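/- For every ε > 0, the bound ∫_T^{2T} J_1(t,G)^4 dt ≪_ε T^{1+ε} holds uniformly for all G with T^{1/5+ε} ≤ G ≤ T (where T ≥ 2). -/

import Mathlib

open Real MeasureTheory

/-- The smoothed moment `J_k(t,G) = (1/(√π G)) ∫_ℝ |ζ(1/2+it+iu)|^{2k} e^{-(u/G)²} du`. -/
noncomputable def J (k : ℕ) (t G : ℝ) : ℝ :=
  (1 / (Real.sqrt Real.pi * G)) *
    ∫ u : ℝ, ‖riemannZeta (1 / 2 + Complex.I * (t : ℂ) + Complex.I * (u : ℂ))‖ ^ (2 * k) *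
      Real.exp (-(u / G) ^ 2)

namespace FM


lemma cpow_sub_bound {n : ℝ} (hn : 0 < n) {s : ℂ} (hs : 0 < s.re) {x : ℝ} (hx : x ∈ Set.Icc n (n+1)) :
    ‖((n+1 : ℝ) : ℂ) ^ (-s) - (x : ℂ) ^ (-s)‖ ≤ ‖s‖ * n ^ (-s.re - 1) := by
  have hs0 : s ≠ 0 := by rintro rfl; simp at hs
  have key := (convex_Icc n (n+1)).norm_image_sub_le_of_norm_hasDerivWithin_le
    (f := fun y : ℝ => (y : ℂ) ^ (-s)) (f' := fun y : ℝ => -s * (y : ℂ) ^ (-s - 1))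
    (C := ‖s‖ * n ^ (-s.re - 1)) (x := x) (y := n + 1) ?_ ?_ hx ⟨by linarith, le_refl _⟩
  · refine key.trans ?_
    have : ‖n + 1 - x‖ ≤ 1 := by
      rw [Real.norm_eq_abs, abs_le]; constructor <;> linarith [hx.1, hx.2]
    calc _ ≤ (‖s‖ * n ^ (-s.re - 1)) * 1 := by gcongr
      _ = _ := by ring
  · intro y hy
    have hy0 : 0 < y := lt_of_lt_of_le hn hy.1
    have := hasDerivAt_ofReal_cpow_const (x := y) hy0.ne' (r := -s) (neg_ne_zero.2 hs0)
    exact this.hasDerivWithinAt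
  · intro y hy
    have hy0 : 0 < y := lt_of_lt_of_le hn hy.1
    rw [norm_mul, norm_neg, Complex.norm_cpow_eq_rpow_re_of_pos hy0]
    have : y ^ ((-s - 1).re) ≤ n ^ (-s.re - 1) := by
      simp only [Complex.sub_re, Complex.neg_re, Complex.one_re]
      exact Real.rpow_le_rpow_of_nonpos hn hy.1 (by linarith)
    gcongr

noncomputable def EE (n : ℕ) (s : ℂ) : ℂ :=
  (s - 1) * ((n : ℂ) + 1) ^ (-s) + ((n : ℂ) + 1) ^ (1 - s) - (n : ℂ) ^ (1 - s)

lemma EE_bound {n : ℕ} (hn : 0 < n) {s : ℂ} (hs : 0 < s.re) :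
    ‖EE n s‖ ≤ ‖s - 1‖ * ‖s‖ * (n : ℝ) ^ (-s.re - 1) := by
  by_cases h1 : s = 1
  · subst h1; simp [EE]
  have hn' : (0 : ℝ) < n := by exact_mod_cast hn
  have key := (convex_Icc (n:ℝ) (n+1)).norm_image_sub_le_of_norm_hasDerivWithin_le
    (f := fun y : ℝ => (s - 1) * (y : ℂ) * (((n : ℝ) + 1 : ℝ) : ℂ) ^ (-s) + (y : ℂ) ^ (1 - s))
    (f' := fun y : ℝ => (s - 1) * ((((n : ℝ) + 1 : ℝ) : ℂ) ^ (-s) - (y : ℂ) ^ (-s)))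
    (C := ‖s - 1‖ * (‖s‖ * (n : ℝ) ^ (-s.re - 1))) (x := n) (y := n + 1) ?_ ?_
    ⟨le_refl _, by linarith⟩ ⟨by linarith, le_refl _⟩
  · simp only [add_sub_cancel_left, norm_one, mul_one] at key
    rw [mul_assoc]
    refine le_trans (le_of_eq ?_) key
    congr 1
    unfold EE
    push_cast
    ring
  · intro y hy
    have hy0 : 0 < y := lt_of_lt_of_le hn' hy.1
    have h4 := hasDerivAt_ofReal_cpow_const (x := y) hy0.ne' (r := 1 - s) (sub_ne_zero.2 (Ne.symm h1))
    rw [show 1 - s - 1 = -s by ring] at h4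
    have h5 : HasDerivAt (fun y : ℝ => (s - 1) * (y : ℂ) * (((n : ℝ) + 1 : ℝ) : ℂ) ^ (-s))
        ((s - 1) * (((n : ℝ) + 1 : ℝ) : ℂ) ^ (-s)) y := by
      have := ((Complex.ofRealCLM.hasDerivAt (x := y)).const_mul (s - 1)).mul_const ((((n : ℝ) + 1 : ℝ) : ℂ) ^ (-s))
      simpa using this
    exact ((h5.fun_add h4).congr_deriv (by ring)).hasDerivWithinAt
  · intro y hy
    rw [norm_mul]
    gcongr
    exact cpow_sub_bound hn' hs hy

lemma EE_sum (N K : ℕ) (s : ℂ) :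
    ∑ k ∈ Finset.range K, EE (N + k) s =
      (s - 1) * (∑ n ∈ Finset.range (N + K), ((n : ℂ) + 1) ^ (-s) - ∑ n ∈ Finset.range N, ((n : ℂ) + 1) ^ (-s))
        + ((N + K : ℕ) : ℂ) ^ (1 - s) - (N : ℂ) ^ (1 - s) := by
  induction K with
  | zero => simp
  | succ K ih =>
    rw [Finset.sum_range_succ, ih, ← add_assoc, Finset.sum_range_succ]
    unfold EE
    push_cast
    ring

lemma summable_EE {N : ℕ} (hN : 0 < N) {σ : ℝ} (hσ : 0 < σ) :
    Summable (fun k : ℕ => ((N + k : ℕ) : ℝ) ^ (-σ - 1)) := by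
  have := (Real.summable_nat_rpow (p := -σ - 1)).2 (by linarith)
  simpa [add_comm] using (summable_nat_add_iff N).2 this

lemma zeta_one_lt {N : ℕ} (hN : 0 < N) {s : ℂ} (hs : 1 < s.re) :
    (s - 1) * riemannZeta s = (s - 1) * ∑ n ∈ Finset.range N, ((n : ℂ) + 1) ^ (-s) + (N : ℂ) ^ (1 - s)
      + ∑' k, EE (N + k) s := by
  have hsum : Summable (fun k => EE (N + k) s) := by
    refine Summable.of_norm_bounded (g := fun k : ℕ => ‖s - 1‖ * ‖s‖ * ((N + k : ℕ) : ℝ) ^ (-s.re - 1))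
      ((summable_EE hN (by linarith)).mul_left _) (fun k => EE_bound (by omega) (by linarith))
  have h1 := hsum.hasSum.tendsto_sum_nat
  have hz : Summable (fun n : ℕ => ((n : ℂ) + 1) ^ (-s)) := by
    have := (Complex.summable_one_div_nat_cpow (p := s)).2 hs
    have := (summable_nat_add_iff 1).2 this
    simpa [Complex.cpow_neg] using this
  have hz2 : HasSum (fun n : ℕ => ((n : ℂ) + 1) ^ (-s)) (riemannZeta s) := by
    rw [zeta_eq_tsum_one_div_nat_add_one_cpow hs]
    convert hz.hasSum using 3
    simp [Complex.cpow_neg]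
  have h2 := hz2.tendsto_sum_nat
  have h3 : Filter.Tendsto (fun K => ∑ n ∈ Finset.range (N + K), ((n : ℂ) + 1) ^ (-s)) Filter.atTop (nhds (riemannZeta s)) := by
    refine h2.comp ?_
    exact Filter.tendsto_atTop_mono (fun K => by simp) Filter.tendsto_id
  have h4 : Filter.Tendsto (fun K => ((N + K : ℕ) : ℂ) ^ (1 - s)) Filter.atTop (nhds 0) := by
    rw [tendsto_zero_iff_norm_tendsto_zero]
    have : ∀ K, ‖((N + K : ℕ) : ℂ) ^ (1 - s)‖ = ((N + K : ℕ) : ℝ) ^ (-(s.re - 1)) := by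
      intro K
      rw [Complex.norm_natCast_cpow_of_pos (by omega)]
      simp
    simp_rw [this]
    have h5 := tendsto_rpow_neg_atTop (y := s.re - 1) (by linarith)
    refine h5.comp (tendsto_natCast_atTop_atTop.comp ?_)
    exact Filter.tendsto_atTop_mono (fun K => by simp) Filter.tendsto_id
  have h5 := ((h3.sub_const (∑ n ∈ Finset.range N, ((n : ℂ) + 1) ^ (-s))).const_mul (s - 1)).add h4 |>.sub_const ((N : ℂ) ^ (1 - s))
  have h6 := tendsto_nhds_unique h1 (h5.congr (fun K => (EE_sum N K s).symm))
  rw [h6]; ring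

lemma zeta_pos {N : ℕ} (hN : 0 < N) {s : ℂ} (hs : 0 < s.re) (hs1 : s ≠ 1) :
    (s - 1) * riemannZeta s = (s - 1) * ∑ n ∈ Finset.range N, ((n : ℂ) + 1) ^ (-s) + (N : ℂ) ^ (1 - s)
      + ∑' k, EE (N + k) s := by
  set R := ‖s‖ + 4 with hR
  set σ := min s.re 1 / 2 with hσ
  have hσ0 : 0 < σ := by have : 0 < min s.re 1 := lt_min hs one_pos
                         linarith
  have hσ1 : σ < 1 := by have : min s.re 1 ≤ 1 := min_le_right _ _
                         linarith
  have hσs : σ < s.re := by have : min s.re 1 ≤ s.re := min_le_left _ _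
                            have : 0 < min s.re 1 := lt_min hs one_pos
                            linarith
  set U : Set ℂ := {z : ℂ | σ < z.re} ∩ Metric.ball 0 R with hU
  have hUo : IsOpen U := (isOpen_lt continuous_const Complex.continuous_re).inter Metric.isOpen_ball
  have hUc : Convex ℝ U := (convex_halfSpace_re_gt σ).inter (convex_ball _ _)
  have hd1 : DifferentiableOn ℂ riemannZeta₁ U := differentiable_riemannZeta₁.differentiableOn
  have hEd : ∀ k, Differentiable ℂ (EE (N + k)) := by
    intro k
    have h1 : ((N + k : ℕ) : ℂ) ≠ 0 := by exact_mod_cast (by omega : N + k ≠ 0)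
    have h2 : ((N + k : ℕ) : ℂ) + 1 ≠ 0 := by exact_mod_cast (by omega : N + k + 1 ≠ 0)
    unfold EE
    intro z
    refine DifferentiableAt.sub (DifferentiableAt.add (DifferentiableAt.mul (by fun_prop) ?_) ?_) ?_
    · exact DifferentiableAt.const_cpow (by fun_prop) (Or.inl h2)
    · exact DifferentiableAt.const_cpow (by fun_prop) (Or.inl h2)
    · exact DifferentiableAt.const_cpow (by fun_prop) (Or.inl h1)
  have hd2 : DifferentiableOn ℂ (fun z => ∑' k, EE (N + k) z) U := by
    refine Complex.differentiableOn_tsum_of_summable_norm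
      (u := fun k : ℕ => (R + 1) * R * ((N + k : ℕ) : ℝ) ^ (-σ - 1))
      ((summable_EE hN hσ0).mul_left _) (fun k => (hEd k).differentiableOn) hUo ?_
    intro k z hz
    have hz1 : σ < z.re := hz.1
    have hz2 : ‖z‖ < R := by simpa using hz.2
    refine (EE_bound (by omega) (by linarith)).trans ?_
    have : ‖z - 1‖ ≤ R + 1 := (norm_sub_le _ _).trans (by simp; linarith)
    have h3 : ((N + k : ℕ) : ℝ) ^ (-z.re - 1) ≤ ((N + k : ℕ) : ℝ) ^ (-σ - 1) := by
      apply Real.rpow_le_rpow_of_exponent_le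
      · exact_mod_cast (by omega : 1 ≤ N + k)
      · linarith
    gcongr
  have hd3 : DifferentiableOn ℂ (fun z => (z - 1) * ∑ n ∈ Finset.range N, ((n : ℂ) + 1) ^ (-z) + (N : ℂ) ^ (1 - z)
      + ∑' k, EE (N + k) z) U := by
    refine DifferentiableOn.add ?_ hd2
    refine Differentiable.differentiableOn ?_
    have h1 : (N : ℂ) ≠ 0 := by exact_mod_cast (by omega : N ≠ 0)
    intro z
    refine DifferentiableAt.add (DifferentiableAt.mul (by fun_prop) ?_) ?_
    · refine DifferentiableAt.fun_sum (fun n _ => ?_)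
      exact DifferentiableAt.const_cpow (by fun_prop) (Or.inl (by exact_mod_cast (by omega : n + 1 ≠ 0)))
    · exact DifferentiableAt.const_cpow (by fun_prop) (Or.inl h1)
  have h2U : (2 : ℂ) ∈ U := ⟨by simp; linarith, by simp [hR]; linarith [norm_nonneg s]⟩
  have hsU : s ∈ U := ⟨hσs, by simp [hR]⟩
  have hz1 : ∀ z : ℂ, z ≠ 1 → riemannZeta₁ z = (z - 1) * riemannZeta z := by
    intro z hz
    rw [riemannZeta_eq_inv_sub_mul hz, mul_inv_cancel_left₀ (sub_ne_zero.2 hz)]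
  have := (hd1.analyticOnNhd hUo).eqOn_of_preconnected_of_eventuallyEq (hd3.analyticOnNhd hUo)
    hUc.isPreconnected h2U (by
      have : {z : ℂ | 1 < z.re} ∈ nhds (2 : ℂ) :=
        (isOpen_lt continuous_const Complex.continuous_re).mem_nhds (by simp)
      filter_upwards [this] with z hz
      rw [hz1 z (by rintro rfl; simp at hz)]
      exact zeta_one_lt hN hz) hsU
  rw [← hz1 s hs1]
  exact this


lemma rpow32 (n : ℕ) (hn : 0 < n) : (n:ℝ) ^ (-(1/2:ℝ) - 1) ≤ 4 * (1 / √n - 1 / √(n+1:ℕ)) := by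
  have hn' : (1:ℝ) ≤ n := by exact_mod_cast hn
  have h0 : (n:ℝ) ^ (-(1/2:ℝ) - 1) = 1 / (√n) ^ 3 := by
    rw [show -(1/2:ℝ) - 1 = -(1/2 * (3:ℕ)) by norm_num, Real.rpow_neg (by positivity), Real.rpow_mul (by positivity),
      Real.rpow_natCast, ← Real.sqrt_eq_rpow, one_div]
  rw [h0]
  have ha : 1 ≤ √(n:ℝ) := Real.one_le_sqrt.2 hn'
  have ha2 : √(n:ℝ) ^ 2 = n := Real.sq_sqrt (by positivity)
  have hb2 : √((n+1:ℕ):ℝ) ^ 2 = n + 1 := by rw [Real.sq_sqrt (by positivity)]; push_cast; ring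
  have hb0 : 0 < √((n+1:ℕ):ℝ) := Real.sqrt_pos.2 (by positivity)
  set a := √(n:ℝ)
  set b := √((n+1:ℕ):ℝ)
  have hab : b ≤ 2 * a := by nlinarith
  have hba : (b - a) * (a + b) = 1 := by nlinarith
  have h3 : b ≤ 4 * a ^ 2 * (b - a) := by
    have : b * (a + b) ≤ 4 * a ^ 2 * (b - a) * (a + b) := by
      rw [mul_assoc (4 * a ^2), hba]; nlinarith
    exact le_of_mul_le_mul_right this (by linarith)
  rw [div_sub_div _ _ (by positivity) (by positivity), ← mul_div_assoc, div_le_div_iff₀ (by positivity) (by positivity)]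
  have := mul_le_mul_of_nonneg_left h3 (by linarith : (0:ℝ) ≤ a)
  nlinarith

noncomputable def SN (N : ℕ) (v : ℝ) : ℂ := ∑ n ∈ Finset.range N, ((n : ℂ) + 1) ^ (-(1/2 + Complex.I * v : ℂ))

lemma zeta_EM {N : ℕ} (hN : 0 < N) (v : ℝ) :
    ‖riemannZeta (1/2 + Complex.I * v) - SN N v‖ ≤ √N / ‖(1/2 + Complex.I * v : ℂ) - 1‖ + 4 * ‖(1/2 + Complex.I * v : ℂ)‖ / √N := by
  set s : ℂ := 1/2 + Complex.I * v with hs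
  have hre : s.re = 1/2 := by simp [hs]
  have hs1 : s ≠ 1 := by intro h; rw [h] at hre; norm_num at hre
  have h := zeta_pos hN (s := s) (by rw [hre]; norm_num) hs1
  have hN' : (0:ℝ) < √N := Real.sqrt_pos.2 (by exact_mod_cast hN)
  have hsum : Summable (fun k : ℕ => ‖s - 1‖ * ‖s‖ * ((N + k : ℕ) : ℝ) ^ (-s.re - 1)) :=
    (summable_EE hN (by rw [hre]; norm_num)).mul_left _
  have h1 : ‖∑' k, EE (N + k) s‖ ≤ ‖s - 1‖ * ‖s‖ * (4 * (1 / √N)) := by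
    refine (tsum_of_norm_bounded hsum.hasSum (fun k => EE_bound (by omega) (by rw [hre]; norm_num))).trans ?_
    rw [tsum_mul_left]
    gcongr
    refine Real.tsum_le_of_sum_range_le (fun k => by positivity) (fun K => ?_)
    have : ∀ K : ℕ, ∑ k ∈ Finset.range K, ((N + k : ℕ) : ℝ) ^ (-s.re - 1) ≤ 4 * (1 / √N - 1 / √(N + K : ℕ)) := by
      intro K
      induction K with
      | zero => simp
      | succ K ih =>
        rw [Finset.sum_range_succ]
        have := rpow32 (N + K) (by omega)
        rw [hre] at ih ⊢
        rw [← add_assoc]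
        linarith
    refine (this K).trans ?_
    have : 0 ≤ 1 / √(N + K : ℕ) := by positivity
    linarith
  have hne : s - 1 ≠ 0 := sub_ne_zero.2 hs1
  have hnn : 0 < ‖s - 1‖ := norm_pos_iff.2 hne
  have h2 : riemannZeta s - SN N v = ((N : ℂ) ^ (1 - s) + ∑' k, EE (N + k) s) / (s - 1) := by
    rw [eq_div_iff hne, SN]
    linear_combination h
  rw [h2, norm_div, div_le_iff₀ hnn]
  refine (norm_add_le _ _).trans ?_
  have h3 : ‖(N : ℂ) ^ (1 - s)‖ = √N := by
    rw [Complex.norm_natCast_cpow_of_pos hN, Real.sqrt_eq_rpow]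
    simp [hre]; norm_num
  rw [h3, add_mul, div_mul_cancel₀ _ hnn.ne']
  have : ‖s - 1‖ * ‖s‖ * (4 * (1 / √N)) = 4 * ‖s‖ / √N * ‖s - 1‖ := by field_simp
  linarith

/-- exponential lower bound -/
lemma exp_lower {x : ℝ} (hx : |x| ≤ 1) : |x| / 2 ≤ ‖1 - Complex.exp (x * Complex.I)‖ := by
  rw [norm_sub_rev, mul_comm, Complex.norm_exp_I_mul_ofReal_sub_one]
  have h := Real.mul_abs_le_abs_sin (x := x / 2) (by rw [abs_div]; norm_num; linarith [Real.pi_gt_three])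
  rw [norm_mul, Real.norm_eq_abs, Real.norm_eq_abs, abs_two]
  have : 1/2 ≤ 2 / π := by rw [div_le_div_iff₀ (by norm_num) Real.pi_pos]; linarith [Real.pi_le_four]
  rw [abs_div, abs_two] at h
  nlinarith [abs_nonneg x]

lemma exp_lip (x y : ℝ) : ‖Complex.exp (x * Complex.I) - Complex.exp (y * Complex.I)‖ ≤ |x - y| := by
  have : Complex.exp (x * Complex.I) - Complex.exp (y * Complex.I)
     = Complex.exp (y * Complex.I) * (Complex.exp (Complex.I * ((x - y : ℝ):ℂ)) - 1) := by
    rw [mul_sub, ← Complex.exp_add]; push_cast; congr 2 <;> ring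
  rw [this, norm_mul, Complex.norm_exp_ofReal_mul_I, one_mul]
  exact Real.norm_exp_I_mul_ofReal_sub_one_le


noncomputable def ee (x : ℝ) : ℂ := Complex.exp (x * Complex.I)
lemma norm_ee (x : ℝ) : ‖ee x‖ = 1 := Complex.norm_exp_ofReal_mul_I x
lemma ee_add (x y : ℝ) : ee (x + y) = ee x * ee y := by
  unfold ee; rw [← Complex.exp_add]; push_cast; congr 1; ring

lemma abel_id (h z : ℕ → ℂ) (K : ℕ) : ∑ k ∈ Finset.range K, h k * (z k - z (k+1)) =
    h 0 * z 0 - h K * z K + ∑ k ∈ Finset.range K, (h (k+1) - h k) * z (k+1) := by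
  induction K with
  | zero => simp
  | succ K ih => rw [Finset.sum_range_succ, ih, Finset.sum_range_succ]; ring

noncomputable def th (v m : ℝ) : ℝ := -(v * (Real.log (m+1) - Real.log m))
noncomputable def hh (v m : ℝ) : ℂ := ((1 / √m : ℝ) : ℂ) / (1 - ee (th v m))

lemma logdiff {m : ℝ} (hm : 1 ≤ m) : 1 / (2 * m) ≤ Real.log (m+1) - Real.log m ∧ Real.log (m+1) - Real.log m ≤ 1 / m := by
  rw [← Real.log_div (by positivity) (by positivity)]
  constructor
  · have := Real.one_sub_inv_le_log_of_pos (x := (m+1)/m) (by positivity)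
    refine le_trans ?_ this
    rw [inv_div, one_sub_div (by positivity), div_le_div_iff₀ (by positivity) (by positivity)]
    linarith
  · have := Real.log_le_sub_one_of_pos (x := (m+1)/m) (by positivity)
    refine this.trans (le_of_eq ?_)
    field_simp; ring

lemma th_bounds {v m : ℝ} (hm : 1 ≤ m) : |v| / (2 * m) ≤ |th v m| ∧ |th v m| ≤ |v| / m := by
  have := logdiff hm
  have h0 : 0 ≤ Real.log (m+1) - Real.log m := le_trans (by positivity) this.1
  rw [th, abs_neg, abs_mul, abs_of_nonneg h0, div_eq_mul_one_div, div_eq_mul_one_div |v| m]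
  exact ⟨by gcongr; exact this.1, by gcongr; exact this.2⟩

lemma den_lower {v m : ℝ} (hm : 1 ≤ m) (hv : |v| ≤ m) : |v| / (4 * m) ≤ ‖1 - ee (th v m)‖ := by
  have h := th_bounds (v := v) hm
  have h1 : |th v m| ≤ 1 := h.2.trans (div_le_one_of_le₀ hv (by linarith))
  refine le_trans ?_ (exp_lower h1)
  have : |v| / (4 * m) = |v| / (2 * m) / 2 := by field_simp; norm_num
  rw [this]; linarith [h.1]

lemma hh_bound {v m : ℝ} (hm : 1 ≤ m) (hv : |v| ≤ m) (hv1 : 1 ≤ |v|) : ‖hh v m‖ ≤ 4 * √m / |v| := by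
  have h := den_lower hm hv
  have hs : 0 < √m := Real.sqrt_pos.2 (by linarith)
  have hss : √m * √m = m := Real.mul_self_sqrt (by linarith)
  have hp : 0 < |v| / (4 * m) := by positivity
  rw [hh, norm_div, Complex.norm_real, Real.norm_eq_abs, abs_of_nonneg (by positivity), div_le_iff₀ (by linarith)]
  calc 1 / √m = 4 * √m / |v| * (|v| / (4 * m)) := by
        field_simp; nlinarith
    _ ≤ _ := by gcongr

lemma th_diff {v m : ℝ} (hm : 1 ≤ m) : |th v m - th v (m+1)| ≤ |v| / (m * (m+1)) := by
  have h1 : th v m - th v (m+1) = - (v * Real.log ((m+1)^2 / (m * (m+1+1)))) := by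
    rw [Real.log_div (by positivity) (by positivity), Real.log_mul (by positivity) (by positivity), Real.log_pow]
    unfold th; push_cast; ring
  have h2 := Real.log_le_sub_one_of_pos (x := (m+1)^2/(m * (m+1+1))) (by positivity)
  have h3 : 0 ≤ Real.log ((m+1)^2 / (m * (m+1+1))) := Real.log_nonneg (by
    rw [one_le_div (by positivity)]; nlinarith)
  rw [h1, abs_neg, abs_mul, abs_of_nonneg h3, div_eq_mul_one_div |v| (m * (m+1))]
  gcongr
  refine h2.trans ?_
  rw [div_sub_one (by positivity), div_le_div_iff₀ (by positivity) (by positivity)]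
  nlinarith

lemma sqrt_step {m : ℝ} (hm : 1 ≤ m) : 1 / √m ≤ 3 * (√(m+1) - √m) ∧ 1 / √m - 1 / √(m+1) ≤ 1 / (√m * m) ∧ 0 ≤ 1 / √m - 1 / √(m+1) := by
  have ha : 1 ≤ √m := Real.one_le_sqrt.2 hm
  have ha2 : √m ^ 2 = m := Real.sq_sqrt (by linarith)
  have hb2 : √(m+1) ^ 2 = m + 1 := Real.sq_sqrt (by linarith)
  have hb0 : 0 < √(m+1) := Real.sqrt_pos.2 (by linarith)
  set a := √m
  set b := √(m+1)
  have hab : a ≤ b := by nlinarith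
  have hab2 : b ≤ 2 * a := by nlinarith
  have hba : (b - a) * (a + b) = 1 := by nlinarith
  refine ⟨?_, ?_, ?_⟩
  · rw [div_le_iff₀ (by linarith)]; nlinarith
  · rw [← ha2, div_sub_div _ _ (by positivity) (by positivity), div_le_div_iff₀ (by positivity) (by positivity)]
    have h1 : b - a ≤ 1 := by nlinarith
    have h2 : (b - a) * a ≤ 1 := by nlinarith
    have h3 : (b-a) * a * a ≤ b := by nlinarith
    have := mul_le_mul_of_nonneg_right h3 (by positivity : 0 ≤ a)
    nlinarith
  · rw [sub_nonneg]; gcongr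

lemma hh_diff {v m : ℝ} (hm : 1 ≤ m) (hv : |v| ≤ m) (hv1 : 1 ≤ |v|) :
    ‖hh v (m+1) - hh v m‖ ≤ 60 / |v| * (√(m+1) - √m) := by
  have d1 := den_lower hm hv
  have d2 := den_lower (v := v) (m := m+1) (by linarith) (by linarith)
  have hv0 : 0 < |v| := by linarith
  have p1 : 0 < |v| / (4 * m) := by positivity
  have p2 : 0 < |v| / (4 * (m+1)) := by positivity
  have hs : 0 < √m := Real.sqrt_pos.2 (by linarith)
  have hs1 : 0 < √(m+1) := Real.sqrt_pos.2 (by linarith)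
  obtain ⟨s1, s2, s3⟩ := sqrt_step hm
  have n1 : 1 - ee (th v m) ≠ 0 := norm_pos_iff.1 (by linarith)
  have n2 : 1 - ee (th v (m+1)) ≠ 0 := norm_pos_iff.1 (by linarith)
  have key : hh v (m+1) - hh v m = -(((1 / √m - 1 / √(m+1) : ℝ) : ℂ) / (1 - ee (th v m)))
      - ((1 / √(m+1) : ℝ) : ℂ) * (ee (th v m) - ee (th v (m+1))) / ((1 - ee (th v m)) * (1 - ee (th v (m+1)))) := by
    unfold hh
    rw [Complex.ofReal_sub]
    field_simp
    ring
  rw [key]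
  refine (norm_sub_le _ _).trans ?_
  have e1 : ‖-(((1 / √m - 1 / √(m+1) : ℝ) : ℂ) / (1 - ee (th v m)))‖ ≤ 4 / |v| * (1 / √m) := by
    rw [norm_neg, norm_div, Complex.norm_real, Real.norm_eq_abs, abs_of_nonneg s3, div_le_iff₀ (by linarith)]
    refine s2.trans ?_
    calc 1 / (√m * m) = 4 / |v| * (1 / √m) * (|v| / (4 * m)) := by field_simp
      _ ≤ _ := by gcongr
  have e2 : ‖((1 / √(m+1) : ℝ) : ℂ) * (ee (th v m) - ee (th v (m+1))) / ((1 - ee (th v m)) * (1 - ee (th v (m+1))))‖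
      ≤ 16 / |v| * (1 / √m) := by
    rw [norm_div, norm_mul, norm_mul, Complex.norm_real, Real.norm_eq_abs, abs_of_nonneg (by positivity), div_le_iff₀ (mul_pos (by linarith) (by linarith))]
    calc (1 / √(m+1)) * ‖ee (th v m) - ee (th v (m+1))‖ ≤ (1 / √m) * (|v| / (m * (m+1))) := by
          gcongr
          · linarith
          · exact (exp_lip _ _).trans (th_diff hm)
      _ = 16 / |v| * (1 / √m) * ((|v| / (4 * m)) * (|v| / (4 * (m+1)))) := by field_simp; norm_num
      _ ≤ _ := by gcongr
  have : 20 / |v| * (1 / √m) ≤ 20 / |v| * (3 * (√(m+1) - √m)) := by gcongr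
  calc _ ≤ 4 / |v| * (1 / √m) + 16 / |v| * (1 / √m) := add_le_add e1 e2
    _ = 20 / |v| * (1 / √m) := by ring
    _ ≤ _ := this
    _ = _ := by ring

lemma term_ee {m : ℝ} (v : ℝ) (hm : 0 < m) :
    (m : ℂ) ^ (-(1/2 + Complex.I * v : ℂ)) = ((1 / √m : ℝ) : ℂ) * ee (-(v * Real.log m)) := by
  have hm0 : (m:ℂ) ≠ 0 := by exact_mod_cast hm.ne'
  rw [neg_add, Complex.cpow_add _ _ hm0]
  congr 1
  · have : (1 / √m : ℝ) = m ^ (-(1/2:ℝ)) := by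
      rw [Real.rpow_neg (by linarith), ← Real.sqrt_eq_rpow, one_div]
    rw [this, Complex.ofReal_cpow (by linarith)]
    push_cast; rfl
  · rw [Complex.cpow_def_of_ne_zero hm0, ← Complex.ofReal_log (by linarith), ee]
    congr 1; push_cast; ring

lemma term_eq {v m : ℝ} (hm : 1 ≤ m) (hv : |v| ≤ m) (hv1 : 1 ≤ |v|) :
    (m : ℂ) ^ (-(1/2 + Complex.I * v : ℂ)) = hh v m * (ee (-(v * Real.log m)) - ee (-(v * Real.log (m+1)))) := by
  have d1 := den_lower hm hv
  have p1 : 0 < |v| / (4 * m) := by positivity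
  have n1 : 1 - ee (th v m) ≠ 0 := norm_pos_iff.1 (by linarith)
  have h1 : ee (-(v * Real.log (m+1))) = ee (-(v * Real.log m)) * ee (th v m) := by
    rw [← ee_add]; congr 1; unfold th; ring
  rw [h1, hh]
  rw [term_ee v (by linarith)]; field_simp

lemma kusmin {N K : ℕ} {v : ℝ} (hv1 : 1 ≤ |v|) (hv : |v| ≤ N) :
    ‖SN (N + K) v - SN N v‖ ≤ 70 * √(N + 1 + K) / |v| := by
  have h1 : SN (N + K) v - SN N v = ∑ k ∈ Finset.range K, hh v (N + 1 + k) *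
      (ee (-(v * Real.log (N + 1 + k))) - ee (-(v * Real.log (N + 1 + (k+1:ℕ))))) := by
    unfold SN
    rw [Finset.sum_range_add, add_sub_cancel_left]
    refine Finset.sum_congr rfl (fun k _ => ?_)
    have := term_eq (v := v) (m := N + 1 + k) (by linarith [(Nat.cast_nonneg N : (0:ℝ) ≤ N), (Nat.cast_nonneg k : (0:ℝ) ≤ k)]) 
      (by linarith [(Nat.cast_nonneg k : (0:ℝ) ≤ k)]) hv1
    rw [show (N:ℝ) + 1 + (k+1:ℕ) = N + 1 + k + 1 by push_cast; ring, ← this]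
    congr 1
    push_cast; ring
  have hN0 : (0:ℝ) ≤ N := Nat.cast_nonneg N
  have hK0 : (0:ℝ) ≤ K := Nat.cast_nonneg K
  have hm : ∀ k : ℕ, (1:ℝ) ≤ N + 1 + k := fun k => by linarith [(Nat.cast_nonneg k : (0:ℝ) ≤ k)]
  have hm2 : ∀ k : ℕ, |v| ≤ N + 1 + k := fun k => by linarith [(Nat.cast_nonneg k : (0:ℝ) ≤ k)]
  rw [h1, abel_id (fun k => hh v (N + 1 + k)) (fun k => ee (-(v * Real.log (N + 1 + k))))]
  have b1 : ∑ k ∈ Finset.range K, ‖(hh v (N + 1 + (k+1:ℕ)) - hh v (N + 1 + k)) * ee (-(v * Real.log (N + 1 + (k+1:ℕ))))‖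
      ≤ 60 / |v| * (√(N + 1 + K) - √(N+1 + (0:ℕ))) := by
    rw [← Finset.sum_range_sub (fun k : ℕ => √((N:ℝ) + 1 + k)), Finset.mul_sum]
    refine Finset.sum_le_sum (fun k _ => ?_)
    rw [norm_mul, norm_ee, mul_one, show (N:ℝ) + 1 + (k+1:ℕ) = N + 1 + k + 1 by push_cast; ring]
    exact hh_diff (hm k) (hm2 k) hv1
  have hv0 : 0 < |v| := by linarith
  have b2 : ∀ k : ℕ, k ≤ K → ‖hh v (N + 1 + k) * ee (-(v * Real.log (N + 1 + k)))‖ ≤ 4 * √(N + 1 + K) / |v| := by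
    intro k hk
    rw [norm_mul, norm_ee, mul_one]
    refine (hh_bound (hm k) (hm2 k) hv1).trans ?_
    have : (k:ℝ) ≤ K := by exact_mod_cast hk
    gcongr
  refine (norm_add_le _ _).trans ?_
  have b3 := (norm_sub_le (hh v (N + 1 + (0:ℕ)) * ee (-(v * Real.log (N + 1 + (0:ℕ))))) (hh v (N + 1 + K) * ee (-(v * Real.log (N + 1 + K))))).trans
    (add_le_add (b2 0 (Nat.zero_le _)) (b2 K le_rfl))
  have b4 := (norm_sum_le _ _).trans b1
  have b5 : 0 ≤ 60 / |v| * √(N+1 + (0:ℕ)) := by positivity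
  have b6 : 0 ≤ √((N:ℝ)+1 + K) / |v| := by positivity
  have e : 70 * √(N + 1 + K) / |v| = 70 * (√((N:ℝ)+1 + K) / |v|) := by ring
  have e2 : 4 * √(N + 1 + K) / |v| = 4 * (√((N:ℝ)+1 + K) / |v|) := by ring
  have e3 : 60 / |v| * (√(N + 1 + K) - √(N+1 + (0:ℕ))) = 60 * (√((N:ℝ)+1 + K) / |v|) - 60 / |v| * √(N+1 + (0:ℕ)) := by ring
  rw [e]; rw [e2] at b3; rw [e3] at b4
  linarith


lemma zeta_err1 {N : ℕ} (hN : 0 < N) (v : ℝ) :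
    ‖riemannZeta (1/2 + Complex.I * v) - SN N v‖ ≤ 2 * √N + 4 * (1 + |v|) := by
  refine (zeta_EM hN v).trans ?_
  have hs : 1 ≤ √(N:ℝ) := Real.one_le_sqrt.2 (by exact_mod_cast hN)
  have h1 : 1/2 ≤ ‖(1/2 + Complex.I * v : ℂ) - 1‖ := by
    refine le_trans ?_ (Complex.abs_re_le_norm _)
    simp; norm_num
  have h2 : ‖(1/2 + Complex.I * v : ℂ)‖ ≤ 1 + |v| := by
    refine (norm_add_le _ _).trans ?_
    simp; norm_num
  have h3 : √N / ‖(1/2 + Complex.I * v : ℂ) - 1‖ ≤ 2 * √N := by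
    rw [div_le_iff₀ (by linarith)]; nlinarith
  have h4 : 4 * ‖(1/2 + Complex.I * v : ℂ)‖ / √N ≤ 4 * (1 + |v|) := by
    rw [div_le_iff₀ (by linarith)]
    have : 0 ≤ |v| := abs_nonneg v
    nlinarith
  linarith

lemma zeta_err2 {N : ℕ} (hN : 0 < N) {v : ℝ} (hv : |v| ≤ N) :
    ‖riemannZeta (1/2 + Complex.I * v) - SN N v‖ ≤ 400 * (1 + √N / (1 + |v|)) := by
  have hN1 : (1:ℝ) ≤ N := by exact_mod_cast hN
  have hs : 1 ≤ √(N:ℝ) := Real.one_le_sqrt.2 hN1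
  have ha : 0 ≤ |v| := abs_nonneg v
  rcases le_total |v| 1 with h | h
  · refine (zeta_err1 hN v).trans ?_
    have : √N / 2 ≤ √N / (1 + |v|) := by gcongr; linarith
    linarith
  · set K := ⌈v ^ 2⌉₊ with hK
    have hK1 : v ^ 2 ≤ K := Nat.le_ceil _
    have hK2 : (K:ℝ) ≤ v ^ 2 + 1 := (Nat.ceil_lt_add_one (by positivity)).le
    have k1 := kusmin (K := K) h hv
    have k2 := zeta_EM (N := N + K) (by omega) v
    have h1 : |v| ≤ ‖(1/2 + Complex.I * v : ℂ) - 1‖ := by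
      refine le_trans ?_ (Complex.abs_im_le_norm _)
      simp
    have h2 : ‖(1/2 + Complex.I * v : ℂ)‖ ≤ 2 * |v| := by
      refine (norm_add_le _ _).trans ?_
      simp; norm_num; linarith
    have hvs : |v| ≤ √((N + K : ℕ):ℝ) := by
      apply Real.le_sqrt_of_sq_le; rw [sq_abs]; push_cast; linarith
    have hv0 : 0 < |v| := by linarith
    have h3 : 4 * ‖(1/2 + Complex.I * v : ℂ)‖ / √((N + K : ℕ):ℝ) ≤ 8 := by
      rw [div_le_iff₀ (by linarith)]; linarith
    have h5 : √((N:ℝ) + 1 + K) ≤ 2 * √N + |v| := by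
      apply Real.sqrt_le_iff.2 ⟨by positivity, ?_⟩
      have := Real.sq_sqrt (by linarith : (0:ℝ) ≤ N)
      have hh : 0 ≤ √(N:ℝ) * |v| := by positivity
      nlinarith [sq_abs v]
    have h6 : √((N + K : ℕ):ℝ) ≤ 2 * √N + |v| := by
      refine le_trans (Real.sqrt_le_sqrt ?_) h5
      push_cast; linarith
    have h4 : √((N + K : ℕ):ℝ) / ‖(1/2 + Complex.I * v : ℂ) - 1‖ ≤ 2 * (√N / |v|) + 1 := by
      rw [div_le_iff₀ (by linarith)]
      calc _ ≤ 2 * √N + |v| := h6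
        _ = (2 * (√N / |v|) + 1) * |v| := by field_simp
        _ ≤ _ := by gcongr
    have h7 : 70 * √((N:ℝ) + 1 + K) / |v| ≤ 140 * (√N / |v|) + 70 := by
      rw [div_le_iff₀ hv0]
      calc _ ≤ 70 * (2 * √N + |v|) := by gcongr
        _ = (140 * (√N / |v|) + 70) * |v| := by field_simp; ring
    have h8 : √N / |v| ≤ 2 * (√N / (1 + |v|)) := by
      rw [← mul_div_assoc, div_le_div_iff₀ hv0 (by linarith)]; nlinarith
    have h9 : ‖riemannZeta (1/2 + Complex.I * v) - SN N v‖ ≤ _ := norm_sub_le_norm_sub_add_norm_sub _ (SN (N+K) v) _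
    have h10 : 0 ≤ √(N:ℝ) / (1 + |v|) := by positivity
    linarith


lemma gauss_int {G : ℝ} (hG : 0 < G) : Integrable (fun u : ℝ => Real.exp (-(u / G) ^ 2)) := by
  have := integrable_exp_neg_mul_sq (b := 1 / G ^ 2) (by positivity)
  refine this.congr (Filter.Eventually.of_forall fun u => ?_)
  simp only; congr 1; rw [div_pow]; ring

lemma gauss_val {G : ℝ} (hG : 0 < G) : ∫ u : ℝ, Real.exp (-(u / G) ^ 2) = √π * G := by
  have := integral_gaussian (1 / G ^ 2)
  rw [div_div_eq_mul_div, div_one, Real.sqrt_mul Real.pi_pos.le, Real.sqrt_sq hG.le] at this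
  rw [← this]
  refine integral_congr_ae (Filter.Eventually.of_forall fun u => ?_)
  simp only; congr 1; rw [div_pow]; ring

lemma gauss_cos_int {G : ℝ} (hG : 0 < G) (t L : ℝ) :
    Integrable (fun u : ℝ => Real.cos ((t + u) * L) * Real.exp (-(u / G) ^ 2)) := by
  refine (gauss_int hG).bdd_mul (c := 1) (by fun_prop) (Filter.Eventually.of_forall fun u => ?_)
  exact Real.abs_cos_le_one _

lemma gauss_cos {G : ℝ} (hG : 0 < G) (t L : ℝ) :
    ∫ u : ℝ, Real.cos ((t + u) * L) * Real.exp (-(u / G) ^ 2) =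
      √π * G * (Real.cos (t * L) * Real.exp (-(G ^ 2 / 4 * L ^ 2))) := by
  have hb : 0 < (((1 / G ^ 2 : ℝ) : ℂ)).re := by rw [Complex.ofReal_re]; positivity
  have h := fourierIntegral_gaussian hb (L : ℂ)
  have h1 : ∀ u : ℝ, ee (t * L) * (Complex.exp (Complex.I * L * u) * Complex.exp (-((1 / G ^ 2 : ℝ) : ℂ) * (u:ℂ) ^ 2))
      = ee ((t + u) * L) * ((Real.exp (-(u / G) ^ 2) : ℝ) : ℂ) := by
    intro u
    unfold ee
    push_cast
    rw [← Complex.exp_add, ← Complex.exp_add, ← Complex.exp_add]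
    congr 1
    rw [div_pow]; ring
  have h2 : ∫ u : ℝ, ee ((t + u) * L) * ((Real.exp (-(u / G) ^ 2) : ℝ) : ℂ) =
      ee (t * L) * ((√π * G * Real.exp (-(G ^ 2 / 4 * L ^ 2)) : ℝ) : ℂ) := by
    simp_rw [← h1]
    rw [integral_const_mul, h]
    congr 1
    have e1 : ((π : ℂ) / ((1 / G ^ 2 : ℝ) : ℂ)) = ((π * G ^ 2 : ℝ) : ℂ) := by
      push_cast; field_simp
    rw [e1, show (1/2 : ℂ) = ((1/2 : ℝ) : ℂ) by push_cast; rfl, ← Complex.ofReal_cpow (by positivity), ← Real.sqrt_eq_rpow,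
      Real.sqrt_mul Real.pi_pos.le, Real.sqrt_sq hG.le, Complex.ofReal_mul (√π * G), Complex.ofReal_exp]
    congr 2
    push_cast
    field_simp
  have h3 : Integrable (fun u : ℝ => ee ((t + u) * L) * ((Real.exp (-(u / G) ^ 2) : ℝ) : ℂ)) := by
    refine ((gauss_int hG).ofReal).bdd_mul (c := 1) ?_ (Filter.Eventually.of_forall fun u => (norm_ee _).le)
    unfold ee; fun_prop
  have h4 := congrArg Complex.re h2
  have h5 := Complex.reCLM.integral_comp_comm h3
  simp only [Complex.reCLM_apply] at h5
  rw [← h5] at h4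
  have h6 : ∀ x : ℝ, (ee x).re = Real.cos x := fun x => Complex.exp_ofReal_mul_I_re x
  simp only [Complex.re_mul_ofReal, h6] at h4
  rw [h4]; ring

noncomputable def ll (m n : ℕ) : ℝ := Real.log (m + 1) - Real.log (n + 1)
noncomputable def BB (N : ℕ) (t G : ℝ) : ℝ := ∑ m ∈ Finset.range N, ∑ n ∈ Finset.range N,
  (1 / √((m:ℝ) + 1)) * (1 / √((n:ℝ) + 1)) * (Real.cos (t * ll m n) * Real.exp (-(G ^ 2 / 4 * ll m n ^ 2)))

lemma SN_sq (N : ℕ) (v : ℝ) : ‖SN N v‖ ^ 2 = ∑ m ∈ Finset.range N, ∑ n ∈ Finset.range N,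
    (1 / √((m:ℝ) + 1)) * (1 / √((n:ℝ) + 1)) * Real.cos (v * ll m n) := by
  have h : SN N v = ∑ m ∈ Finset.range N, ((1 / √((m:ℝ) + 1) : ℝ) : ℂ) * ee (-(v * Real.log ((m:ℝ) + 1))) := by
    refine Finset.sum_congr rfl fun m _ => ?_
    rw [← term_ee v (by positivity)]; push_cast; rfl
  have hre : ∀ x : ℝ, (ee x).re = Real.cos x := fun x => Complex.exp_ofReal_mul_I_re x
  have him : ∀ x : ℝ, (ee x).im = Real.sin x := fun x => Complex.exp_ofReal_mul_I_im x
  rw [← Complex.normSq_eq_norm_sq, Complex.normSq_apply, h]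
  simp only [Complex.re_sum, Complex.im_sum, Complex.re_ofReal_mul, Complex.im_ofReal_mul, hre, him]
  rw [Finset.sum_mul_sum, Finset.sum_mul_sum, ← Finset.sum_add_distrib]
  refine Finset.sum_congr rfl fun m _ => ?_
  rw [← Finset.sum_add_distrib]
  refine Finset.sum_congr rfl fun n _ => ?_
  have : v * ll m n = -(v * Real.log ((n:ℝ) + 1)) - -(v * Real.log ((m:ℝ)+1)) := by unfold ll; ring
  rw [this, Real.cos_sub]; ring

lemma SN_gauss {G : ℝ} (hG : 0 < G) (N : ℕ) (t : ℝ) :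
    Integrable (fun u : ℝ => ‖SN N (t + u)‖ ^ 2 * Real.exp (-(u / G) ^ 2)) ∧
    ∫ u : ℝ, ‖SN N (t + u)‖ ^ 2 * Real.exp (-(u / G) ^ 2) = √π * G * BB N t G := by
  simp_rw [SN_sq, Finset.sum_mul, mul_assoc _ (Real.cos _) (Real.exp _)]
  have hi : ∀ m n : ℕ, Integrable (fun u : ℝ => (1 / √((m:ℝ) + 1)) * (1 / √((n:ℝ) + 1)) * (Real.cos ((t + u) * ll m n) * Real.exp (-(u / G) ^ 2))) :=
    fun m n => (gauss_cos_int hG _ _).const_mul _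
  constructor
  · exact integrable_finsetSum _ fun m _ => integrable_finsetSum _ fun n _ => hi m n
  · rw [integral_finsetSum _ fun m _ => integrable_finsetSum _ fun n _ => hi m n, BB, Finset.mul_sum]
    refine Finset.sum_congr rfl fun m _ => ?_
    rw [integral_finsetSum _ fun n _ => hi m n, Finset.mul_sum]
    refine Finset.sum_congr rfl fun n _ => ?_
    rw [integral_const_mul, gauss_cos hG]; ring

lemma err_pt {K : ℕ} {T G t u : ℝ} {N : ℕ} (hT : 2 ≤ T) (hG1 : 1 ≤ G) (hGT : G ≤ T) (ht : T ≤ t) (ht2 : t ≤ 2 * T)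
    {R : ℝ} (hR : 1 ≤ R) (hK : T ≤ R ^ K) (hN : 8 * (T * R) ≤ N) :
    ‖riemannZeta (1/2 + Complex.I * ((t + u : ℝ) : ℂ)) - SN N (t + u)‖ ^ 2 ≤
      320000 * (1 + N / (1 + (t+u)^2) + (u / G) ^ (2 * K + 2)) := by
  have hN1 : (1:ℝ) ≤ N := by nlinarith
  have hN0 : 0 < N := by exact_mod_cast (by linarith : (0:ℝ) < N)
  have hp : 0 ≤ (u / G) ^ (2 * K + 2) := by
    rw [show 2 * K + 2 = 2 * (K+1) by ring, pow_mul]; positivity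
  set v := t + u with hv
  have hsN := Real.sq_sqrt (by linarith : (0:ℝ) ≤ N)
  have hsN0 := Real.sqrt_nonneg (N:ℝ)
  rcases le_or_gt |v| N with h | h
  · have h1 := zeta_err2 hN0 h
    have h2 := pow_le_pow_left₀ (norm_nonneg _) h1 2
    refine h2.trans ?_
    have h3 : (√N / (1 + |v|)) ^ 2 ≤ N / (1 + v ^ 2) := by
      rw [div_pow, hsN]; gcongr
      nlinarith [abs_nonneg v, sq_abs v]
    nlinarith [sq_nonneg (1 - √N / (1 + |v|))]
  · have h1 := zeta_err1 hN0 v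
    have hsq : √(N:ℝ) ≤ N := by nlinarith [Real.one_le_sqrt.2 hN1]
    have h2 : ‖riemannZeta (1/2 + Complex.I * v) - SN N v‖ ≤ 10 * |v| := by linarith
    have h3 : |v| ≤ 2 * |u| := by
      have : |v| ≤ |t| + |u| := abs_add_le _ _
      rw [abs_of_nonneg (by linarith : 0 ≤ t)] at this
      nlinarith
    have h4 := pow_le_pow_left₀ (norm_nonneg _) (h2.trans (by linarith : 10 * |v| ≤ 20 * |u|)) 2
    refine h4.trans ?_
    have hG0 : 0 < G := by linarith
    have h5 : R ≤ |u| / G := by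
      rw [le_div_iff₀ hG0]
      have : R * G ≤ T * R := by nlinarith
      nlinarith
    have h6 : G ≤ (|u| / G) ^ K := hGT.trans (hK.trans (pow_le_pow_left₀ (by linarith) h5 K))
    have h7 : |u| ^ 2 ≤ (u / G) ^ (2 * K + 2) := by
      have : (u / G) ^ (2 * K + 2) = (|u| / G) ^ (2 * K + 2) := by
        have hx : (|u| / G) ^ 2 = (u / G) ^ 2 := by rw [div_pow, div_pow, sq_abs]
        rw [show 2 * K + 2 = 2 * (K+1) by ring, pow_mul, pow_mul, hx]
      rw [this]
      calc |u| ^ 2 = G ^ 2 * (|u| / G) ^ 2 := by field_simp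
        _ ≤ ((|u| / G) ^ K) ^ 2 * (|u| / G) ^ 2 := by gcongr
        _ = _ := by ring
    have h8 : 0 ≤ (N:ℝ) / (1 + v^2) := by positivity
    nlinarith


lemma gauss_mom (K : ℕ) : ∃ c : ℝ, 0 ≤ c ∧ ∀ G : ℝ, 0 < G →
    Integrable (fun u : ℝ => (u / G) ^ (2 * K + 2) * Real.exp (-(u / G) ^ 2)) ∧
    ∫ u : ℝ, (u / G) ^ (2 * K + 2) * Real.exp (-(u / G) ^ 2) = √π * G * c := by
  have h0 : Integrable (fun x : ℝ => x ^ (2 * K + 2) * Real.exp (-x ^ 2)) := by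
    have := integrable_rpow_mul_exp_neg_mul_sq (b := 1) one_pos (s := ((2 * K + 2 : ℕ) : ℝ)) (by
      have : (0:ℝ) ≤ ((2 * K + 2 : ℕ) : ℝ) := Nat.cast_nonneg _
      linarith)
    simpa only [Real.rpow_natCast, neg_mul, one_mul] using this
  refine ⟨(∫ x : ℝ, x ^ (2 * K + 2) * Real.exp (-x ^ 2)) / √π, ?_, fun G hG => ⟨h0.comp_div hG.ne', ?_⟩⟩
  · refine div_nonneg (integral_nonneg fun x => ?_) (Real.sqrt_nonneg _)
    have : 0 ≤ x ^ (2 * K + 2) := by rw [show 2 * K + 2 = 2 * (K+1) by ring, pow_mul]; positivity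
    positivity
  · have := Measure.integral_comp_div (fun x : ℝ => x ^ (2 * K + 2) * Real.exp (-x ^ 2)) G
    rw [this, abs_of_pos hG, smul_eq_mul]
    have := Real.sqrt_pos.2 Real.pi_pos
    field_simp

lemma cauchy_int (t : ℝ) : Integrable (fun u : ℝ => 1 / (1 + (t + u) ^ 2)) ∧ ∫ u : ℝ, 1 / (1 + (t + u) ^ 2) = π := by
  constructor
  · simpa [one_div] using integrable_inv_one_add_sq.comp_add_left t
  · have := integral_add_left_eq_self (μ := volume) (fun x : ℝ => (1 + x ^ 2)⁻¹) t
    simp only [one_div]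
    rw [this, integral_univ_inv_one_add_sq]

lemma cross_pt {T G t u : ℝ} (hT : 2 ≤ T) (hG : 0 < G) (ht : T ≤ t) :
    1 / (1 + (t + u) ^ 2) * Real.exp (-(u / G) ^ 2) ≤ 4 / T ^ 2 * Real.exp (-(u / G) ^ 2) + 4 * G ^ 2 / T ^ 2 * (1 / (1 + (t + u) ^ 2)) := by
  rcases le_or_gt (T/2) |t + u| with h | h
  · have : 1 / (1 + (t+u)^2) ≤ 4 / T ^ 2 := by
      rw [div_le_div_iff₀ (by positivity) (by positivity)]
      nlinarith [sq_abs (t+u), abs_nonneg (t+u)]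
    have h2 : 0 ≤ 4 * G ^ 2 / T ^ 2 * (1 / (1 + (t + u) ^ 2)) := by positivity
    have := mul_le_mul_of_nonneg_right this (Real.exp_pos (-(u / G) ^ 2)).le
    linarith
  · have hu : T / 2 ≤ |u| := by
      have := (abs_lt.1 h).2
      rw [le_abs]; right; linarith
    have h1 : Real.exp (-(u / G) ^ 2) ≤ 4 * G ^ 2 / T ^ 2 := by
      have e := Real.add_one_le_exp ((u / G) ^ 2)
      rw [Real.exp_neg]
      have hT2 : T ^ 2 / (4 * G ^ 2) ≤ (u / G) ^ 2 := by
        rw [div_pow, div_le_div_iff₀ (by positivity) (by positivity)]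
        have : T ^ 2 ≤ 4 * u ^ 2 := by nlinarith [sq_abs u]
        nlinarith [sq_nonneg G]
      rw [inv_le_comm₀ (Real.exp_pos _) (by positivity), inv_div]
      linarith
    have h2 : 0 ≤ 4 / T ^ 2 * Real.exp (-(u / G) ^ 2) := by positivity
    have := mul_le_mul_of_nonneg_left h1 (by positivity : 0 ≤ 1 / (1 + (t + u) ^ 2))
    linarith

lemma J_le (K : ℕ) : ∃ C : ℝ, 0 < C ∧ ∀ (T G t R : ℝ) (N : ℕ), 2 ≤ T → 1 ≤ G → G ≤ T → T ≤ t → t ≤ 2 * T →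
    1 ≤ R → T ≤ R ^ K → 8 * (T * R) ≤ N → N ≤ 32 * (T * R) → J 1 t G ≤ 2 * BB N t G + C * R := by
  obtain ⟨c, hc, hmom⟩ := gauss_mom K
  refine ⟨640000 * (1 + 128 + c + 128 * √π), by positivity, ?_⟩
  intro T G t R N hT hG1 hGT ht ht2 hR hK hN hN2
  have hG0 : 0 < G := by linarith
  obtain ⟨mi, mv⟩ := hmom G hG0
  obtain ⟨ci, cv⟩ := cauchy_int t
  obtain ⟨si, sv⟩ := SN_gauss hG0 N t
  have gi := gauss_int hG0
  have gv := gauss_val hG0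
  set g : ℝ → ℝ := fun u => 2 * (‖SN N (t + u)‖ ^ 2 * Real.exp (-(u / G) ^ 2)) +
    640000 * ((1 + N * (4 / T ^ 2)) * Real.exp (-(u / G) ^ 2) + (u / G) ^ (2 * K + 2) * Real.exp (-(u / G) ^ 2)
      + N * (4 * G ^ 2 / T ^ 2) * (1 / (1 + (t + u) ^ 2))) with hg
  have i1 := (gi.const_mul (1 + N * (4 / T ^ 2)))
  have i2 := ci.const_mul (N * (4 * G ^ 2 / T ^ 2))
  have gint : Integrable g := (si.const_mul 2).add (((i1.add mi).add i2).const_mul 640000)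
  have gval : ∫ u, g u = 2 * (√π * G * BB N t G) + 640000 * ((1 + N * (4 / T ^ 2)) * (√π * G) + √π * G * c + N * (4 * G ^ 2 / T ^ 2) * π) := by
    refine (integral_add (si.const_mul 2) (((i1.add mi).add i2).const_mul 640000)).trans ?_
    rw [integral_const_mul, integral_const_mul, sv]
    congr 2
    refine (integral_add (i1.add mi) i2).trans ?_
    rw [integral_const_mul, cv]
    congr 1
    refine (integral_add i1 mi).trans ?_
    rw [integral_const_mul, gv, mv]
  have hle : ∫ u : ℝ, ‖riemannZeta (1 / 2 + Complex.I * (t : ℂ) + Complex.I * (u : ℂ))‖ ^ (2 * 1) * Real.exp (-(u / G) ^ 2) ≤ ∫ u, g u := by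
    refine integral_mono_of_nonneg (Filter.Eventually.of_forall fun u => by positivity) gint (Filter.Eventually.of_forall fun u => ?_)
    have e := err_pt (u := u) hT hG1 hGT ht ht2 hR hK hN
    have hz : (1 / 2 + Complex.I * (t : ℂ) + Complex.I * (u : ℂ)) = 1/2 + Complex.I * ((t + u : ℝ) : ℂ) := by push_cast; ring
    simp only [hz, mul_one, hg]
    have hE := Real.exp_pos (-(u / G) ^ 2)
    have cp := mul_le_mul_of_nonneg_left (cross_pt (u := u) hT hG0 ht) (Nat.cast_nonneg N : (0:ℝ) ≤ N)
    set z := riemannZeta (1/2 + Complex.I * ((t + u : ℝ) : ℂ))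
    have tri : ‖z‖ ≤ ‖z - SN N (t+u)‖ + ‖SN N (t+u)‖ := by
      simpa using norm_add_le (z - SN N (t+u)) (SN N (t+u))
    have h2 : ‖z‖ ^ 2 ≤ 2 * ‖SN N (t+u)‖ ^ 2 + 2 * ‖z - SN N (t+u)‖ ^ 2 := by
      nlinarith [sq_nonneg (‖z - SN N (t+u)‖ - ‖SN N (t+u)‖), norm_nonneg z]
    have h3 := mul_le_mul_of_nonneg_right (h2.trans (by linarith [e] : _ ≤ 2 * ‖SN N (t+u)‖ ^ 2 + 2 * (320000 * (1 + N / (1 + (t+u)^2) + (u / G) ^ (2 * K + 2))))) hE.le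
    have e1 : (N:ℝ) / (1 + (t+u)^2) = N * (1 / (1 + (t+u)^2)) := by ring
    rw [e1] at h3
    nlinarith
  have hπ := Real.sqrt_pos.2 Real.pi_pos
  have hππ := Real.mul_self_sqrt Real.pi_pos.le
  unfold J
  calc _ ≤ (1 / (√π * G)) * ∫ u, g u := by gcongr
    _ = 2 * BB N t G + 640000 * (1 + 4 * (N / T ^ 2) + c + 4 * (N / T ^ 2 * G) * √π) := by
        rw [gval]
        have e2 : N * (4 * G ^ 2 / T ^ 2) * π = (√π * G) * (4 * (N / T ^ 2 * G) * √π) := by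
          linear_combination (-(N * (4 * G ^ 2 / T ^ 2))) * hππ
        rw [e2]
        field_simp
    _ ≤ _ := by
        have n1 : N / T ^ 2 * G ≤ 32 * R := by
          rw [div_mul_eq_mul_div, div_le_iff₀ (by positivity)]
          calc (N:ℝ) * G ≤ (32 * (T * R)) * T := by gcongr
            _ = _ := by ring
        have n2 : N / T ^ 2 ≤ 32 * R := by
          refine le_trans ?_ n1
          exact le_mul_of_one_le_right (by positivity) hG1
        have n3 := mul_le_mul_of_nonneg_right n1 hπ.le
        nlinarith


lemma symm_sum (f : ℕ → ℕ → ℝ) (hf : ∀ m n, f m n = f n m) (N : ℕ) :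
    ∑ m ∈ Finset.range N, ∑ n ∈ Finset.range N, f m n =
      ∑ m ∈ Finset.range N, f m m + 2 * ∑ n ∈ Finset.range N, ∑ m ∈ Finset.Ico (n+1) N, f m n := by
  induction N with
  | zero => simp
  | succ N ih =>
    have h1 : ∑ n ∈ Finset.range (N+1), ∑ m ∈ Finset.Ico (n+1) (N+1), f m n =
        ∑ n ∈ Finset.range N, ∑ m ∈ Finset.Ico (n+1) N, f m n + ∑ n ∈ Finset.range N, f N n := by
      rw [Finset.sum_range_succ, Finset.Ico_self, Finset.sum_empty, add_zero, ← Finset.sum_add_distrib]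
      refine Finset.sum_congr rfl fun n hn => ?_
      rw [Finset.sum_Ico_succ_top (by have := Finset.mem_range.1 hn; omega)]
    rw [h1, Finset.sum_range_succ]
    simp_rw [Finset.sum_range_succ]
    rw [Finset.sum_add_distrib, ih]
    have : ∑ x ∈ Finset.range N, f x N = ∑ x ∈ Finset.range N, f N x := Finset.sum_congr rfl fun x _ => hf _ _
    rw [this]; ring

noncomputable def tht (y : ℝ) : ℝ := Real.log (1 + 1 / y)

/-- amplitude without cutoff -/
noncomputable def am (G y : ℝ) : ℝ := 1 / √(y * (y + 1)) * Real.exp (-(G ^ 2 / 4 * tht y ^ 2))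

lemma BB_split {N M : ℕ} (hNM : N ≤ M) (t G : ℝ) : BB N t G = ∑ m ∈ Finset.range N, 1 / ((m:ℝ) + 1) +
    2 * ∑ n ∈ Finset.range M, ∑ r ∈ Finset.range M, if n + r + 2 ≤ N then
      1 / ((r:ℝ) + 1) * (am G (((n:ℝ) + 1) / ((r:ℝ) + 1)) * Real.cos (t * tht (((n:ℝ) + 1) / ((r:ℝ) + 1)))) else 0 := by
  unfold BB
  rw [symm_sum]
  · congr 1
    · refine Finset.sum_congr rfl fun m _ => ?_
      have : (0:ℝ) < (m:ℝ) + 1 := by positivity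
      have h2 := Real.mul_self_sqrt this.le
      have h3 := Real.sqrt_pos.2 this
      simp only [ll, sub_self, mul_zero, Real.cos_zero, ne_eq, OfNat.ofNat_ne_zero, not_false_eq_true, zero_pow, neg_zero, Real.exp_zero, mul_one]
      rw [one_div_mul_one_div, h2]
    · congr 1
      have : ∀ n ∈ Finset.range M, n ∉ Finset.range N → (∑ r ∈ Finset.range M, if n + r + 2 ≤ N then
        1 / ((r:ℝ) + 1) * (am G (((n:ℝ) + 1) / ((r:ℝ) + 1)) * Real.cos (t * tht (((n:ℝ) + 1) / ((r:ℝ) + 1)))) else 0) = 0 := by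
        intro n _ hn
        rw [Finset.mem_range] at hn
        refine Finset.sum_eq_zero fun r _ => ?_
        rw [if_neg (by omega)]
      rw [← Finset.sum_subset (Finset.range_mono hNM) this]
      refine Finset.sum_congr rfl fun n hn => ?_
      rw [Finset.sum_Ico_eq_sum_range]
      have h2 : Finset.range (N - (n+1)) = (Finset.range M).filter (fun r => n + r + 2 ≤ N) := by
        ext r; simp only [Finset.mem_range, Finset.mem_filter]; omega
      rw [h2, Finset.sum_filter]
      refine Finset.sum_congr rfl fun r _ => ?_
      split_ifs
      swap
      · rfl
      have pr : (0:ℝ) < (r:ℝ) + 1 := by positivity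
      have pn : (0:ℝ) < (n:ℝ) + 1 := by positivity
      have hl : ll (n + 1 + r) n = tht (((n:ℝ) + 1) / ((r:ℝ) + 1)) := by
        unfold ll tht
        rw [← Real.log_div (by positivity) (by positivity)]
        congr 1
        push_cast
        field_simp
        ring
      have hs : 1 / √(((n + 1 + r : ℕ):ℝ) + 1) * (1 / √((n:ℝ) + 1)) = 1 / ((r:ℝ) + 1) *
          (1 / √(((n:ℝ) + 1) / ((r:ℝ) + 1) * (((n:ℝ) + 1) / ((r:ℝ) + 1) + 1))) := by
        have e : ((n:ℝ) + 1) / ((r:ℝ) + 1) * (((n:ℝ) + 1) / ((r:ℝ) + 1) + 1) = (((n + 1 + r : ℕ):ℝ) + 1) * ((n:ℝ) + 1) / ((r:ℝ) + 1) ^ 2 := by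
          push_cast; field_simp; ring
        rw [e, Real.sqrt_div (by positivity), Real.sqrt_sq pr.le, Real.sqrt_mul (by positivity)]
        field_simp
      rw [hl, hs, am]; ring
  · intro m n
    have : ll m n = - ll n m := by unfold ll; ring
    rw [this, mul_neg, Real.cos_neg, neg_sq]; ring

/-- The bump. -/
noncomputable def bmp : ContDiffBump (3/2 : ℝ) := ⟨1/4, 1/2, by norm_num, by norm_num⟩
noncomputable def chi (x : ℝ) : ℝ := bmp.normed volume x
lemma chi_nonneg (x : ℝ) : 0 ≤ chi x := bmp.nonneg_normed x
lemma chi_contDiff : ContDiff ℝ ((⊤ : ℕ∞) : WithTop ℕ∞) chi := bmp.contDiff_normed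
lemma chi_int : ∫ x, chi x = 1 := bmp.integral_normed
lemma chi_integrable : Integrable chi := bmp.integrable_normed
lemma chi_zero {x : ℝ} (hx : x ≤ 1 ∨ 2 ≤ x) : chi x = 0 := by
  by_contra h
  have h1 : x ∈ Function.support chi := h
  have : Function.support chi = Metric.ball (3/2:ℝ) (1/2) := bmp.support_normed_eq
  rw [this, Metric.mem_ball, Real.dist_eq, abs_lt] at h1
  rcases hx with h | h <;> linarith [h1.1, h1.2]

noncomputable def chit (x : ℝ) : ℝ := x * chi x
lemma chit_contDiff : ContDiff ℝ ((⊤ : ℕ∞) : WithTop ℕ∞) chit := contDiff_id.mul chi_contDiff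
lemma chit_zero {x : ℝ} (hx : x ≤ 1 ∨ 2 ≤ x) : chit x = 0 := by rw [chit, chi_zero hx, mul_zero]
lemma chit_nonneg (x : ℝ) : 0 ≤ chit x := by
  rcases le_total x 1 with h | h
  · rw [chit_zero (Or.inl h)]
  · exact mul_nonneg (by linarith) (chi_nonneg x)

/-- weight of a term after averaging -/
lemma W_eq {a c : ℝ} (hc : 0 < c) (ha : 1 ≤ a) :
    Integrable (fun ρ : ℝ => if a < ρ then chit (ρ * c) / ρ else 0) ∧
    ∫ ξ : ℝ, (if a * c ≤ ξ then chi ξ else 0) = ∫ ρ : ℝ, (if a < ρ then chit (ρ * c) / ρ else 0) := by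
  have h1 : (fun ρ : ℝ => if a < ρ then chit (ρ * c) / ρ else 0) = (Set.Ioi a).indicator (fun ρ => c * chi (ρ * c)) := by
    ext ρ
    by_cases h : a < ρ
    · rw [if_pos h, Set.indicator_of_mem (Set.mem_Ioi.2 h), chit]
      have : ρ ≠ 0 := by linarith
      field_simp
    · rw [if_neg h, Set.indicator_of_notMem (by exact h)]
  have h2 : (fun ξ : ℝ => if a * c ≤ ξ then chi ξ else 0) = (Set.Ici (a * c)).indicator chi := by
    ext ξ
    by_cases h : a * c ≤ ξ
    · rw [if_pos h, Set.indicator_of_mem (by exact h)]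
    · rw [if_neg h, Set.indicator_of_notMem (by exact h)]
  rw [h1, h2]
  constructor
  · exact ((chi_integrable.comp_mul_right' hc.ne').const_mul c).indicator measurableSet_Ioi
  · rw [integral_indicator measurableSet_Ici, integral_indicator measurableSet_Ioi, integral_Ici_eq_integral_Ioi,
      integral_const_mul, integral_comp_mul_right_Ioi _ _ hc, smul_eq_mul, mul_inv_cancel_left₀ hc.ne']


noncomputable def yy (n r : ℕ) : ℝ := ((n:ℝ) + 1) / ((r:ℝ) + 1)
noncomputable def coef (I : Finset ℕ) (t : ℕ → ℝ) (G : ℝ) (n r : ℕ) : ℝ :=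
  1 / ((r:ℝ) + 1) * (am G (yy n r) * ∑ i ∈ I, Real.cos (t i * tht (yy n r)))
noncomputable def DD (M : ℕ) (I : Finset ℕ) (t : ℕ → ℝ) (G X ρ : ℝ) : ℝ :=
  ∑ n ∈ Finset.range M, ∑ r ∈ Finset.range M,
    coef I t G n r * (if (r:ℝ) + 1 < ρ then chit (ρ * ((yy n r + 1) / X)) else 0)

lemma yy_pos (n r : ℕ) : 0 < yy n r := by unfold yy; positivity

lemma harm_le (N : ℕ) : ∑ m ∈ Finset.range N, 1 / ((m:ℝ) + 1) ≤ 1 + Real.log N := by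
  have := harmonic_le_one_add_log N
  refine le_trans (le_of_eq ?_) this
  simp [harmonic]

lemma avg_step (K : ℕ) : ∃ C : ℝ, 0 < C ∧ ∀ (T G R X Mb : ℝ) (I : Finset ℕ) (t : ℕ → ℝ) (M : ℕ), 2 ≤ T → 1 ≤ G → G ≤ T →
    (∀ i ∈ I, T ≤ t i ∧ t i ≤ 2 * T) → 1 ≤ R → T ≤ R ^ K → X = 16 * (T * R) → 2 * X ≤ M →
    (∀ ρ, 1 < ρ → ρ ≤ 2 * X → |DD M I t G X ρ| ≤ Mb) →
    ∑ i ∈ I, J 1 (t i) G ≤ (I.card : ℝ) * (C * R + 2 * (1 + Real.log M)) + 4 * (Mb * Real.log (2 * X)) := by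
  obtain ⟨C, hC, hJ⟩ := J_le K
  refine ⟨C, hC, ?_⟩
  intro T G R X Mb I t M hT hG hGT ht hR hK hX hM hD
  have hTR : 2 ≤ T * R := by nlinarith
  have hX0 : 0 < X := by rw [hX]; linarith
  have hac : ∀ n r : ℕ, ((r:ℝ) + 1) * ((yy n r + 1) / X) = (n + r + 2 : ℕ) / X := by
    intro n r; unfold yy; push_cast; field_simp; ring
  set E := ∑ i ∈ I, J 1 (t i) G - (I.card : ℝ) * (C * R + 2 * (1 + Real.log M)) with hE
  have key : ∀ ξ : ℝ, E * chi ξ ≤ 4 * ∑ n ∈ Finset.range M, ∑ r ∈ Finset.range M,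
      coef I t G n r * (if ((r:ℝ) + 1) * ((yy n r + 1) / X) ≤ ξ then chi ξ else 0) := by
    intro ξ
    by_cases hξ : ξ ≤ 1 ∨ 2 ≤ ξ
    · simp [chi_zero hξ]
    push Not at hξ
    obtain ⟨h1, h2⟩ := hξ
    set N := ⌊ξ * X⌋₊ with hN
    have n1 : (N:ℝ) ≤ ξ * X := Nat.floor_le (by positivity)
    have n2 : ξ * X < N + 1 := Nat.lt_floor_add_one _
    have n3 : 8 * (T * R) ≤ N := by nlinarith
    have n4 : (N:ℝ) ≤ 32 * (T * R) := by nlinarith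
    have n5 : N ≤ M := by exact_mod_cast (by nlinarith : (N:ℝ) ≤ M)
    have hN1 : (1:ℝ) ≤ N := by linarith
    have hlog : Real.log N ≤ Real.log M := Real.log_le_log (by linarith) (by exact_mod_cast n5)
    have hi : ∀ i ∈ I, J 1 (t i) G ≤ (C * R + 2 * (1 + Real.log M)) + 4 * ∑ n ∈ Finset.range M, ∑ r ∈ Finset.range M, if n + r + 2 ≤ N then
      1 / ((r:ℝ) + 1) * (am G (((n:ℝ) + 1) / ((r:ℝ) + 1)) * Real.cos (t i * tht (((n:ℝ) + 1) / ((r:ℝ) + 1)))) else 0 := by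
      intro i hiI
      have := hJ T G (t i) R N hT hG hGT (ht i hiI).1 (ht i hiI).2 hR hK n3 n4
      rw [BB_split n5] at this
      have hh := harm_le N
      linarith
    have hs := Finset.sum_le_sum hi
    rw [Finset.sum_add_distrib, Finset.sum_const, nsmul_eq_mul, ← Finset.mul_sum] at hs
    have e1 : ∑ i ∈ I, ∑ n ∈ Finset.range M, ∑ r ∈ Finset.range M, (if n + r + 2 ≤ N then
      1 / ((r:ℝ) + 1) * (am G (((n:ℝ) + 1) / ((r:ℝ) + 1)) * Real.cos (t i * tht (((n:ℝ) + 1) / ((r:ℝ) + 1)))) else 0)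
      = ∑ n ∈ Finset.range M, ∑ r ∈ Finset.range M, coef I t G n r * (if ((r:ℝ) + 1) * ((yy n r + 1) / X) ≤ ξ then 1 else 0) := by
      rw [Finset.sum_comm]
      refine Finset.sum_congr rfl fun n _ => ?_
      rw [Finset.sum_comm]
      refine Finset.sum_congr rfl fun r _ => ?_
      have : (n + r + 2 ≤ N) ↔ ((r:ℝ) + 1) * ((yy n r + 1) / X) ≤ ξ := by
        rw [hac, div_le_iff₀ hX0, hN, Nat.le_floor_iff (by positivity)]
      by_cases hc : n + r + 2 ≤ N
      · rw [if_pos (this.1 hc), mul_one]; simp only [if_pos hc, coef, yy, Finset.mul_sum]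
      · simp only [if_neg hc, if_neg (fun h => hc (this.2 h)), mul_zero, Finset.sum_const_zero]
    rw [e1] at hs
    have hE2 : E ≤ 4 * ∑ n ∈ Finset.range M, ∑ r ∈ Finset.range M, coef I t G n r * (if ((r:ℝ) + 1) * ((yy n r + 1) / X) ≤ ξ then 1 else 0) := by
      rw [hE]; linarith
    refine (mul_le_mul_of_nonneg_right hE2 (chi_nonneg ξ)).trans (le_of_eq ?_)
    simp only [mul_assoc, Finset.sum_mul, ite_mul, one_mul, zero_mul]
  have hcpos : ∀ n r, 0 < (yy n r + 1) / X := fun n r => by have := yy_pos n r; positivity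
  have hr1 : ∀ r : ℕ, (1:ℝ) ≤ (r:ℝ) + 1 := fun r => by linarith [(Nat.cast_nonneg r : (0:ℝ) ≤ r)]
  have ii : ∀ n r : ℕ, Integrable (fun ξ => coef I t G n r * (if ((r:ℝ) + 1) * ((yy n r + 1) / X) ≤ ξ then chi ξ else 0)) := by
    intro n r
    refine Integrable.const_mul ?_ _
    exact chi_integrable.indicator (s := Set.Ici (((r:ℝ) + 1) * ((yy n r + 1) / X))) measurableSet_Ici
  have h3 := integral_mono (chi_integrable.const_mul E)
    ((integrable_finsetSum _ fun n _ => integrable_finsetSum _ fun r _ => ii n r).const_mul 4) key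
  rw [integral_const_mul, chi_int, mul_one, integral_const_mul, integral_finsetSum _ (fun n _ => integrable_finsetSum _ fun r _ => ii n r)] at h3
  have ij : ∀ n r : ℕ, Integrable (fun ρ : ℝ => coef I t G n r * (if (r:ℝ) + 1 < ρ then chit (ρ * ((yy n r + 1) / X)) / ρ else 0)) :=
    fun n r => (W_eq (hcpos n r) (hr1 r)).1.const_mul _
  have e2 : ∑ n ∈ Finset.range M, ∫ ξ, ∑ r ∈ Finset.range M, coef I t G n r * (if ((r:ℝ) + 1) * ((yy n r + 1) / X) ≤ ξ then chi ξ else 0)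
      = ∫ ρ, DD M I t G X ρ / ρ := by
    have : ∀ ρ, DD M I t G X ρ / ρ = ∑ n ∈ Finset.range M, ∑ r ∈ Finset.range M, coef I t G n r * (if (r:ℝ) + 1 < ρ then chit (ρ * ((yy n r + 1) / X)) / ρ else 0) := by
      intro ρ
      simp only [DD, Finset.sum_div, mul_div_assoc, ite_div, zero_div]
    simp_rw [this]
    rw [integral_finsetSum _ (fun n _ => integrable_finsetSum _ fun r _ => ij n r)]
    refine Finset.sum_congr rfl fun n _ => ?_
    rw [integral_finsetSum _ fun r _ => ij n r, integral_finsetSum _ fun r _ => ii n r]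
    refine Finset.sum_congr rfl fun r _ => ?_
    rw [integral_const_mul, integral_const_mul, (W_eq (hcpos n r) (hr1 r)).2]
  rw [e2] at h3
  have hX2 : 1 ≤ 2 * X := by rw [hX]; linarith
  have bi : IntegrableOn (fun ρ : ℝ => Mb * ρ⁻¹) (Set.Ioc 1 (2 * X)) := by
    have : IntervalIntegrable (fun ρ : ℝ => ρ⁻¹) volume 1 (2 * X) := intervalIntegral.intervalIntegrable_inv (by
      intro x hx; rw [Set.uIcc_of_le hX2] at hx; linarith [hx.1]) continuousOn_id
    exact ((intervalIntegrable_iff_integrableOn_Ioc_of_le hX2).1 this).const_mul _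
  have h4 : ‖∫ ρ, DD M I t G X ρ / ρ‖ ≤ ∫ ρ, (Set.Ioc 1 (2 * X)).indicator (fun ρ : ℝ => Mb * ρ⁻¹) ρ := by
    refine norm_integral_le_of_norm_le ((integrable_indicator_iff measurableSet_Ioc).2 bi) (Filter.Eventually.of_forall fun ρ => ?_)
    by_cases hρ : ρ ∈ Set.Ioc 1 (2 * X)
    · rw [Set.indicator_of_mem hρ, norm_div, Real.norm_eq_abs, Real.norm_eq_abs, abs_of_pos (by linarith [hρ.1] : 0 < ρ), div_eq_mul_inv]
      have := hD ρ hρ.1 hρ.2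
      have : 0 < ρ := by linarith [hρ.1]
      gcongr
    · rw [Set.indicator_of_notMem hρ]
      have : DD M I t G X ρ = 0 := by
        refine Finset.sum_eq_zero fun n _ => Finset.sum_eq_zero fun r _ => ?_
        split_ifs with h
        · have h5 : 1 < ρ := lt_of_le_of_lt (hr1 r) h
          have h6 : 2 * X < ρ := by
            by_contra h7; exact hρ ⟨h5, not_lt.1 h7⟩
          rw [chit_zero, mul_zero]
          right
          rw [← mul_div_assoc, le_div_iff₀ hX0]
          nlinarith [yy_pos n r]
        · rw [mul_zero]
      simp [this]
  rw [integral_indicator measurableSet_Ioc, integral_const_mul, ← intervalIntegral.integral_of_le hX2, integral_inv_of_pos one_pos (by linarith), div_one] at h4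
  have h5 := (le_abs_self _).trans h4
  rw [hE] at h3
  linarith


lemma hasDerivAt_ee {f : ℝ → ℝ} {f' x : ℝ} (h : HasDerivAt f f' x) :
    HasDerivAt (fun y => ee (f y)) (ee (f x) * (f' * Complex.I)) x := by
  unfold ee
  exact (h.ofReal_comp.mul_const Complex.I).cexp

lemma ibp {a c : ℝ} (h : a ≤ c) {B B' P P' Φ Φ' : ℝ → ℝ}
    (hB : ∀ y ∈ Set.Icc a c, HasDerivAt B (B' y) y) (hP : ∀ y ∈ Set.Icc a c, HasDerivAt P (P' y) y)
    (hΦ : ∀ y ∈ Set.Icc a c, HasDerivAt Φ (Φ' y) y) (cB : ContinuousOn B' (Set.Icc a c))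
    (cP : ContinuousOn P' (Set.Icc a c)) (cΦ : ContinuousOn Φ' (Set.Icc a c)) (ha : B a = 0) (hc : B c = 0) :
    ‖∫ y in a..c, ((B y * P y * Φ' y : ℝ) : ℂ) * ee (Φ y)‖ ≤ ∫ y in a..c, (|B' y| * |P y| + |B y| * |P' y|) := by
  have cB0 : ContinuousOn B (Set.Icc a c) := fun y hy => (hB y hy).continuousAt.continuousWithinAt
  have cP0 : ContinuousOn P (Set.Icc a c) := fun y hy => (hP y hy).continuousAt.continuousWithinAt
  have cE : ContinuousOn (fun y => ee (Φ y)) (Set.Icc a c) := fun y hy => (hasDerivAt_ee (hΦ y hy)).continuousAt.continuousWithinAt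
  have c1 : ContinuousOn (fun y => ((B y * P y * Φ' y : ℝ) : ℂ) * ee (Φ y)) (Set.Icc a c) :=
    (Complex.continuous_ofReal.comp_continuousOn ((cB0.mul cP0).mul cΦ)).mul cE
  have c2 : ContinuousOn (fun y => ((B' y * P y + B y * P' y : ℝ) : ℂ) * ee (Φ y)) (Set.Icc a c) :=
    (Complex.continuous_ofReal.comp_continuousOn ((cB.mul cP0).add (cB0.mul cP))).mul cE
  have i1 := c1.intervalIntegrable_of_Icc (μ := volume) h
  have i2 := c2.intervalIntegrable_of_Icc (μ := volume) h
  have key : ∫ y in a..c, (((B' y * P y + B y * P' y : ℝ) : ℂ) * ee (Φ y) + Complex.I * (((B y * P y * Φ' y : ℝ) : ℂ) * ee (Φ y))) = 0 := by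
    rw [intervalIntegral.integral_eq_sub_of_hasDerivAt (f := fun y => ((B y * P y : ℝ) : ℂ) * ee (Φ y))]
    · simp [ha, hc]
    · intro y hy
      rw [Set.uIcc_of_le h] at hy
      refine ((((hB y hy).mul (hP y hy)).ofReal_comp).mul (hasDerivAt_ee (hΦ y hy))).congr_deriv ?_
      simp only [Pi.mul_apply]
      push_cast; ring
    · exact i2.add (i1.const_mul _)
  rw [intervalIntegral.integral_add i2 (i1.const_mul _), intervalIntegral.integral_const_mul] at key
  have h3 : ‖∫ y in a..c, ((B y * P y * Φ' y : ℝ) : ℂ) * ee (Φ y)‖ = ‖∫ y in a..c, ((B' y * P y + B y * P' y : ℝ) : ℂ) * ee (Φ y)‖ := by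
    rw [eq_neg_of_add_eq_zero_left key, norm_neg, norm_mul, Complex.norm_I, one_mul]
  rw [h3]
  refine intervalIntegral.norm_integral_le_of_norm_le h (Filter.Eventually.of_forall fun y _ => ?_) ?_
  · rw [norm_mul, norm_ee, mul_one, Complex.norm_real, Real.norm_eq_abs, ← abs_mul, ← abs_mul]
    exact abs_add_le _ _
  · exact ((cB.abs.mul cP0.abs).add (cB0.abs.mul cP.abs)).intervalIntegrable_of_Icc h

noncomputable def eta (y : ℝ) : ℝ := 1 / (y * (y + 1))

lemma tht_deriv {y : ℝ} (hy : 0 < y) : HasDerivAt tht (-eta y) y := by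
  unfold tht eta
  have h1 : HasDerivAt (fun y : ℝ => 1 + 1 / y) (-(1 / y^2)) y := by
    have := (hasDerivAt_inv hy.ne').const_add 1
    simpa [one_div] using this
  refine (h1.log (by positivity)).congr_deriv ?_
  field_simp

structure Amp (b b' : ℝ → ℝ) (β Y : ℝ) : Prop where
  der : ∀ y, HasDerivAt b (b' y) y
  cont : Continuous b'
  bd : ∀ y, |b y| ≤ β
  bd' : ∀ y, |b' y| ≤ β / Y
  supp : ∀ y, y ≤ Y - 1 ∨ 2 * Y - 1 ≤ y → b y = 0

lemma Amp.cts {b b' : ℝ → ℝ} {β Y : ℝ} (h : Amp b b' β Y) : Continuous b :=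
  continuous_iff_continuousAt.2 fun y => (h.der y).continuousAt

/-- the correlation integrals -/
noncomputable def Ij (b : ℝ → ℝ) (j : ℕ) (t t' : ℝ) : ℂ :=
  ∫ y : ℝ, ((b (y + j) * b y : ℝ) : ℂ) * ee (t * tht (y + j) - t' * tht y)

lemma Ij_eq {b b' : ℝ → ℝ} {β Y : ℝ} (h : Amp b b' β Y) (hY : 4 ≤ Y) (j : ℕ) (t t' : ℝ) :
    Ij b j t t' = ∫ y in (Y-1)..(2*Y-1), ((b (y + j) * b y : ℝ) : ℂ) * ee (t * tht (y + j) - t' * tht y) := by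
  rw [intervalIntegral.integral_of_le (by linarith), Ij, setIntegral_eq_integral_of_forall_compl_eq_zero]
  intro y hy
  rw [h.supp y, mul_zero, Complex.ofReal_zero, zero_mul]
  simp only [Set.mem_Ioc, not_and_or, not_lt, not_le] at hy
  rcases hy with hy | hy
  · exact Or.inl hy
  · exact Or.inr hy.le

lemma Ij_zero {b b' : ℝ → ℝ} {β Y : ℝ} (h : Amp b b' β Y) (j : ℕ) (hj : Y ≤ j) (t t' : ℝ) : Ij b j t t' = 0 := by
  unfold Ij
  rw [← integral_zero ℝ ℂ]
  congr 1; ext y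
  rcases le_total y (Y-1) with hy | hy
  · simp [h.supp y (Or.inl hy)]
  · simp [h.supp (y + j) (Or.inr (by linarith))]

lemma Ij_triv {b b' : ℝ → ℝ} {β Y : ℝ} (h : Amp b b' β Y) (hY : 4 ≤ Y) (j : ℕ) (t t' : ℝ) : ‖Ij b j t t'‖ ≤ β ^ 2 * Y := by
  rw [Ij_eq h hY]
  refine (intervalIntegral.norm_integral_le_of_norm_le_const (C := β^2) ?_).trans ?_
  · intro y _
    rw [norm_mul, norm_ee, mul_one, Complex.norm_real, Real.norm_eq_abs, abs_mul, sq]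
    exact mul_le_mul (h.bd _) (h.bd _) (abs_nonneg _) ((abs_nonneg _).trans (h.bd 0))
  · rw [show (2 * Y - 1 - (Y-1)) = Y by ring, abs_of_nonneg (by linarith)]


noncomputable def qq (j y : ℝ) : ℝ := y * (y + 1) / ((y + j) * (y + j + 1))
noncomputable def qd (j y : ℝ) : ℝ := j * (2 * y * (y + j) + y + (y + j) + 1) / ((y + j) * (y + j + 1)) ^ 2

lemma qq_deriv {j y : ℝ} (hj : 0 ≤ j) (hy : 0 < y) : HasDerivAt (qq j) (qd j y) y := by
  unfold qq qd
  have h1 : HasDerivAt (fun y : ℝ => y * (y + 1)) (2 * y + 1) y :=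
    ((hasDerivAt_id y).mul ((hasDerivAt_id y).add_const 1)).congr_deriv (by simp; ring)
  have h2 : HasDerivAt (fun y : ℝ => (y + j) * (y + j + 1)) (2 * (y + j) + 1) y :=
    (((hasDerivAt_id y).add_const j).mul (((hasDerivAt_id y).add_const j).add_const 1)).congr_deriv (by simp; ring)
  refine (h1.div h2 (by positivity)).congr_deriv ?_
  congr 1; ring

lemma qd_cont {j : ℝ} (hj : 0 ≤ j) {s : Set ℝ} (hs : ∀ y ∈ s, 0 < y) : ContinuousOn (qd j) s := by
  unfold qd
  refine ContinuousOn.div (by fun_prop) (by fun_prop) fun y hy => ?_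
  have := hs y hy
  positivity

lemma qd_nonneg {j y : ℝ} (hj : 0 ≤ j) (hy : 0 < y) : 0 ≤ qd j y := by unfold qd; positivity

lemma qd_le {j y Y : ℝ} (hj : 0 ≤ j) (hY : 4 ≤ Y) (hy : Y - 1 ≤ y) : qd j y ≤ 6 * j / Y ^ 2 := by
  unfold qd
  have h0 : 0 < y := by linarith
  rw [div_le_div_iff₀ (by positivity) (by positivity)]
  have h1 : 3 * Y / 4 ≤ y := by linarith
  set z := y + j with hz
  have hzy : y ≤ z := by linarith
  have e1 : 2 * y * z + y + z + 1 ≤ 3 * (z * (z + 1)) := by nlinarith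
  have e2 : Y ^ 2 ≤ 2 * (z * (z + 1)) := by nlinarith
  have e3 : 0 < z * (z + 1) := by nlinarith
  calc j * (2 * y * z + y + z + 1) * Y ^ 2 ≤ j * (3 * (z * (z + 1))) * (2 * (z * (z + 1))) := by gcongr
    _ = _ := by ring

lemma le_qd {j y Y : ℝ} (hj : 0 ≤ j) (hY : 4 ≤ Y) (hy : Y - 1 ≤ y) (hy2 : y ≤ 2 * Y - 1) (hjY : j ≤ Y) : j / (18 * Y ^ 2) ≤ qd j y := by
  unfold qd
  have h0 : 0 < y := by linarith
  rw [div_le_div_iff₀ (by positivity) (by positivity)]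
  have h1 : 3 * Y / 4 ≤ y := by linarith
  set z := y + j with hz
  have hzy : y ≤ z := by linarith
  have hz0 : 0 < z := by linarith
  have e1 : (z * (z + 1)) ^ 2 ≤ 9 * Y ^ 2 * (3 * Y * z) := by
    have a1 : z + 1 ≤ 3 * Y := by linarith
    calc (z * (z + 1)) ^ 2 = (z + 1) ^ 2 * (z * z) := by ring
      _ ≤ (3 * Y) ^ 2 * (3 * Y * z) := by gcongr; linarith
      _ = _ := by ring
  have e2 : 3 * Y * z ≤ 2 * (2 * y * z + y + z + 1) := by nlinarith
  calc j * (z * (z + 1)) ^ 2 ≤ j * (9 * Y ^ 2 * (2 * (2 * y * z + y + z + 1))) := by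
        gcongr; exact e1.trans (by gcongr)
    _ = _ := by ring

lemma one_sub_qq {j y Y : ℝ} (hj : 0 ≤ j) (hY : 4 ≤ Y) (hy : Y - 1 ≤ y) (hy2 : y ≤ 2 * Y - 1) (hjY : j ≤ Y) : j / (4 * Y) ≤ 1 - qq j y := by
  unfold qq
  have h0 : 0 < y := by linarith
  have e : 1 - y * (y + 1) / ((y + j) * (y + j + 1)) = j * (2 * y + j + 1) / ((y + j) * (y + j + 1)) := by
    field_simp; ring
  rw [e, div_le_div_iff₀ (by linarith) (by positivity)]
  have : (y + j) * (y + j + 1) ≤ (2 * y + j + 1) * (4 * Y) := by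
    apply mul_le_mul <;> nlinarith
  calc j * ((y + j) * (y + j + 1)) ≤ j * ((2 * y + j + 1) * (4 * Y)) := by gcongr
    _ = _ := by ring

section
variable {b b' : ℝ → ℝ} {β Y : ℝ}

noncomputable def Bf (b : ℝ → ℝ) (j y : ℝ) : ℝ := b (y + j) * b y * (y * (y + 1))
noncomputable def Bd (b b' : ℝ → ℝ) (j y : ℝ) : ℝ :=
  (b' (y + j) * b y + b (y + j) * b' y) * (y * (y + 1)) + b (y + j) * b y * (2 * y + 1)

lemma Bf_deriv (h : Amp b b' β Y) (j y : ℝ) : HasDerivAt (Bf b j) (Bd b b' j y) y := by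
  have h1 : HasDerivAt (fun y : ℝ => y * (y + 1)) (2 * y + 1) y :=
    ((hasDerivAt_id y).mul ((hasDerivAt_id y).add_const 1)).congr_deriv (by simp; ring)
  exact (((h.der (y + j)).comp_add_const y j).mul (h.der y)).mul h1

lemma Bd_cont (h : Amp b b' β Y) (j : ℝ) : Continuous (Bd b b' j) := by
  have := h.cont; have := h.cts
  unfold Bd; fun_prop

lemma beta_nonneg (h : Amp b b' β Y) : 0 ≤ β := (abs_nonneg _).trans (h.bd 0)

lemma Bf_bd (h : Amp b b' β Y) (hY : 4 ≤ Y) {y : ℝ} (j : ℝ) (hy : Y - 1 ≤ y) (hy2 : y ≤ 2 * Y - 1) : |Bf b j y| ≤ 4 * β ^ 2 * Y ^ 2 := by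
  have hβ := beta_nonneg h
  unfold Bf
  rw [abs_mul, abs_mul, abs_of_nonneg (by nlinarith : 0 ≤ y * (y+1))]
  have : y * (y + 1) ≤ 4 * Y ^ 2 := by nlinarith
  calc |b (y + j)| * |b y| * (y * (y + 1)) ≤ β * β * (4 * Y ^ 2) := by
        gcongr
        · nlinarith
        · exact h.bd _
        · exact h.bd _
    _ = _ := by ring

lemma Bd_bd (h : Amp b b' β Y) (hY : 4 ≤ Y) {y : ℝ} (j : ℝ) (hy : Y - 1 ≤ y) (hy2 : y ≤ 2 * Y - 1) : |Bd b b' j y| ≤ 12 * β ^ 2 * Y := by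
  have hβ := beta_nonneg h
  have h4 : y * (y + 1) ≤ 4 * Y ^ 2 := by nlinarith
  have h5 : 0 ≤ y * (y + 1) := by nlinarith
  unfold Bd
  have e1 : |(b' (y + j) * b y + b (y + j) * b' y)| ≤ β / Y * β + β * (β / Y) := by
    refine (abs_add_le _ _).trans ?_
    rw [abs_mul, abs_mul]
    have h1 := h.bd' (y + j); have h2 := h.bd' y; have h3 := h.bd y; have h4 := h.bd (y + j)
    have : 0 ≤ β / Y := by positivity
    gcongr
  have e2 : |b (y + j) * b y| ≤ β * β := by
    rw [abs_mul]; have h3 := h.bd y; have h4 := h.bd (y + j); gcongr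
  refine (abs_add_le _ _).trans ?_
  rw [abs_mul, abs_mul _ (2 * y + 1), abs_of_nonneg h5, abs_of_nonneg (by linarith : 0 ≤ 2 * y + 1)]
  calc _ ≤ (β / Y * β + β * (β / Y)) * (4 * Y ^ 2) + β * β * (4 * Y) := by
        gcongr <;> linarith
    _ = _ := by field_simp; ring

lemma phase_deriv (j : ℕ) (t t' : ℝ) {y : ℝ} (hy : 0 < y) :
    HasDerivAt (fun y => t * tht (y + j) - t' * tht y) (eta y * (t' - t * qq j y)) y := by
  have h1 : HasDerivAt (fun y => tht (y + j)) (-eta (y + j)) y := (tht_deriv (by positivity)).comp_add_const y j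
  refine ((h1.const_mul t).sub ((tht_deriv hy).const_mul t')).congr_deriv ?_
  unfold eta qq; field_simp; ring

lemma phase_cont (j : ℕ) (t t' : ℝ) {s : Set ℝ} (hs : ∀ y ∈ s, 0 < y) :
    ContinuousOn (fun y => eta y * (t' - t * qq j y)) s := by
  unfold eta qq
  refine ContinuousOn.mul (ContinuousOn.div (by fun_prop) (by fun_prop) fun y hy => ?_) (ContinuousOn.sub (by fun_prop) (ContinuousOn.mul (by fun_prop) (ContinuousOn.div (by fun_prop) (by fun_prop) fun y hy => ?_)))
  all_goals have := hs y hy; positivity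

/-- general reduction: P smooth -/
lemma Ij_ibp (h : Amp b b' β Y) (hY : 4 ≤ Y) (j : ℕ) (t t' : ℝ) {P P' : ℝ → ℝ}
    (hP : ∀ y ∈ Set.Icc (Y-1) (2*Y-1), HasDerivAt P (P' y) y) (cP : ContinuousOn P' (Set.Icc (Y-1) (2*Y-1))) :
    ‖∫ y in (Y-1)..(2*Y-1), ((b (y + j) * b y * (P y * (t' - t * qq j y)) : ℝ) : ℂ) * ee (t * tht (y + j) - t' * tht y)‖
      ≤ ∫ y in (Y-1)..(2*Y-1), (12 * β ^ 2 * Y * |P y| + 4 * β ^ 2 * Y ^ 2 * |P' y|) := by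
  have hpos : ∀ y ∈ Set.Icc (Y-1) (2*Y-1), 0 < y := fun y hy => by linarith [hy.1]
  have hle : Y - 1 ≤ 2 * Y - 1 := by linarith
  have cP0 : ContinuousOn P (Set.Icc (Y-1) (2*Y-1)) := fun y hy => (hP y hy).continuousAt.continuousWithinAt
  have cB0 : Continuous (Bf b j) := continuous_iff_continuousAt.2 fun y => (Bf_deriv h j y).continuousAt
  have := ibp hle (fun y _ => Bf_deriv h (j:ℝ) y) hP (fun y hy => phase_deriv j t t' (hpos y hy)) (Bd_cont h j).continuousOn cP (phase_cont j t t' hpos)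
    (by simp [Bf, h.supp (Y-1) (Or.inl le_rfl)]) (by simp [Bf, h.supp (2*Y-1) (Or.inr le_rfl)])
  rw [show (∫ y in (Y-1)..(2*Y-1), ((b (y + j) * b y * (P y * (t' - t * qq j y)) : ℝ) : ℂ) * ee (t * tht (y + j) - t' * tht y)) =
    ∫ y in (Y-1)..(2*Y-1), ((Bf b j y * P y * (eta y * (t' - t * qq j y)) : ℝ) : ℂ) * ee (t * tht (y + j) - t' * tht y) from ?_]
  · refine this.trans (intervalIntegral.integral_mono_on hle ?_ ?_ fun y hy => ?_)
    · exact (((Bd_cont h j).continuousOn.abs.mul cP0.abs).add (cB0.continuousOn.abs.mul cP.abs)).intervalIntegrable_of_Icc hle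
    · exact ((continuousOn_const.mul cP0.abs).add (continuousOn_const.mul cP.abs)).intervalIntegrable_of_Icc hle
    · have h1 := Bf_bd h hY j hy.1 hy.2
      have h2 := Bd_bd h hY j hy.1 hy.2
      gcongr
  · refine intervalIntegral.integral_congr fun y hy => ?_
    rw [Set.uIcc_of_le hle] at hy
    have := hpos y hy
    congr 2
    unfold Bf eta
    field_simp

end

section
variable {b b' : ℝ → ℝ} {β Y : ℝ}

lemma Ij_diag (h : Amp b b' β Y) (hY : 4 ≤ Y) (t t' : ℝ) : ‖Ij b 0 t t'‖ * |t - t'| ≤ 12 * β ^ 2 * Y ^ 2 := by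
  have := Ij_ibp h hY 0 t t' (P := fun _ => 1) (P' := fun _ => 0) (fun y _ => hasDerivAt_const _ _) continuousOn_const
  simp only [abs_one, mul_one, abs_zero, mul_zero, add_zero, one_mul, intervalIntegral.integral_const] at this
  rw [Ij_eq h hY]
  rw [intervalIntegral.integral_congr (g := fun y => ((t' - t : ℝ) : ℂ) * (((b (y + (0:ℕ)) * b y : ℝ) : ℂ) * ee (t * tht (y + (0:ℕ)) - t' * tht y))), intervalIntegral.integral_const_mul, norm_mul, Complex.norm_real, Real.norm_eq_abs, abs_sub_comm] at this
  · rw [smul_eq_mul] at this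
    linarith
  · intro y hy
    rw [Set.uIcc_of_le (by linarith)] at hy
    have h0 : 0 < y := by linarith [hy.1]
    have : qq (0:ℕ) y = 1 := by unfold qq; simp only [Nat.cast_zero, add_zero]; field_simp
    simp only [this]; push_cast; ring

lemma Ij_far (h : Amp b b' β Y) (hY : 4 ≤ Y) {j : ℕ} (hj : 1 ≤ j) (hjY : (j:ℝ) ≤ Y) {T t t' : ℝ} (hT : 0 < T) (ht : T ≤ t) (ht2 : t ≤ 2 * T)
    (hfar : 8 * Y * |t - t'| ≤ T * j) : ‖Ij b j t t'‖ ≤ 3168 * β ^ 2 * Y ^ 3 / (T * j) := by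
  have hj' : (1:ℝ) ≤ j := by exact_mod_cast hj
  have hle : Y - 1 ≤ 2 * Y - 1 := by linarith
  have hpos : ∀ y ∈ Set.Icc (Y-1) (2*Y-1), 0 < y := fun y hy => by linarith [hy.1]
  have hQ : ∀ y ∈ Set.Icc (Y-1) (2*Y-1), T * j / (8 * Y) ≤ t' - t * qq j y := by
    intro y hy
    have h1 := one_sub_qq (by linarith : (0:ℝ) ≤ j) hY hy.1 hy.2 hjY
    have h2 : |t - t'| ≤ T * j / (8 * Y) := by rw [le_div_iff₀ (by linarith)]; linarith
    have h3 : T * (j / (4 * Y)) ≤ t * (1 - qq j y) := mul_le_mul ht h1 (by positivity) (by linarith)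
    have h4 : T * (j / (4 * Y)) = 2 * (T * j / (8 * Y)) := by field_simp; norm_num
    have h5 := le_abs_self (t - t')
    nlinarith
  have hd : 0 < T * j / (8 * Y) := by positivity
  have hQd : ∀ y ∈ Set.Icc (Y-1) (2*Y-1), HasDerivAt (fun y => t' - t * qq j y) (-(t * qd j y)) y := fun y hy =>
    (((qq_deriv (by linarith) (hpos y hy)).const_mul t).const_sub t')
  have cQ : ContinuousOn (fun y => t' - t * qq j y) (Set.Icc (Y-1) (2*Y-1)) := fun y hy => (hQd y hy).continuousAt.continuousWithinAt
  have cq : ContinuousOn (qd j) (Set.Icc (Y-1) (2*Y-1)) := qd_cont (by linarith) hpos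
  have := Ij_ibp h hY j t t' (P := fun y => (t' - t * qq j y)⁻¹) (P' := fun y => -(-(t * qd j y)) / (t' - t * qq j y) ^ 2)
    (fun y hy => (hQd y hy).fun_inv (by linarith [hQ y hy]))
    (ContinuousOn.div (by fun_prop) (by fun_prop) fun y hy => pow_ne_zero _ (by linarith [hQ y hy]))
  rw [intervalIntegral.integral_congr (g := fun y => (((b (y + j) * b y : ℝ) : ℂ) * ee (t * tht (y + j) - t' * tht y))), ← Ij_eq h hY] at this
  swap
  · intro y hy
    rw [Set.uIcc_of_le hle] at hy
    have : t' - t * qq j y ≠ 0 := by linarith [hQ y hy]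
    simp only [inv_mul_cancel₀ this, mul_one]
  refine this.trans ((Real.le_norm_self _).trans ((intervalIntegral.norm_integral_le_of_norm_le_const (C := 3168 * β ^ 2 * Y ^ 2 / (T * j)) ?_).trans ?_))
  · intro y hy
    rw [Set.uIoc_of_le hle] at hy
    have hy' : y ∈ Set.Icc (Y-1) (2*Y-1) := ⟨hy.1.le, hy.2⟩
    have hQy := hQ y hy'
    have e0 := qd_nonneg (by linarith : (0:ℝ) ≤ j) (hpos y hy')
    have e1 : |(t' - t * qq j y)⁻¹| ≤ (T * j / (8 * Y))⁻¹ := by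
      rw [abs_of_pos (inv_pos.2 (by linarith))]
      exact inv_anti₀ hd hQy
    have e2 : |-(-(t * qd j y)) / (t' - t * qq j y) ^ 2| ≤ (2 * T) * (6 * j / Y ^ 2) / (T * j / (8 * Y)) ^ 2 := by
      rw [neg_neg, abs_of_nonneg (div_nonneg (mul_nonneg (by linarith) e0) (sq_nonneg _))]
      have := qd_le (by linarith : (0:ℝ) ≤ j) hY hy'.1
      gcongr
    rw [Real.norm_eq_abs, abs_of_nonneg (by positivity)]
    calc _ ≤ 12 * β ^ 2 * Y * (T * j / (8 * Y))⁻¹ + 4 * β ^ 2 * Y ^ 2 * ((2 * T) * (6 * j / Y ^ 2) / (T * j / (8 * Y)) ^ 2) := by gcongr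
      _ = _ := by field_simp; ring
  · rw [show (2 * Y - 1 - (Y-1)) = Y by ring, abs_of_nonneg (by linarith)]
    apply le_of_eq; ring

lemma Ij_all (h : Amp b b' β Y) (hY : 4 ≤ Y) {j : ℕ} (hj : 1 ≤ j) (hjY : (j:ℝ) ≤ Y) {T t t' : ℝ} (hT : 0 < T) (ht : T ≤ t) :
    ‖Ij b j t t'‖ ≤ 100 * β ^ 2 * Y ^ 2 / √(T * j) := by
  have hj' : (1:ℝ) ≤ j := by exact_mod_cast hj
  have hle : Y - 1 ≤ 2 * Y - 1 := by linarith
  have hpos : ∀ y ∈ Set.Icc (Y-1) (2*Y-1), 0 < y := fun y hy => by linarith [hy.1]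
  set d := √(T * j) with hdd
  have hd : 0 < d := Real.sqrt_pos.2 (by positivity)
  have hd2 : d ^ 2 = T * j := Real.sq_sqrt (by positivity)
  have hQd : ∀ y ∈ Set.Icc (Y-1) (2*Y-1), HasDerivAt (fun y => t' - t * qq j y) (-(t * qd j y)) y := fun y hy =>
    (((qq_deriv (by linarith) (hpos y hy)).const_mul t).const_sub t')
  set Q := fun y => t' - t * qq j y with hQQ
  have cQ : ContinuousOn Q (Set.Icc (Y-1) (2*Y-1)) := fun y hy => (hQd y hy).continuousAt.continuousWithinAt
  have cq : ContinuousOn (qd j) (Set.Icc (Y-1) (2*Y-1)) := qd_cont (by linarith) hpos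
  have hqn : ∀ y ∈ Set.Icc (Y-1) (2*Y-1), 0 ≤ t * qd j y := fun y hy => mul_nonneg (by linarith) (qd_nonneg (by linarith) (hpos y hy))
  have hQ2 : ∀ y, 0 < Q y ^ 2 + d ^ 2 := fun y => by positivity
  -- arctan integral
  have cK : ContinuousOn (fun y => t * qd j y / (Q y ^ 2 + d ^ 2)) (Set.Icc (Y-1) (2*Y-1)) :=
    ContinuousOn.div (by fun_prop) (by fun_prop) fun y hy => (hQ2 y).ne'
  have iK := cK.intervalIntegrable_of_Icc (μ := volume) hle
  have hK : ∫ y in (Y-1)..(2*Y-1), t * qd j y / (Q y ^ 2 + d ^ 2) ≤ 4 / d := by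
    rw [intervalIntegral.integral_eq_sub_of_hasDerivAt (f := fun y => -(Real.arctan (Q y / d) / d)) ?_ iK]
    · have h1 := Real.neg_pi_div_two_lt_arctan (Q (2*Y-1) / d)
      have h2 := Real.arctan_lt_pi_div_two (Q (Y-1) / d)
      have h3 := Real.pi_le_four
      rw [neg_sub_neg, ← sub_div]
      gcongr
      linarith
    · intro y hy
      rw [Set.uIcc_of_le hle] at hy
      refine ((((hQd y hy).div_const d).arctan).div_const d).neg.congr_deriv ?_
      have := hQ2 y
      have : d ^ 2 + Q y ^ 2 ≠ 0 := by positivity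
      field_simp
      ring
  have hP : ∀ y ∈ Set.Icc (Y-1) (2*Y-1), HasDerivAt (fun y => Q y / (Q y ^ 2 + d ^ 2)) (t * qd j y * (Q y ^ 2 - d ^ 2) / (Q y ^ 2 + d ^ 2) ^ 2) y := by
    intro y hy
    refine ((hQd y hy).fun_div (((hQd y hy).fun_pow 2).add_const (d ^ 2)) (hQ2 y).ne').congr_deriv ?_
    congr 1
    simp only [hQQ]; push_cast; ring
  have cP' : ContinuousOn (fun y => t * qd j y * (Q y ^ 2 - d ^ 2) / (Q y ^ 2 + d ^ 2) ^ 2) (Set.Icc (Y-1) (2*Y-1)) :=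
    ContinuousOn.div (by fun_prop) (by fun_prop) fun y hy => pow_ne_zero _ (hQ2 y).ne'
  have cP : ContinuousOn (fun y => Q y / (Q y ^ 2 + d ^ 2)) (Set.Icc (Y-1) (2*Y-1)) := fun y hy => (hP y hy).continuousAt.continuousWithinAt
  have h1 := Ij_ibp h hY j t t' hP cP'
  have h2 : ∫ y in (Y-1)..(2*Y-1), (12 * β ^ 2 * Y * |Q y / (Q y ^ 2 + d ^ 2)| + 4 * β ^ 2 * Y ^ 2 * |t * qd j y * (Q y ^ 2 - d ^ 2) / (Q y ^ 2 + d ^ 2) ^ 2|)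
      ≤ 12 * β ^ 2 * Y * (1 / d) * Y + 4 * β ^ 2 * Y ^ 2 * (4 / d) := by
    calc _ ≤ ∫ y in (Y-1)..(2*Y-1), (12 * β ^ 2 * Y * (1 / d) + 4 * β ^ 2 * Y ^ 2 * (t * qd j y / (Q y ^ 2 + d ^ 2))) := by
          refine intervalIntegral.integral_mono_on hle (((continuousOn_const.mul cP.abs).add (continuousOn_const.mul cP'.abs)).intervalIntegrable_of_Icc hle)
            ((continuousOn_const.add (continuousOn_const.mul cK)).intervalIntegrable_of_Icc hle) fun y hy => ?_
          have a1 : |Q y / (Q y ^ 2 + d ^ 2)| ≤ 1 / d := by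
            rw [abs_div, abs_of_pos (hQ2 y), div_le_div_iff₀ (hQ2 y) hd]
            nlinarith [sq_nonneg (|Q y| - d), sq_abs (Q y), abs_nonneg (Q y)]
          have a2 : |t * qd j y * (Q y ^ 2 - d ^ 2) / (Q y ^ 2 + d ^ 2) ^ 2| ≤ t * qd j y / (Q y ^ 2 + d ^ 2) := by
            rw [abs_div, abs_mul, abs_of_nonneg (hqn y hy), abs_of_pos (pow_pos (hQ2 y) 2), div_le_div_iff₀ (pow_pos (hQ2 y) 2) (hQ2 y)]
            have : |Q y ^ 2 - d ^ 2| ≤ Q y ^ 2 + d ^ 2 := by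
              rw [abs_le]; constructor <;> nlinarith [sq_nonneg (Q y), sq_nonneg d]
            calc _ ≤ t * qd j y * (Q y ^ 2 + d ^ 2) * (Q y ^ 2 + d ^ 2) := by
                  have := hqn y hy; have := hQ2 y
                  gcongr
              _ = _ := by ring
          have : 0 ≤ Y := by linarith
          gcongr
      _ = 12 * β ^ 2 * Y * (1 / d) * Y + 4 * β ^ 2 * Y ^ 2 * ∫ y in (Y-1)..(2*Y-1), (t * qd j y / (Q y ^ 2 + d ^ 2)) := by
          rw [intervalIntegral.integral_add intervalIntegrable_const (iK.const_mul _), intervalIntegral.integral_const, intervalIntegral.integral_const_mul, smul_eq_mul]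
          ring
      _ ≤ _ := by gcongr
  have cE : ContinuousOn (fun y => ee (t * tht (y + j) - t' * tht y)) (Set.Icc (Y-1) (2*Y-1)) :=
    fun y hy => (hasDerivAt_ee (phase_deriv j t t' (hpos y hy))).continuousAt.continuousWithinAt
  have cb : Continuous b := h.cts
  have c1 : ContinuousOn (fun y => ((b (y + j) * b y * (Q y / (Q y ^ 2 + d ^ 2) * Q y) : ℝ) : ℂ) * ee (t * tht (y + j) - t' * tht y)) (Set.Icc (Y-1) (2*Y-1)) :=
    (Complex.continuous_ofReal.comp_continuousOn ((Continuous.continuousOn (by fun_prop)).mul (cP.mul cQ))).mul cE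
  have c0 : ContinuousOn (fun y => ((b (y + j) * b y * (d ^ 2 / (Q y ^ 2 + d ^ 2)) : ℝ) : ℂ) * ee (t * tht (y + j) - t' * tht y)) (Set.Icc (Y-1) (2*Y-1)) :=
    (Complex.continuous_ofReal.comp_continuousOn ((Continuous.continuousOn (by fun_prop)).mul (ContinuousOn.div (by fun_prop) (by fun_prop) fun y hy => (hQ2 y).ne'))).mul cE
  have h3 : Ij b j t t' = (∫ y in (Y-1)..(2*Y-1), ((b (y + j) * b y * (Q y / (Q y ^ 2 + d ^ 2) * Q y) : ℝ) : ℂ) * ee (t * tht (y + j) - t' * tht y))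
     + ∫ y in (Y-1)..(2*Y-1), ((b (y + j) * b y * (d ^ 2 / (Q y ^ 2 + d ^ 2)) : ℝ) : ℂ) * ee (t * tht (y + j) - t' * tht y) := by
    rw [Ij_eq h hY, ← intervalIntegral.integral_add (c1.intervalIntegrable_of_Icc hle) (c0.intervalIntegrable_of_Icc hle)]
    refine intervalIntegral.integral_congr fun y _ => ?_
    rw [← add_mul, ← Complex.ofReal_add, ← mul_add]
    have := (hQ2 y).ne'
    have e : Q y / (Q y ^ 2 + d ^ 2) * Q y + d ^ 2 / (Q y ^ 2 + d ^ 2) = 1 := by field_simp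
    rw [e, mul_one]
  have h4 : ‖∫ y in (Y-1)..(2*Y-1), ((b (y + j) * b y * (d ^ 2 / (Q y ^ 2 + d ^ 2)) : ℝ) : ℂ) * ee (t * tht (y + j) - t' * tht y)‖ ≤ 18 * β ^ 2 * Y ^ 2 * (4 / d) := by
    calc _ ≤ ∫ y in (Y-1)..(2*Y-1), 18 * β ^ 2 * Y ^ 2 * (t * qd j y / (Q y ^ 2 + d ^ 2)) := by
          refine intervalIntegral.norm_integral_le_of_norm_le hle (Filter.Eventually.of_forall fun y hy => ?_) (iK.const_mul _)
          have hy' : y ∈ Set.Icc (Y-1) (2*Y-1) := ⟨hy.1.le, hy.2⟩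
          rw [norm_mul, norm_ee, mul_one, Complex.norm_real, Real.norm_eq_abs, abs_mul, abs_mul, abs_of_nonneg (div_nonneg (sq_nonneg d) (hQ2 y).le)]
          have a1 := le_qd (by linarith : (0:ℝ) ≤ j) hY hy'.1 hy'.2 hjY
          have a2 : d ^ 2 ≤ 18 * Y ^ 2 * (t * qd j y) := by
            rw [div_le_iff₀ (by positivity)] at a1
            rw [hd2]
            calc T * j ≤ t * (qd j y * (18 * Y ^ 2)) := by
                  exact mul_le_mul ht a1 (by linarith) (by linarith)
              _ = _ := by ring
          have hβ := beta_nonneg h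
          have := hQ2 y
          calc |b (y + j)| * |b y| * (d ^ 2 / (Q y ^ 2 + d ^ 2)) ≤ β * β * (18 * Y ^ 2 * (t * qd j y) / (Q y ^ 2 + d ^ 2)) := by
                have := h.bd (y + j); have := h.bd y
                gcongr
            _ = _ := by ring
      _ ≤ _ := by
          rw [intervalIntegral.integral_const_mul]; gcongr
  rw [h3]
  refine (norm_add_le _ _).trans ((add_le_add (h1.trans h2) h4).trans (le_of_eq ?_))
  field_simp; norm_num

end


lemma sqrt_stp (J : ℕ) : 1 / √((J:ℝ) + 1) ≤ 2 * √((J:ℝ) + 1) - 2 * √(J:ℝ) := by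
  have h0 : 0 < √((J:ℝ) + 1) := Real.sqrt_pos.2 (by positivity)
  have h1 := Real.sq_sqrt (by positivity : (0:ℝ) ≤ (J:ℝ) + 1)
  have h2 := Real.sq_sqrt (by positivity : (0:ℝ) ≤ (J:ℝ))
  rw [div_le_iff₀ h0]
  nlinarith [sq_nonneg (√((J:ℝ) + 1) - √(J:ℝ))]

lemma sqrt_sum (Z : ℝ) (J : ℕ) :
    ∑ j ∈ Finset.range J, (if (j:ℝ) + 1 ≤ Z then 1 / √((j:ℝ) + 1) else 0) ≤ 2 * √(min J Z) := by
  induction J with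
  | zero => simp
  | succ J ih =>
    rw [Finset.sum_range_succ]
    split_ifs with h
    · rw [min_eq_left (by linarith)] at ih
      push_cast
      rw [min_eq_left h]
      linarith [sqrt_stp J]
    · rw [add_zero]
      refine ih.trans ?_
      gcongr
      linarith

lemma ker_bound {b b' : ℝ → ℝ} {β Y : ℝ} (h : Amp b b' β Y) (hY : 4 ≤ Y) {T t t' : ℝ} (hT : 0 < T) (ht : T ≤ t) (ht2 : t ≤ 2 * T) (J : ℕ) :
    ‖Ij b 0 t t'‖ + 2 * ∑ j ∈ Finset.range J, ‖Ij b (j+1) t t'‖ ≤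
      10000 * (β ^ 2 * Y ^ 2) * (1 / (Y + |t - t'|) + Y / T * (1 + Real.log J) + √(Y * |t - t'|) / T) := by
  have a0 : ‖Ij b 0 t t'‖ ≤ 13 * (β ^ 2 * Y ^ 2) * (1 / (Y + |t - t'|)) := by
    have h1 := Ij_diag h hY t t'
    have h2 := Ij_triv h hY 0 t t'
    have h3 := abs_nonneg (t - t')
    rw [mul_one_div, le_div_iff₀ (by linarith)]
    nlinarith
  set τ := |t - t'| with hτ
  have hτ0 : 0 ≤ τ := abs_nonneg _
  have hY0 : 0 < Y := by linarith
  have aj : ∀ j ∈ Finset.range J, ‖Ij b (j+1) t t'‖ ≤ 3168 * β ^ 2 * Y ^ 3 / T * (1 / ((j:ℝ)+1)) +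
      100 * β ^ 2 * Y ^ 2 / √T * (if (j:ℝ) + 1 ≤ 8 * Y * τ / T then 1 / √((j:ℝ) + 1) else 0) := by
    intro j _
    have hs : 0 ≤ 100 * β ^ 2 * Y ^ 2 / √T * (if (j:ℝ) + 1 ≤ 8 * Y * τ / T then 1 / √((j:ℝ) + 1) else 0) := by
      split_ifs <;> positivity
    rcases le_total Y ((j + 1 : ℕ):ℝ) with hj | hj
    · rw [Ij_zero h _ hj, norm_zero]
      positivity
    · by_cases hc : (j:ℝ) + 1 ≤ 8 * Y * τ / T
      · rw [if_pos hc]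
        have := Ij_all h hY (by omega : 1 ≤ j + 1) hj hT ht (t' := t')
        rw [Real.sqrt_mul hT.le] at this
        push_cast at this
        have h2 : 0 ≤ 3168 * β ^ 2 * Y ^ 3 / T * (1 / ((j:ℝ)+1)) := by positivity
        refine this.trans (le_trans (le_of_eq ?_) (le_add_of_nonneg_left h2))
        rw [div_mul_div_comm, mul_one]
      · have := Ij_far h hY (by omega : 1 ≤ j + 1) hj hT ht ht2 (t' := t') (by
          rw [not_le, div_lt_iff₀ hT] at hc; push_cast; linarith)
        push_cast at this
        refine this.trans (le_trans (le_of_eq ?_) (le_add_of_nonneg_right hs))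
        rw [div_mul_div_comm, mul_one]
  have s := Finset.sum_le_sum aj
  rw [Finset.sum_add_distrib, ← Finset.mul_sum, ← Finset.mul_sum] at s
  have s1 := harm_le J
  have s2 := (sqrt_sum (8 * Y * τ / T) J).trans (mul_le_mul_of_nonneg_left (Real.sqrt_le_sqrt (min_le_right _ _)) two_pos.le)
  have e1 : √(8 * Y * τ / T) ≤ 3 * (√(Y * τ) / √T) := by
    rw [Real.sqrt_div' _ hT.le, mul_assoc, Real.sqrt_mul (by norm_num), mul_div_assoc]
    gcongr
    rw [Real.sqrt_le_left (by norm_num)]; norm_num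
  have s3 : 3168 * β ^ 2 * Y ^ 3 / T * ∑ i ∈ Finset.range J, 1 / ((i:ℝ)+1) ≤ 3168 * (β ^ 2 * Y ^ 2) * (Y / T * (1 + Real.log J)) := by
    calc _ ≤ 3168 * β ^ 2 * Y ^ 3 / T * (1 + Real.log J) := by gcongr
      _ = _ := by ring
  have s4 : 100 * β ^ 2 * Y ^ 2 / √T * ∑ i ∈ Finset.range J, (if (i:ℝ) + 1 ≤ 8 * Y * τ / T then 1 / √((i:ℝ) + 1) else 0) ≤
      600 * (β ^ 2 * Y ^ 2) * (√(Y * τ) / T) := by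
    calc _ ≤ 100 * β ^ 2 * Y ^ 2 / √T * (2 * (3 * (√(Y * τ) / √T))) := by gcongr; linarith
      _ = 600 * (β ^ 2 * Y ^ 2) * (√(Y * τ) / (√T * √T)) := by have := Real.sqrt_pos.2 hT; field_simp; ring
      _ = _ := by rw [Real.mul_self_sqrt hT.le]
  have p0 : 0 ≤ 1 + Real.log J := le_trans (Finset.sum_nonneg fun j _ => by positivity) s1
  have p1 : 0 ≤ (β ^ 2 * Y ^ 2) * (1 / (Y + τ)) := by positivity
  have p2 : 0 ≤ (β ^ 2 * Y ^ 2) * (Y / T * (1 + Real.log J)) := by positivity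
  have p3 : 0 ≤ (β ^ 2 * Y ^ 2) * (√(Y * τ) / T) := by positivity
  nlinarith
open scoped FourierTransform SchwartzMap


lemma sch_summable (g : 𝓢(ℝ, ℂ)) (k : ℝ) : Summable fun N : ℤ => |(N:ℝ)| ^ k * ‖𝓕 (g : ℝ → ℂ) (N:ℝ)‖ := by
  have h1 := ((𝓕 g).isBigO_cocompact_rpow (-(2 + k))).comp_tendsto Int.tendsto_coe_cofinite
  have h2 : (fun N : ℤ => |(N:ℝ)| ^ k * ‖𝓕 (g : ℝ → ℂ) (N:ℝ)‖) =O[Filter.cofinite] fun N : ℤ => |(N:ℝ)| ^ (-(2:ℝ)) := by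
    have h3 := (Asymptotics.isBigO_refl (fun N : ℤ => |(N:ℝ)| ^ k) Filter.cofinite).mul h1.norm_left
    refine h3.congr' ?_ ?_
    · exact Filter.Eventually.of_forall fun N => by simp [SchwartzMap.fourier_coe]
    · have : ∀ᶠ N : ℤ in Filter.cofinite, N ≠ 0 := (Set.finite_singleton (0:ℤ)).subset fun x hx => by simpa using hx
      filter_upwards [this] with N hN
      have : 0 < |(N:ℝ)| := abs_pos.2 (by exact_mod_cast hN)
      simp only [Function.comp, Real.norm_eq_abs]
      rw [← Real.rpow_add this]; congr 1; ring
  exact summable_of_isBigO (Real.summable_abs_int_rpow one_lt_two) h2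

lemma sch_summable0 (g : 𝓢(ℝ, ℂ)) : Summable fun N : ℤ => ‖𝓕 (g : ℝ → ℂ) (N:ℝ)‖ := by
  simpa using sch_summable g 0

lemma parseval (g : 𝓢(ℝ, ℂ)) (J : ℕ) (hg : ∀ (y : ℝ) (j : ℤ), J < |j| → g (y + j) * star (g y) = 0) :
    ((∑' N : ℤ, ‖𝓕 (g : ℝ → ℂ) (N:ℝ)‖ ^ 2 : ℝ) : ℂ) = ∑ j ∈ Finset.Icc (-(J:ℤ)) J, ∫ y : ℝ, g (y + j) * star (g y) := by
  have hP : ∀ y : ℝ, ∑ j ∈ Finset.Icc (-(J:ℤ)) J, g (y + j) * star (g y) =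
      ∑' N : ℤ, 𝓕 (g : ℝ → ℂ) (N:ℝ) * (fourier N (y : UnitAddCircle) * star (g y)) := by
    intro y
    have h1 := SchwartzMap.tsum_eq_tsum_fourier g y
    rw [← tsum_eq_sum (L := SummationFilter.unconditional ℤ) (s := Finset.Icc (-(J:ℤ)) J) (f := fun j : ℤ => g (y + j) * star (g y)), tsum_mul_right, h1, ← tsum_mul_right]
    · simp only [SchwartzMap.fourier_coe, mul_assoc]
    · intro j hj
      apply hg
      by_contra hc
      rw [not_lt, abs_le] at hc
      exact hj (Finset.mem_Icc.2 hc)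
  have gi : Integrable (fun y => g y) := g.integrable
  have gs : Integrable (fun y => star (g y)) := (Complex.conjLIE.integrable_comp_iff (φ := fun y => g y)).2 gi
  have hb : ∃ C, ∀ y, ‖g y‖ ≤ C := by
    obtain ⟨C, hC⟩ := g.decay 0 0
    exact ⟨C, fun y => by simpa using hC.2 y⟩
  obtain ⟨C, hC⟩ := hb
  have ij : ∀ j : ℤ, Integrable (fun y : ℝ => g (y + j) * star (g y)) := by
    intro j
    refine gs.bdd_mul (c := C) ?_ (Filter.Eventually.of_forall fun y => hC _)
    exact (g.continuous.comp (continuous_add_const _)).aestronglyMeasurable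
  rw [← integral_finsetSum _ fun j _ => ij j]
  simp_rw [hP]
  have hn : ∀ (N : ℤ) (y : ℝ), ‖𝓕 (g : ℝ → ℂ) (N:ℝ) * (fourier N (y : UnitAddCircle) * star (g y))‖ = ‖𝓕 (g : ℝ → ℂ) (N:ℝ)‖ * ‖g y‖ := by
    intro N y
    rw [norm_mul, norm_mul, norm_star, fourier_apply, Circle.norm_coe, one_mul]
  have cf : ∀ N : ℤ, Continuous (fun y : ℝ => (fourier N (y : UnitAddCircle) : ℂ)) := fun N =>
    (map_continuous (fourier N)).comp continuous_quotient_mk'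
  have iN : ∀ N : ℤ, Integrable (fun y : ℝ => fourier N (y : UnitAddCircle) * star (g y)) := by
    intro N
    refine gs.bdd_mul (c := 1) (cf N).aestronglyMeasurable (Filter.Eventually.of_forall fun y => ?_)
    rw [fourier_apply, Circle.norm_coe]
  rw [← integral_tsum_of_summable_integral_norm (fun N => (iN N).const_mul _)]
  · rw [Complex.ofReal_tsum]
    refine tsum_congr fun N => ?_
    rw [integral_const_mul]
    have : ∫ y : ℝ, fourier N (y : UnitAddCircle) * star (g y) = star (𝓕 (g : ℝ → ℂ) (N:ℝ)) := by
      rw [fourier_real_eq_integral_exp_smul]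
      refine Eq.trans ?_ (integral_conj (f := fun y : ℝ => Complex.exp (↑(-2 * π * y * (N:ℝ)) * Complex.I) • g y))
      congr 1; ext y
      rw [fourier_coe_apply, smul_eq_mul, map_mul, ← Complex.exp_conj]
      congr 2
      simp only [map_mul, Complex.conj_I, Complex.conj_ofReal]
      push_cast; ring
    rw [this]
    simp [Complex.mul_conj, Complex.normSq_eq_norm_sq]
  · simp_rw [hn, integral_const_mul]
    exact (sch_summable0 g).mul_right _

noncomputable def corr (g : ℝ → ℂ) (j : ℤ) : ℂ := ∫ y : ℝ, g (y + j) * star (g y)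

lemma corr_neg (g : ℝ → ℂ) (j : ℤ) : ‖corr g (-j)‖ = ‖corr g j‖ := by
  have h1 : corr g (-j) = star (corr g j) := by
    unfold corr
    rw [← integral_add_right_eq_self (fun y : ℝ => g (y + (-j : ℤ)) * star (g y)) (j:ℝ)]
    refine Eq.trans ?_ (integral_conj (f := fun y : ℝ => g (y + j) * star (g y)))
    congr 1; ext y
    rw [show y + (j:ℝ) + ((-j : ℤ):ℝ) = y by push_cast; ring]
    simp [mul_comm]
  rw [h1, norm_star]

lemma parseval_le (g : 𝓢(ℝ, ℂ)) (J : ℕ) (hg : ∀ (y : ℝ) (j : ℤ), J < |j| → g (y + j) * star (g y) = 0) :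
    ∑' N : ℤ, ‖𝓕 (g : ℝ → ℂ) (N:ℝ)‖ ^ 2 ≤ ‖corr g 0‖ + 2 * ∑ j ∈ Finset.range J, ‖corr g ((j + 1 : ℕ) : ℤ)‖ := by
  have h1 := congrArg norm (parseval g J hg)
  rw [Complex.norm_real, Real.norm_eq_abs, abs_of_nonneg (tsum_nonneg fun _ => by positivity)] at h1
  rw [h1]
  refine (norm_sum_le _ _).trans (le_of_eq ?_)
  have : ∀ J : ℕ, ∑ j ∈ Finset.Icc (-(J:ℤ)) J, ‖corr g j‖ = ‖corr g 0‖ + 2 * ∑ j ∈ Finset.range J, ‖corr g ((j + 1 : ℕ) : ℤ)‖ := by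
    intro J
    induction J with
    | zero => simp
    | succ J ih =>
      have e : Finset.Icc (-((J+1:ℕ):ℤ)) ((J+1:ℕ):ℤ) = insert (-((J+1:ℕ):ℤ)) (insert ((J+1:ℕ):ℤ) (Finset.Icc (-(J:ℤ)) J)) := by
        ext x; simp only [Finset.mem_insert, Finset.mem_Icc]; omega
      rw [e, Finset.sum_insert, Finset.sum_insert, ih, Finset.sum_range_succ, corr_neg]
      · ring
      · simp
      · simp only [Finset.mem_insert, Finset.mem_Icc]; omega
  exact this J


lemma meas_tht : Measurable tht := by unfold tht; fun_prop
lemma meas_ee : Measurable ee := by unfold ee; fun_prop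

lemma Amp.hcs {b b' : ℝ → ℝ} {β Y : ℝ} (h : Amp b b' β Y) : HasCompactSupport b := by
  refine HasCompactSupport.intro (isCompact_Icc (a := Y - 1) (b := 2 * Y - 1)) fun y hy => h.supp y ?_
  simp only [Set.mem_Icc, not_and_or, not_le] at hy
  rcases hy with hy | hy
  · exact Or.inl hy.le
  · exact Or.inr hy.le

lemma Ij_integrable {b b' : ℝ → ℝ} {β Y : ℝ} (h : Amp b b' β Y) (j : ℕ) (t t' : ℝ) :
    Integrable (fun y : ℝ => ((b (y + j) * b y : ℝ) : ℂ) * ee (t * tht (y + j) - t' * tht y)) := by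
  have hc : Continuous (fun y : ℝ => ((b (y + j) * b y : ℝ) : ℂ)) := by
    have := h.cts; fun_prop
  have hs : HasCompactSupport (fun y : ℝ => ((b (y + j) * b y : ℝ) : ℂ)) := by
    refine h.hcs.mono fun y hy => ?_
    rw [Function.mem_support] at hy ⊢
    intro h0; apply hy; simp [h0]
  refine (hc.integrable_of_hasCompactSupport hs).mul_bdd (c := 1) ?_ (Filter.Eventually.of_forall fun y => (norm_ee _).le)
  have := meas_tht
  exact (meas_ee.comp (by fun_prop)).aestronglyMeasurable

lemma star_ee (x : ℝ) : star (ee x) = ee (-x) := by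
  unfold ee
  rw [Complex.star_def, ← Complex.exp_conj]; simp

lemma corr_eq {b b' : ℝ → ℝ} {β Y : ℝ} (h : Amp b b' β Y) (I : Finset ℕ) (t c : ℕ → ℝ) (g : ℝ → ℂ)
    (hg : ∀ y, g y = (b y : ℂ) * ∑ i ∈ I, (c i : ℂ) * ee (t i * tht y)) (j : ℕ) :
    corr g (j:ℤ) = ∑ i ∈ I, ∑ k ∈ I, ((c i * c k : ℝ) : ℂ) * Ij b j (t i) (t k) := by
  unfold corr Ij
  simp_rw [← integral_const_mul]
  simp_rw [← integral_finsetSum I (fun k _ => (Ij_integrable h j _ _).const_mul _)]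
  rw [← integral_finsetSum I (fun i _ => integrable_finsetSum I (fun k _ => (Ij_integrable h j _ _).const_mul _))]
  congr 1; ext y
  rw [hg, hg, Int.cast_natCast, star_mul, star_sum]
  have : ∀ k ∈ I, star ((c k : ℂ) * ee (t k * tht y)) = (c k : ℂ) * ee (-(t k * tht y)) := by
    intro k _
    rw [star_mul, star_ee, Complex.star_def, Complex.conj_ofReal, mul_comm]
  rw [Finset.sum_congr rfl this, Complex.star_def, Complex.conj_ofReal]
  rw [show ((b (y + j):ℝ):ℂ) * (∑ i ∈ I, (c i : ℂ) * ee (t i * tht (y + j))) * ((∑ k ∈ I, (c k : ℂ) * ee (-(t k * tht y))) * (b y : ℂ))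
    = ((b (y + j) : ℂ) * b y) * ((∑ i ∈ I, (c i : ℂ) * ee (t i * tht (y + j))) * (∑ k ∈ I, (c k : ℂ) * ee (-(t k * tht y)))) by ring]
  rw [Finset.sum_mul_sum, Finset.mul_sum]
  refine Finset.sum_congr rfl fun i _ => ?_
  rw [Finset.mul_sum]
  refine Finset.sum_congr rfl fun k _ => ?_
  rw [sub_eq_add_neg, ee_add]; push_cast; ring

lemma ker_sum {b b' : ℝ → ℝ} {β Y : ℝ} (h : Amp b b' β Y) (hY : 4 ≤ Y) (I : Finset ℕ) (t c : ℕ → ℝ) {c0 : ℝ} (hc : ∀ i ∈ I, |c i| ≤ c0) (g : 𝓢(ℝ, ℂ))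
    (hg : ∀ y, g y = (b y : ℂ) * ∑ i ∈ I, (c i : ℂ) * ee (t i * tht y)) {T : ℝ} (hT : 0 < T) (ht : ∀ i ∈ I, T ≤ t i ∧ t i ≤ 2 * T) :
    ∑' N : ℤ, ‖𝓕 (g : ℝ → ℂ) (N:ℝ)‖ ^ 2 ≤ 10000 * c0 ^ 2 * (β ^ 2 * Y ^ 2) *
      ∑ i ∈ I, ∑ k ∈ I, (1 / (Y + |t i - t k|) + Y / T * (1 + Real.log ⌈Y⌉₊) + √(Y * |t i - t k|) / T) := by
  set J := ⌈Y⌉₊ with hJ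
  have hJY : Y ≤ J := Nat.le_ceil Y
  refine (parseval_le g J ?_).trans ?_
  · intro y j hj
    have hj' : (J:ℝ) < |(j:ℝ)| := by exact_mod_cast hj
    rw [hg, hg]
    by_cases h1 : b y = 0
    · simp [h1]
    · have : b (y + j) = 0 := by
        by_contra h2
        have a1 : Y - 1 < y ∧ y < 2 * Y - 1 := by
          by_contra hh; rw [not_and_or, not_lt, not_lt] at hh; exact h1 (h.supp _ hh)
        have a2 : Y - 1 < y + j ∧ y + j < 2 * Y - 1 := by
          by_contra hh; rw [not_and_or, not_lt, not_lt] at hh; exact h2 (h.supp _ hh)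
        have : |(j:ℝ)| < Y := by rw [abs_lt]; constructor <;> linarith
        linarith
      simp [this]
  · have hcj : ∀ j : ℕ, ‖corr g (j:ℤ)‖ ≤ ∑ i ∈ I, ∑ k ∈ I, c0 ^ 2 * ‖Ij b j (t i) (t k)‖ := by
      intro j
      rw [corr_eq h I t c g hg]
      refine (norm_sum_le _ _).trans (Finset.sum_le_sum fun i hi => (norm_sum_le _ _).trans (Finset.sum_le_sum fun k hk => ?_))
      rw [norm_mul, Complex.norm_real, Real.norm_eq_abs, abs_mul, sq]
      have := hc i hi; have := hc k hk
      have : 0 ≤ c0 := (abs_nonneg _).trans (hc i hi)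
      gcongr
    have h0 := hcj 0
    have hs := Finset.sum_le_sum fun j (_ : j ∈ Finset.range J) => hcj (j+1)
    rw [Finset.sum_comm] at hs
    simp_rw [Finset.sum_comm (s := Finset.range J)] at hs
    calc _ ≤ ∑ i ∈ I, ∑ k ∈ I, c0 ^ 2 * ‖Ij b 0 (t i) (t k)‖ + 2 * ∑ i ∈ I, ∑ k ∈ I, ∑ j ∈ Finset.range J, c0 ^ 2 * ‖Ij b (j+1) (t i) (t k)‖ := by
          refine add_le_add (by simpa using h0) ?_
          gcongr
      _ = ∑ i ∈ I, ∑ k ∈ I, c0 ^ 2 * (‖Ij b 0 (t i) (t k)‖ + 2 * ∑ j ∈ Finset.range J, ‖Ij b (j+1) (t i) (t k)‖) := by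
          rw [Finset.mul_sum, ← Finset.sum_add_distrib]
          refine Finset.sum_congr rfl fun i _ => ?_
          rw [Finset.mul_sum, ← Finset.sum_add_distrib]
          refine Finset.sum_congr rfl fun k _ => ?_
          rw [← Finset.mul_sum]; ring
      _ ≤ ∑ i ∈ I, ∑ k ∈ I, c0 ^ 2 * (10000 * (β ^ 2 * Y ^ 2) * (1 / (Y + |t i - t k|) + Y / T * (1 + Real.log J) + √(Y * |t i - t k|) / T)) := by
          refine Finset.sum_le_sum fun i hi => Finset.sum_le_sum fun k hk => ?_
          gcongr
          exact ker_bound h hY hT (ht i hi).1 (ht i hi).2 J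
      _ = _ := by
          simp_rw [Finset.mul_sum]
          refine Finset.sum_congr rfl fun i _ => Finset.sum_congr rfl fun k _ => ?_
          ring

lemma space_sum (I : Finset ℕ) (n : ℕ) (hI : I ⊆ Finset.range n) {Y h : ℝ} (hY : 0 < Y) (hh : 0 < h) (i : ℕ) (hi : i ∈ I) :
    ∑ k ∈ I, 1 / (Y + |((i:ℝ) - k) * h|) ≤ 1 / Y + 2 * (1 + Real.log n) / h := by
  have hin := Finset.mem_range.1 (hI hi)
  have h1 : ∑ k ∈ I, 1 / (Y + |((i:ℝ) - k) * h|) ≤ ∑ k ∈ Finset.range n, 1 / (Y + |((i:ℝ) - k) * h|) :=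
    Finset.sum_le_sum_of_subset_of_nonneg hI fun _ _ _ => by positivity
  refine h1.trans ?_
  obtain ⟨m, rfl⟩ := Nat.exists_eq_add_of_lt hin
  rw [show i + m + 1 = i + (1 + m) by ring, Finset.sum_range_add, Finset.sum_range_add]
  have e1 : ∑ k ∈ Finset.range i, 1 / (Y + |((i:ℝ) - k) * h|) ≤ (1 + Real.log (i + (1 + m) : ℕ)) / h := by
    rw [← Finset.sum_range_reflect]
    calc _ ≤ ∑ k ∈ Finset.range i, 1 / ((k:ℝ) + 1) / h := by
          refine Finset.sum_le_sum fun k hk => ?_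
          have hk := Finset.mem_range.1 hk
          have : ((i - 1 - k : ℕ):ℝ) = i - 1 - k := by
            rw [Nat.sub_sub, Nat.cast_sub (by omega)]; push_cast; ring
          rw [this, div_div, show ((i:ℝ) - (i - 1 - k)) = k + 1 by ring, abs_of_nonneg (by positivity)]
          apply one_div_le_one_div_of_le (by positivity); linarith
      _ ≤ _ := by
          rw [← Finset.sum_div]
          gcongr
          refine (harm_le i).trans ?_
          rcases Nat.eq_zero_or_pos i with h0 | h0
          · subst h0
            simpa using Real.log_natCast_nonneg (1 + m)
          · gcongr; omega
  have e2 : ∑ k ∈ Finset.range m, 1 / (Y + |((i:ℝ) - (i + (1 + k) : ℕ)) * h|) ≤ (1 + Real.log (i + (1 + m) : ℕ)) / h := by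
    calc _ ≤ ∑ k ∈ Finset.range m, 1 / ((k:ℝ) + 1) / h := by
          refine Finset.sum_le_sum fun k hk => ?_
          push_cast
          rw [div_div, show ((i:ℝ) - (i + (1 + k))) = -(k + 1) by ring, neg_mul, abs_neg, abs_of_nonneg (by positivity)]
          apply one_div_le_one_div_of_le (by positivity); linarith
      _ ≤ _ := by
          rw [← Finset.sum_div]
          gcongr
          refine (harm_le m).trans ?_
          rcases Nat.eq_zero_or_pos m with h0 | h0
          · subst h0
            simpa using Real.log_natCast_nonneg (i + 1)
          · gcongr; omega
  have e3 : ∑ k ∈ Finset.range 1, 1 / (Y + |((i:ℝ) - (i + k : ℕ)) * h|) = 1 / Y := by simp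
  rw [e3]
  have : 2 * (1 + Real.log (i + (1 + m) : ℕ)) / h = (1 + Real.log (i + (1 + m) : ℕ)) / h + (1 + Real.log (i + (1 + m) : ℕ)) / h := by ring
  linarith
open scoped ContDiff


lemma smooth_glue {F : Type*} [NormedAddCommGroup F] [NormedSpace ℝ F] {f : ℝ → F} {n : WithTop ℕ∞} (h1 : ∀ y, 1 < y → ContDiffAt ℝ n f y) (h2 : ∀ y, y < 3 → f y = 0) : ContDiff ℝ n f := by
  rw [contDiff_iff_contDiffAt]
  intro y
  rcases lt_or_ge 1 y with hy | hy
  · exact h1 y hy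
  · refine (contDiffAt_const (c := (0:F))).congr_of_eventuallyEq ?_
    filter_upwards [Iio_mem_nhds (by linarith : y < 3)] with z hz
    exact h2 z hz

lemma tht_smooth {n : WithTop ℕ∞} {y : ℝ} (hy : 1 < y) : ContDiffAt ℝ n tht y := by
  unfold tht
  have h0 : y ≠ 0 := by linarith
  exact ((contDiffAt_const).add ((contDiffAt_const).div contDiffAt_id h0)).log (by have : 0 < y := by linarith
                                                                                   have : 0 < 1 + 1 / y := by positivity
                                                                                   exact this.ne')

lemma am_smooth {n : WithTop ℕ∞} (G : ℝ) {y : ℝ} (hy : 1 < y) : ContDiffAt ℝ n (am G) y := by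
  unfold am
  have h0 : y * (y + 1) ≠ 0 := by positivity
  have h1 : √(y * (y + 1)) ≠ 0 := by positivity
  refine ContDiffAt.mul (contDiffAt_const.div ((contDiffAt_id.mul (contDiffAt_id.add contDiffAt_const)).sqrt h0) h1) ?_
  exact ((contDiffAt_const.mul ((tht_smooth hy).pow 2)).neg).exp

lemma eta_smooth {n : WithTop ℕ∞} {y : ℝ} (hy : 1 < y) : ContDiffAt ℝ n eta y := by
  unfold eta
  have h0 : y * (y + 1) ≠ 0 := by positivity
  exact contDiffAt_const.div (contDiffAt_id.mul (contDiffAt_id.add contDiffAt_const)) h0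

lemma tht_ge {y : ℝ} (hy : 0 < y) : 1 / (y + 1) ≤ tht y := by
  unfold tht
  have := Real.one_sub_inv_le_log_of_pos (by positivity : 0 < 1 + 1 / y)
  refine le_trans (le_of_eq ?_) this
  field_simp; ring

noncomputable def amc (G Y y : ℝ) : ℝ := am G y * chit ((y + 1) / Y)

lemma amc_zero {G Y y : ℝ} (hY : 4 ≤ Y) (h : y ≤ Y - 1 ∨ 2 * Y - 1 ≤ y) : amc G Y y = 0 := by
  unfold amc
  rw [chit_zero, mul_zero]
  rcases h with h | h
  · left; rw [div_le_one (by linarith)]; linarith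
  · right; rw [le_div_iff₀ (by linarith)]; linarith

lemma amc_smooth (G : ℝ) {Y : ℝ} (hY : 4 ≤ Y) : ContDiff ℝ ∞ (amc G Y) := by
  refine smooth_glue (fun y hy => ?_) fun y hy => amc_zero hY (Or.inl (by linarith))
  unfold amc
  refine (am_smooth G hy).mul ?_
  have : ContDiff ℝ ∞ (fun y : ℝ => chit ((y + 1) / Y)) := chit_contDiff.comp (by fun_prop)
  exact this.contDiffAt

lemma x_exp_le (x : ℝ) : x * Real.exp (-x) ≤ 1 := by
  rw [Real.exp_neg, ← div_eq_mul_inv, div_le_one (Real.exp_pos x)]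
  linarith [Real.add_one_le_exp x]

lemma am_deriv (G : ℝ) {y : ℝ} (hy : 1 < y) : |am G y| ≤ 1 / y ∧ ∃ D, HasDerivAt (am G) D y ∧ |D| ≤ 4 / y ^ 2 := by
  have y0 : 0 < y := by linarith
  set s := √(y * (y + 1)) with hs
  have hs1 : y ≤ s := by rw [hs]; apply Real.le_sqrt_of_sq_le; nlinarith
  have s0 : 0 < s := by linarith
  have hs2 : s ^ 2 = y * (y + 1) := Real.sq_sqrt (by positivity)
  have th0 : 0 < tht y := lt_of_lt_of_le (by positivity) (tht_ge y0)
  have hu : HasDerivAt (fun y : ℝ => 1 / √(y * (y + 1))) (-((2 * y + 1) / (2 * s ^ 3))) y := by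
    have h1 : HasDerivAt (fun y : ℝ => y * (y + 1)) (2 * y + 1) y :=
      ((hasDerivAt_id y).mul ((hasDerivAt_id y).add_const 1)).congr_deriv (by simp; ring)
    have h2 := (h1.sqrt (by positivity)).fun_inv s0.ne'
    simp only [one_div]
    refine h2.congr_deriv ?_
    rw [← hs]; field_simp
  have hv : HasDerivAt (fun y : ℝ => Real.exp (-(G ^ 2 / 4 * tht y ^ 2))) (Real.exp (-(G ^ 2 / 4 * tht y ^ 2)) * (G ^ 2 / 2 * tht y * eta y)) y := by
    refine ((((tht_deriv y0).fun_pow 2).const_mul (G ^ 2 / 4)).fun_neg.exp).congr_deriv ?_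
    push_cast; ring
  have u1 : |1 / s| ≤ 1 / y := by
    rw [abs_of_pos (by positivity)]; gcongr
  have v1 : |Real.exp (-(G ^ 2 / 4 * tht y ^ 2))| ≤ 1 := by
    rw [abs_of_pos (Real.exp_pos _)]
    apply Real.exp_le_one_iff.2
    have : 0 ≤ G ^ 2 / 4 * tht y ^ 2 := by positivity
    linarith
  have u2 : |-((2 * y + 1) / (2 * s ^ 3))| ≤ 2 / y ^ 2 := by
    rw [abs_neg, abs_of_pos (by positivity)]
    calc (2 * y + 1) / (2 * s ^ 3) ≤ (4 * y) / (2 * y ^ 3) := by gcongr; linarith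
      _ = _ := by field_simp; norm_num
  have v2 : |Real.exp (-(G ^ 2 / 4 * tht y ^ 2)) * (G ^ 2 / 2 * tht y * eta y)| ≤ 2 / y := by
    have e0 : 0 < eta y := by unfold eta; positivity
    rw [abs_of_nonneg (by positivity)]
    have h1 := x_exp_le (G ^ 2 / 4 * tht y ^ 2)
    have h2 : eta y / tht y ≤ 1 / y := by
      rw [div_le_iff₀ th0]
      calc eta y = 1 / y * (1 / (y + 1)) := by unfold eta; field_simp
        _ ≤ _ := by gcongr; exact tht_ge y0
    calc _ = 2 * ((G ^ 2 / 4 * tht y ^ 2) * Real.exp (-(G ^ 2 / 4 * tht y ^ 2))) * (eta y / tht y) := by field_simp; ring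
      _ ≤ 2 * 1 * (1 / y) := by gcongr
      _ = _ := by ring
  constructor
  · unfold am
    rw [abs_mul]
    calc _ ≤ 1 / y * 1 := by gcongr
      _ = _ := mul_one _
  · refine ⟨_, hu.mul hv, ?_⟩
    refine (abs_add_le _ _).trans ?_
    rw [abs_mul, abs_mul (1 / s)]
    calc _ ≤ 2 / y ^ 2 * 1 + 1 / y * (2 / y) := by gcongr
      _ = _ := by field_simp; norm_num

lemma amp_amc : ∃ C1 : ℝ, 0 < C1 ∧ ∀ G Y : ℝ, 4 ≤ Y → Amp (amc G Y) (deriv (amc G Y)) (C1 / Y) Y := by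
  have hcs : HasCompactSupport chit := by
    refine HasCompactSupport.intro (isCompact_Icc (a := 1) (b := 2)) fun y hy => chit_zero ?_
    simp only [Set.mem_Icc, not_and_or, not_le] at hy
    rcases hy with hy | hy
    · exact Or.inl hy.le
    · exact Or.inr hy.le
  obtain ⟨c0, h0⟩ := hcs.exists_bound_of_continuous chit_contDiff.continuous
  obtain ⟨c1, h1⟩ := hcs.deriv.exists_bound_of_continuous (chit_contDiff.continuous_deriv (by simp))
  simp only [Real.norm_eq_abs] at h0 h1
  have p0 : 0 ≤ c0 := (abs_nonneg _).trans (h0 0)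
  have p1 : 0 ≤ c1 := (abs_nonneg _).trans (h1 0)
  refine ⟨8 * (c0 + c1) + 1, by positivity, ?_⟩
  intro G Y hY
  have hsm := amc_smooth G hY
  have hY0 : 0 < Y := by linarith
  refine ⟨fun y => (hsm.differentiable (by simp)).differentiableAt.hasDerivAt, hsm.continuous_deriv (by simp), ?_, ?_, fun y => amc_zero hY⟩
  · intro y
    by_cases hy : y ≤ Y - 1 ∨ 2 * Y - 1 ≤ y
    · rw [amc_zero hY hy, abs_zero]; positivity
    · push Not at hy
      unfold amc
      rw [abs_mul]
      have := (am_deriv G (by linarith : 1 < y)).1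
      have y0 : 0 < y := by linarith
      have hh := h0 ((y + 1) / Y)
      calc _ ≤ 1 / y * c0 := by gcongr
        _ ≤ 1 / (Y / 2) * c0 := by gcongr; linarith
        _ ≤ _ := by rw [one_div_mul_eq_div, div_le_div_iff₀ (by positivity) hY0]; nlinarith
  · intro y
    by_cases hy : Y - 1 ≤ y ∧ y ≤ 2 * Y - 1
    · obtain ⟨ha, D, hD, hDb⟩ := am_deriv G (by linarith : 1 < y)
      have hc : HasDerivAt (fun y : ℝ => chit ((y + 1) / Y)) (deriv chit ((y + 1) / Y) * (1 / Y)) y :=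
        ((chit_contDiff.differentiable (by simp)).differentiableAt.hasDerivAt).comp y (((hasDerivAt_id y).add_const 1).div_const Y)
      have : HasDerivAt (amc G Y) _ y := hD.mul hc
      rw [this.deriv]
      refine (abs_add_le _ _).trans ?_
      rw [abs_mul, abs_mul, abs_mul, abs_of_pos (by positivity : 0 < 1 / Y)]
      have y2 : Y / 2 < y := by linarith
      have y3 : 3 * Y / 4 ≤ y := by linarith
      have y0 : 0 < y := by linarith
      have hh := h0 ((y + 1) / Y)
      have hh1 := h1 ((y + 1) / Y)
      calc _ ≤ 4 / y ^ 2 * c0 + 1 / y * (c1 * (1 / Y)) := by gcongr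
        _ ≤ 4 / (3 * Y / 4) ^ 2 * c0 + 1 / (Y / 2) * (c1 * (1 / Y)) := by gcongr
        _ ≤ _ := by
            rw [div_div]
            have e : 4 / (3 * Y / 4) ^ 2 * c0 + 1 / (Y / 2) * (c1 * (1 / Y)) = (64 / 9 * c0 + 2 * c1) / (Y * Y) := by field_simp; ring
            rw [e]; apply div_le_div_of_nonneg_right _ (by positivity); linarith
    · have : deriv (amc G Y) y = 0 := by
        have : amc G Y =ᶠ[nhds y] fun _ => 0 := by
          rw [not_and_or, not_le, not_le] at hy
          rcases hy with hy | hy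
          · filter_upwards [Iio_mem_nhds hy] with z hz
            exact amc_zero hY (Or.inl (le_of_lt hz))
          · filter_upwards [Ioi_mem_nhds hy] with z hz
            exact amc_zero hY (Or.inr (le_of_lt hz))
        rw [this.deriv_eq]; simp
      rw [this, abs_zero]; positivity

lemma amp_eta {a : ℝ → ℝ} {β Y T : ℝ} (hY : 4 ≤ Y) (hT : 0 < T) (h : Amp a (deriv a) β Y) (hs : ContDiff ℝ ∞ a) :
    ContDiff ℝ ∞ (fun y => a y * (T * eta y)) ∧ Amp (fun y => a y * (T * eta y)) (deriv (fun y => a y * (T * eta y))) (8 * (β * T / Y ^ 2)) Y := by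
  have hβ := beta_nonneg h
  have hY0 : 0 < Y := by linarith
  have hsm : ContDiff ℝ ∞ (fun y => a y * (T * eta y)) := by
    refine smooth_glue (fun y hy => hs.contDiffAt.mul (contDiffAt_const.mul (eta_smooth hy))) fun y hy => ?_
    rw [h.supp y (Or.inl (by linarith)), zero_mul]
  refine ⟨hsm, fun y => (hsm.differentiable (by simp)).differentiableAt.hasDerivAt, hsm.continuous_deriv (by simp), ?_, ?_, fun y hy => by rw [h.supp y hy, zero_mul]⟩
  · intro y
    by_cases hy : y ≤ Y - 1 ∨ 2 * Y - 1 ≤ y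
    · rw [h.supp y hy, zero_mul, abs_zero]; positivity
    · push Not at hy
      have y3 : 3 * Y / 4 ≤ y := by linarith
      have e1 : 0 < eta y := by unfold eta; apply one_div_pos.2; nlinarith
      have e2 : eta y ≤ 2 / Y ^ 2 := by
        unfold eta; rw [div_le_div_iff₀ (by nlinarith) (by positivity)]; nlinarith
      rw [abs_mul, abs_of_pos (by positivity : 0 < T * eta y)]
      have := h.bd y
      calc _ ≤ β * (T * (2 / Y ^ 2)) := by gcongr
        _ = 2 * (β * T / Y ^ 2) := by ring
        _ ≤ _ := by gcongr; norm_num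
  · intro y
    by_cases hy : Y - 1 ≤ y ∧ y ≤ 2 * Y - 1
    · have y3 : 3 * Y / 4 ≤ y := by linarith
      have y0 : 0 < y := by linarith
      have hd : HasDerivAt eta (-((2 * y + 1) / (y * (y + 1)) ^ 2)) y := by
        have h1 : HasDerivAt (fun y : ℝ => y * (y + 1)) (2 * y + 1) y :=
          ((hasDerivAt_id y).mul ((hasDerivAt_id y).add_const 1)).congr_deriv (by simp; ring)
        have := h1.fun_inv (by positivity : y * (y + 1) ≠ 0)
        unfold eta
        simp only [one_div]
        exact this.congr_deriv (by ring)
      have hD := (h.der y).fun_mul (hd.const_mul T)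
      rw [hD.deriv]
      have e1 : 0 < eta y := by unfold eta; apply one_div_pos.2; nlinarith
      have e2 : eta y ≤ 2 / Y ^ 2 := by
        unfold eta; rw [div_le_div_iff₀ (by nlinarith) (by positivity)]; nlinarith
      have e3 : |-((2 * y + 1) / (y * (y + 1)) ^ 2)| ≤ 6 / Y ^ 3 := by
        rw [abs_neg, abs_of_pos (by positivity)]
        calc (2 * y + 1) / (y * (y + 1)) ^ 2 ≤ (2 * (y + 1)) / (y * (y + 1)) ^ 2 := by gcongr; linarith
          _ = 2 / (y ^ 2 * (y + 1)) := by field_simp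
          _ ≤ 2 / ((3 * Y / 4) ^ 2 * (3 * Y / 4)) := by gcongr; linarith
          _ ≤ 6 / Y ^ 3 := by
              rw [div_le_div_iff₀ (by positivity) (by positivity)]
              nlinarith [pow_pos hY0 3]
      refine (abs_add_le _ _).trans ?_
      rw [abs_mul, abs_mul (a y), abs_of_pos (by positivity : 0 < T * eta y), abs_mul T, abs_of_pos hT]
      have := h.bd y; have := h.bd' y
      calc _ ≤ β / Y * (T * (2 / Y ^ 2)) + β * (T * (6 / Y ^ 3)) := by gcongr
        _ = _ := by field_simp; ring
    · have : deriv (fun y => a y * (T * eta y)) y = 0 := by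
        have : (fun y => a y * (T * eta y)) =ᶠ[nhds y] fun _ => 0 := by
          rw [not_and_or, not_le, not_le] at hy
          rcases hy with hy | hy
          · filter_upwards [Iio_mem_nhds hy] with z hz
            rw [h.supp z (Or.inl (le_of_lt hz)), zero_mul]
          · filter_upwards [Ioi_mem_nhds hy] with z hz
            rw [h.supp z (Or.inr (le_of_lt hz)), zero_mul]
        rw [this.deriv_eq]; simp
      rw [this, abs_zero]; positivity


noncomputable def FF (b : ℝ → ℝ) (I : Finset ℕ) (c t : ℕ → ℝ) (y : ℝ) : ℂ := (b y : ℂ) * ∑ i ∈ I, (c i : ℂ) * ee (t i * tht y)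

lemma FF_smooth {b b' : ℝ → ℝ} {β Y : ℝ} (hY : 4 ≤ Y) (h : Amp b b' β Y) (hs : ContDiff ℝ ∞ b) (I : Finset ℕ) (c t : ℕ → ℝ) :
    ContDiff ℝ ∞ (FF b I c t) := by
  refine smooth_glue (fun y hy => ?_) fun y hy => ?_
  · unfold FF
    refine ContDiffAt.mul (Complex.ofRealCLM.contDiff.comp hs).contDiffAt (ContDiffAt.sum fun i _ => contDiffAt_const.mul ?_)
    unfold ee
    refine ContDiffAt.cexp (ContDiffAt.mul ?_ contDiffAt_const)
    exact (Complex.ofRealCLM.contDiff.contDiffAt).comp y (contDiffAt_const.mul (tht_smooth hy))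
  · unfold FF
    rw [h.supp y (Or.inl (by linarith))]; simp

lemma FF_hcs {b b' : ℝ → ℝ} {β Y : ℝ} (h : Amp b b' β Y) (I : Finset ℕ) (c t : ℕ → ℝ) : HasCompactSupport (FF b I c t) := by
  refine h.hcs.mono fun y hy hb => hy ?_
  unfold FF; rw [hb]; simp

lemma poisson_scale {f : ℝ → ℂ} (hf : ContDiff ℝ ∞ f) (hc : HasCompactSupport f) {r : ℕ} (hr : 0 < r) :
    ∑' n : ℤ, f (n / r) = r * ∑' k : ℤ, 𝓕 f ((k * r : ℤ) : ℝ) := by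
  have r0 : (0:ℝ) < r := by exact_mod_cast hr
  have h1 : ContDiff ℝ ∞ (fun y : ℝ => f (y / r)) := hf.comp (by fun_prop)
  have h2 : HasCompactSupport (fun y : ℝ => f (y / r)) := by
    have := hc.comp_homeomorph (Homeomorph.mulRight₀ ((r:ℝ)⁻¹) (by positivity))
    simpa [Function.comp_def, div_eq_mul_inv] using this
  have key := SchwartzMap.tsum_eq_tsum_fourier (h2.toSchwartzMap h1) 0
  simp only [zero_add] at key
  rw [← tsum_mul_left]
  refine Eq.trans ?_ (key.trans ?_)
  · rfl
  · refine tsum_congr fun k => ?_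
    have e : 𝓕 ((h2.toSchwartzMap h1 : 𝓢(ℝ, ℂ)) : ℝ → ℂ) (k:ℝ) = r * 𝓕 f ((k * r : ℤ) : ℝ) := by
      rw [Real.fourier_real_eq_integral_exp_smul, Real.fourier_real_eq_integral_exp_smul]
      have := Measure.integral_comp_div (fun v : ℝ => Complex.exp (↑(-2 * π * v * ((k * r : ℤ) : ℝ)) * Complex.I) • f v) (r:ℝ)
      rw [abs_of_pos r0] at this
      refine Eq.trans ?_ (this.trans (by rw [Complex.real_smul]; push_cast; rfl))
      congr 1
      ext v
      have : -2 * π * (v / r) * ((k * r : ℤ) : ℝ) = -2 * π * v * k := by push_cast; field_simp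
      rw [this]; rfl
    rw [← e]; simp [SchwartzMap.fourier_coe]

lemma div_bound {δ : ℝ} (hδ : 0 < δ) : ∃ C : ℝ, 0 < C ∧ ∀ n : ℕ, n ≠ 0 → ((n.divisors.card : ℕ) : ℝ) ≤ C * (n:ℝ) ^ δ := by
  set P := ⌈(2:ℝ) ^ (1 / δ)⌉₊ with hP
  have hl : 0 < Real.log 2 := Real.log_pos (by norm_num)
  set A : ℝ := 1 + 1 / (δ * Real.log 2) with hA
  have hA1 : 1 ≤ A := by rw [hA]; have : 0 < 1 / (δ * Real.log 2) := by positivity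
                         linarith
  refine ⟨A ^ P, by positivity, fun n hn => ?_⟩
  have hn0 : n.factorization.prod (fun p k => p ^ k) = n := Nat.prod_factorization_pow_eq_self hn
  rw [Nat.card_divisors hn]
  have e2 : (n:ℝ) ^ δ = ∏ p ∈ n.primeFactors, ((p:ℝ) ^ (n.factorization p)) ^ δ := by
    rw [Real.finsetProd_rpow _ _ (fun i _ => by positivity)]
    congr 1
    conv_lhs => rw [← hn0]
    rw [Finsupp.prod]; push_cast; rfl
  rw [e2]
  have e3 : ∏ p ∈ n.primeFactors, (if p < P then A else 1) ≤ A ^ P := by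
    rw [Finset.prod_ite, Finset.prod_const_one, mul_one, Finset.prod_const]
    refine pow_le_pow_right₀ hA1 ?_
    calc _ ≤ (Finset.range P).card := Finset.card_le_card fun p hp => by simp at hp ⊢; exact hp.2
      _ = P := Finset.card_range P
  push_cast
  calc ∏ p ∈ n.primeFactors, ((n.factorization p : ℝ) + 1) ≤ ∏ p ∈ n.primeFactors, ((if p < P then A else 1) * ((p:ℝ) ^ (n.factorization p)) ^ δ) := by
        refine Finset.prod_le_prod (fun _ _ => by positivity) fun p hp => ?_
        have pp := Nat.prime_of_mem_primeFactors hp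
        have p2 : (2:ℝ) ≤ p := by exact_mod_cast pp.two_le
        set v := n.factorization p
        split_ifs with h
        · have h1 : (2:ℝ) ^ ((v:ℝ) * δ) ≤ ((p:ℝ) ^ v) ^ δ := by
            rw [← Real.rpow_natCast, ← Real.rpow_mul (by positivity)]
            gcongr
          have h2 : 1 + v * δ * Real.log 2 ≤ (2:ℝ) ^ ((v:ℝ) * δ) := by
            rw [Real.rpow_def_of_pos (by norm_num)]
            have := Real.add_one_le_exp (Real.log 2 * (v * δ)); linarith
          have h3 : (v:ℝ) + 1 ≤ A * (1 + v * δ * Real.log 2) := by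
            have : A * (1 + v * δ * Real.log 2) = 1 + v + v * δ * Real.log 2 + 1 / (δ * Real.log 2) := by rw [hA]; field_simp; ring
            rw [this]
            have : 0 ≤ v * δ * Real.log 2 := by positivity
            have : 0 ≤ 1 / (δ * Real.log 2) := by positivity
            linarith
          exact h3.trans (by gcongr; exact h2.trans h1)
        · rw [one_mul]
          have h1 : (2:ℝ) ≤ (p:ℝ) ^ δ := by
            have : (2:ℝ) ^ (1 / δ) ≤ p := (Nat.le_ceil _).trans (by exact_mod_cast not_lt.1 h)
            calc (2:ℝ) = ((2:ℝ) ^ (1 / δ)) ^ δ := by rw [← Real.rpow_mul (by norm_num)]; field_simp; simp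
              _ ≤ _ := by gcongr
          have h2 : ((p:ℝ) ^ v) ^ δ = ((p:ℝ) ^ δ) ^ v := by
            rw [← Real.rpow_natCast, ← Real.rpow_natCast, ← Real.rpow_mul (by positivity), ← Real.rpow_mul (by positivity), mul_comm]
          rw [h2]
          calc (v:ℝ) + 1 ≤ (2:ℝ) ^ v := by exact_mod_cast Nat.lt_two_pow_self (n := v)
            _ ≤ _ := by gcongr
    _ = (∏ p ∈ n.primeFactors, (if p < P then A else 1)) * ∏ p ∈ n.primeFactors, ((p:ℝ) ^ (n.factorization p)) ^ δ := Finset.prod_mul_distrib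
    _ ≤ _ := by
        gcongr

lemma div_sum {δ : ℝ} (hδ : 0 < δ) : ∃ C : ℝ, 0 < C ∧ ∀ (f : ℝ → ℂ), ContDiff ℝ ∞ f → HasCompactSupport f → ∀ S : ℕ,
    ‖∑ r ∈ Finset.range S, (1 / ((r:ℂ) + 1)) * ∑' n : ℤ, f (n / ((r + 1 : ℕ) : ℝ))‖ ≤
      S * ‖𝓕 f 0‖ + C * ∑' N : ℤ, |(N:ℝ)| ^ δ * ‖𝓕 f (N:ℝ)‖ := by
  obtain ⟨C, C0, hC⟩ := div_bound hδ
  refine ⟨C, C0, fun f hf hc S => ?_⟩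
  have s0 : Summable fun N : ℤ => ‖𝓕 f (N:ℝ)‖ := sch_summable0 (hc.toSchwartzMap hf)
  have s1 : Summable fun N : ℤ => |(N:ℝ)| ^ δ * ‖𝓕 f (N:ℝ)‖ := sch_summable (hc.toSchwartzMap hf) δ
  have hr : ∀ r : ℕ, Summable (fun N : ℤ => if ((r + 1 : ℕ) : ℤ) ∣ N then ‖𝓕 f (N:ℝ)‖ else 0) := by
    intro r
    refine Summable.of_nonneg_of_le (fun N => by split_ifs <;> positivity) (fun N => ?_) s0
    split_ifs
    · exact le_rfl
    · positivity
  have h1 : ∀ r : ℕ, ‖(1 / ((r:ℂ) + 1)) * ∑' n : ℤ, f (n / ((r + 1 : ℕ) : ℝ))‖ ≤ ∑' N : ℤ, if ((r + 1 : ℕ) : ℤ) ∣ N then ‖𝓕 f (N:ℝ)‖ else 0 := by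
    intro r
    rw [poisson_scale hf hc (Nat.succ_pos r)]
    have : (1 / ((r:ℂ) + 1)) * (((r + 1 : ℕ) : ℂ) * ∑' k : ℤ, 𝓕 f ((k * ((r + 1 : ℕ) : ℤ) : ℤ) : ℝ)) = ∑' k : ℤ, 𝓕 f ((k * ((r + 1 : ℕ) : ℤ) : ℤ) : ℝ) := by
      have : (r:ℂ) + 1 ≠ 0 := by exact_mod_cast Nat.succ_ne_zero r
      rw [← mul_assoc]; push_cast; rw [one_div_mul_cancel this, one_mul]
    rw [this]
    have inj : Function.Injective (fun k : ℤ => k * ((r + 1 : ℕ) : ℤ)) := fun a b h => by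
      have : ((r + 1 : ℕ) : ℤ) ≠ 0 := by positivity
      exact mul_right_cancel₀ this h
    have s2 : Summable fun k : ℤ => ‖𝓕 f ((k * ((r + 1 : ℕ) : ℤ) : ℤ) : ℝ)‖ := s0.comp_injective inj
    refine (norm_tsum_le_tsum_norm s2).trans (le_of_eq ?_)
    rw [← Function.Injective.tsum_eq inj (f := fun N : ℤ => if ((r + 1 : ℕ) : ℤ) ∣ N then ‖𝓕 f (N:ℝ)‖ else 0)]
    · refine tsum_congr fun k => ?_
      rw [if_pos (dvd_mul_left _ _)]
    · intro N hN
      rw [Function.mem_support] at hN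
      have : ((r + 1 : ℕ) : ℤ) ∣ N := by by_contra h; exact hN (if_neg h)
      obtain ⟨k, hk⟩ := this
      exact ⟨k, by simp only [hk]; ring⟩
  refine (norm_sum_le _ _).trans ((Finset.sum_le_sum fun r _ => h1 r).trans ?_)
  rw [← Summable.tsum_finsetSum fun r _ => hr r]
  have s3 : Summable fun N : ℤ => if N = 0 then (S:ℝ) * ‖𝓕 f 0‖ else 0 := (hasSum_ite_eq (0:ℤ) ((S:ℝ) * ‖𝓕 f 0‖)).summable
  have e1 : S * ‖𝓕 f 0‖ = ∑' N : ℤ, if N = 0 then (S:ℝ) * ‖𝓕 f 0‖ else 0 := (tsum_ite_eq (0:ℤ) (fun _ => (S:ℝ) * ‖𝓕 f 0‖)).symm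
  rw [e1, ← tsum_mul_left, ← s3.tsum_add (s1.mul_left C)]
  refine Summable.tsum_le_tsum (fun N => ?_) (summable_sum fun r _ => hr r) (s3.add (s1.mul_left C))
  by_cases hN : N = 0
  · subst hN
    simp [Real.zero_rpow hδ.ne']
  · rw [if_neg hN, zero_add, ← Finset.sum_filter, Finset.sum_const, nsmul_eq_mul, ← mul_assoc]
    gcongr
    have hn : N.natAbs ≠ 0 := Int.natAbs_ne_zero.2 hN
    have e : |(N:ℝ)| = (N.natAbs : ℝ) := by rw [Nat.cast_natAbs]; push_cast; rfl
    rw [e]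
    refine le_trans ?_ (hC _ hn)
    have : ((Finset.range S).filter fun r => ((r + 1 : ℕ) : ℤ) ∣ N).card ≤ N.natAbs.divisors.card := by
      refine Finset.card_le_card_of_injOn (fun r => r + 1) (fun r h => ?_) fun a _ b _ h => by simpa using h
      simp only [Finset.coe_filter, Set.mem_ofPred_eq] at h
      simp only [Finset.mem_coe, Nat.mem_divisors]
      exact ⟨Int.natCast_dvd.1 h.2, hn⟩
    exact_mod_cast this


lemma sch_summable2 (g : 𝓢(ℝ, ℂ)) (k : ℝ) : Summable fun N : ℤ => |(N:ℝ)| ^ k * ‖𝓕 (g : ℝ → ℂ) (N:ℝ)‖ ^ 2 := by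
  refine Summable.of_nonneg_of_le (fun N => by positivity) (fun N => ?_) ((sch_summable g k).mul_right (∑' N : ℤ, ‖𝓕 (g : ℝ → ℂ) (N:ℝ)‖))
  rw [pow_two, ← mul_assoc]
  gcongr
  exact (sch_summable0 g).le_tsum N fun _ _ => norm_nonneg _

lemma cauchy_div {δ : ℝ} (hδ : 0 < δ) (hδ' : δ < 1 / 3) : ∃ C : ℝ, 0 < C ∧ ∀ (g : 𝓢(ℝ, ℂ)) (N0 : ℝ), 1 ≤ N0 →
    (∑' N : ℤ, |(N:ℝ)| ^ δ * ‖𝓕 (g : ℝ → ℂ) (N:ℝ)‖) ^ 2 ≤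
      C * (N0 ^ (3 * δ - 1) * (N0 ^ 2 * ∑' N : ℤ, ‖𝓕 (g : ℝ → ℂ) (N:ℝ)‖ ^ 2 + ∑' N : ℤ, |(N:ℝ)| ^ 2 * ‖𝓕 (g : ℝ → ℂ) (N:ℝ)‖ ^ 2)) := by
  have sA : Summable fun N : ℤ => |(N:ℝ)| ^ (-(1 + δ)) := Real.summable_abs_int_rpow (by linarith)
  set A := ∑' N : ℤ, |(N:ℝ)| ^ (-(1 + δ)) with hA
  have A0 : 0 ≤ A := tsum_nonneg fun _ => by positivity
  refine ⟨A + 1, by positivity, fun g N0 hN0 => ?_⟩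
  have n0 : 0 < N0 := by linarith
  set F := fun N : ℤ => ‖𝓕 (g : ℝ → ℂ) (N:ℝ)‖ with hF
  have hF0 : ∀ N, 0 ≤ F N := fun N => norm_nonneg _
  have sB := sch_summable2 g (1 + 3 * δ)
  have s0 : Summable fun N : ℤ => F N ^ 2 := by simpa using sch_summable2 g 0
  have s2 : Summable fun N : ℤ => |(N:ℝ)| ^ 2 * F N ^ 2 := by
    have := sch_summable2 g 2
    simpa only [Real.rpow_two] using this
  have e1 : ∀ N : ℤ, (|(N:ℝ)| ^ (-((1 + δ) / 2))) ^ (2:ℝ) = |(N:ℝ)| ^ (-(1 + δ)) := fun N => by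
    rw [← Real.rpow_mul (abs_nonneg _)]; congr 1; ring
  have e2 : ∀ N : ℤ, (|(N:ℝ)| ^ ((1 + 3 * δ) / 2) * F N) ^ (2:ℝ) = |(N:ℝ)| ^ (1 + 3 * δ) * F N ^ 2 := fun N => by
    rw [Real.mul_rpow (by positivity) (hF0 N), ← Real.rpow_mul (abs_nonneg _), Real.rpow_two]; congr 2; ring
  have key := Real.inner_le_Lp_mul_Lq_tsum_of_nonneg (p := 2) (q := 2) Real.HolderConjugate.two_two
    (f := fun N : ℤ => |(N:ℝ)| ^ (-((1 + δ) / 2))) (g := fun N : ℤ => |(N:ℝ)| ^ ((1 + 3 * δ) / 2) * F N)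
    (fun N => by positivity) (fun N => by positivity) (by simpa only [e1] using sA) (by simpa only [e2] using sB)
  simp only [e1, e2] at key
  have e3 : ∀ N : ℤ, |(N:ℝ)| ^ (-((1 + δ) / 2)) * (|(N:ℝ)| ^ ((1 + 3 * δ) / 2) * F N) = |(N:ℝ)| ^ δ * F N := fun N => by
    rw [← mul_assoc]
    by_cases hN : N = 0
    · subst hN
      rw [Int.cast_zero, abs_zero, Real.zero_rpow (by linarith), Real.zero_rpow hδ.ne']; ring
    · rw [← Real.rpow_add (abs_pos.2 (by exact_mod_cast hN))]; congr 2; ring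
  simp only [e3] at key
  rw [← Real.sqrt_eq_rpow, ← Real.sqrt_eq_rpow] at key
  have B0 : 0 ≤ ∑' N : ℤ, |(N:ℝ)| ^ (1 + 3 * δ) * F N ^ 2 := tsum_nonneg fun _ => by positivity
  have S0 : 0 ≤ ∑' N : ℤ, |(N:ℝ)| ^ δ * F N := tsum_nonneg fun N => by positivity
  have hB : ∑' N : ℤ, |(N:ℝ)| ^ (1 + 3 * δ) * F N ^ 2 ≤ N0 ^ (3 * δ - 1) * (N0 ^ 2 * ∑' N : ℤ, F N ^ 2 + ∑' N : ℤ, |(N:ℝ)| ^ 2 * F N ^ 2) := by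
    rw [← tsum_mul_left, ← (s0.mul_left _).tsum_add s2, ← tsum_mul_left]
    refine Summable.tsum_le_tsum (fun N => ?_) sB (((s0.mul_left _).add s2).mul_left _)
    have : |(N:ℝ)| ^ (1 + 3 * δ) ≤ N0 ^ (3 * δ - 1) * (N0 ^ 2 + |(N:ℝ)| ^ 2) := by
      have e4 : N0 ^ (3 * δ - 1) * N0 ^ 2 = N0 ^ (1 + 3 * δ) := by
        rw [← Real.rpow_two, ← Real.rpow_add n0]; congr 1; ring
      rcases le_total |(N:ℝ)| N0 with h | h
      · calc |(N:ℝ)| ^ (1 + 3 * δ) ≤ N0 ^ (1 + 3 * δ) := by gcongr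
          _ = N0 ^ (3 * δ - 1) * N0 ^ 2 := e4.symm
          _ ≤ _ := by gcongr; nlinarith [abs_nonneg (N:ℝ)]
      · have hp : 0 < |(N:ℝ)| := by linarith
        calc |(N:ℝ)| ^ (1 + 3 * δ) = |(N:ℝ)| ^ (3 * δ - 1) * |(N:ℝ)| ^ 2 := by
              rw [← Real.rpow_two, ← Real.rpow_add hp]; congr 1; ring
          _ ≤ N0 ^ (3 * δ - 1) * |(N:ℝ)| ^ 2 := by
              gcongr ?_ * _
              exact Real.rpow_le_rpow_of_nonpos n0 h (by linarith)
          _ ≤ _ := by gcongr; nlinarith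
    calc |(N:ℝ)| ^ (1 + 3 * δ) * F N ^ 2 ≤ (N0 ^ (3 * δ - 1) * (N0 ^ 2 + |(N:ℝ)| ^ 2)) * F N ^ 2 := by gcongr
      _ = _ := by ring
  calc (∑' N : ℤ, |(N:ℝ)| ^ δ * F N) ^ 2 ≤ (√A * √(∑' N : ℤ, |(N:ℝ)| ^ (1 + 3 * δ) * F N ^ 2)) ^ 2 := by gcongr
    _ = A * ∑' N : ℤ, |(N:ℝ)| ^ (1 + 3 * δ) * F N ^ 2 := by rw [mul_pow, Real.sq_sqrt A0, Real.sq_sqrt B0]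
    _ ≤ (A + 1) * _ := by gcongr; linarith

lemma flat_sum {Y s : ℝ} (hY : 4 ≤ Y) (hs : 0 ≤ s) (H : 𝓢(ℝ, ℂ)) (hb : ∀ y, ‖H y‖ ≤ s) (hz : ∀ y, y < Y - 1 ∨ 2 * Y - 1 < y → H y = 0) :
    ∑' N : ℤ, ‖𝓕 (H : ℝ → ℂ) (N:ℝ)‖ ^ 2 ≤ 3 * Y ^ 2 * s ^ 2 := by
  have hJY : Y ≤ ⌈Y⌉₊ := Nat.le_ceil Y
  have hJ2 : (⌈Y⌉₊ : ℝ) < Y + 1 := Nat.ceil_lt_add_one (by linarith)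
  have hc : ∀ j : ℤ, ‖corr H j‖ ≤ Y * s ^ 2 := by
    intro j
    unfold corr
    rw [← setIntegral_eq_integral_of_forall_compl_eq_zero (s := Set.Icc (Y - 1) (2 * Y - 1))]
    · have := norm_setIntegral_le_of_norm_le_const (μ := volume) (s := Set.Icc (Y - 1) (2 * Y - 1)) (f := fun y : ℝ => H (y + j) * star (H y)) (C := s * s) (by simp) (fun y _ => by
        rw [norm_mul, norm_star]
        have := hb (y + j); have := hb y
        gcongr)
      rw [Real.volume_real_Icc_of_le (by linarith)] at this
      calc _ ≤ _ := this
        _ = _ := by ring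
    · intro y hy
      simp only [Set.mem_Icc, not_and_or, not_le] at hy
      rw [hz y hy]; simp
  refine (parseval_le H ⌈Y⌉₊ ?_).trans ?_
  · intro y j hj
    have hj' : (⌈Y⌉₊:ℝ) < |(j:ℝ)| := by exact_mod_cast hj
    by_cases h1 : y < Y - 1 ∨ 2 * Y - 1 < y
    · rw [hz y h1]; simp
    · by_cases h2 : y + j < Y - 1 ∨ 2 * Y - 1 < y + j
      · rw [hz _ h2]; simp
      · push Not at h1 h2
        have : |(j:ℝ)| ≤ Y := by rw [abs_le]; constructor <;> linarith
        linarith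
  · calc _ ≤ Y * s ^ 2 + 2 * ∑ j ∈ Finset.range ⌈Y⌉₊, Y * s ^ 2 := by
          gcongr
          · exact hc 0
          · exact hc _
      _ = (1 + 2 * ⌈Y⌉₊) * (Y * s ^ 2) := by rw [Finset.sum_const, Finset.card_range, nsmul_eq_mul]; ring
      _ ≤ (3 * Y) * (Y * s ^ 2) := by gcongr; linarith
      _ = _ := by ring

lemma fd_test {b b' : ℝ → ℝ} {β Y T t : ℝ} (h : Amp b b' β Y) (hY : 4 ≤ Y) (hT : 0 < T) (ht : T ≤ t) :
    ‖∫ y : ℝ, (b y : ℂ) * ee (t * tht y)‖ ≤ 8 * β * Y ^ 2 / T := by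
  have hβ := beta_nonneg h
  have t0 : 0 < t := by linarith
  have hle : Y - 1 ≤ 2 * Y - 1 := by linarith
  have hpos : ∀ y ∈ Set.Icc (Y - 1) (2 * Y - 1), 0 < y := fun y hy => by linarith [hy.1]
  rw [← setIntegral_eq_integral_of_forall_compl_eq_zero (s := Set.Ioc (Y - 1) (2 * Y - 1)), ← intervalIntegral.integral_of_le hle]
  · have key := ibp hle (B := b) (B' := b') (P := fun y => -(y * (y + 1)) / t) (P' := fun y => -(2 * y + 1) / t) (Φ := fun y => t * tht y) (Φ' := fun y => t * (-eta y))
      (fun y _ => h.der y) (fun y _ => ?_) (fun y hy => (tht_deriv (hpos y hy)).const_mul t) h.cont.continuousOn (Continuous.continuousOn (by fun_prop)) ?_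
      (h.supp _ (Or.inl le_rfl)) (h.supp _ (Or.inr le_rfl))
    · rw [intervalIntegral.integral_congr (g := fun y => ((b y * (-(y * (y + 1)) / t) * (t * (-eta y)) : ℝ) : ℂ) * ee (t * tht y))]
      · refine key.trans ?_
        have := intervalIntegral.norm_integral_le_of_norm_le_const (a := Y - 1) (b := 2 * Y - 1) (C := 8 * β * Y / T) (f := fun y => |b' y| * |(-(y * (y + 1)) / t)| + |b y| * |(-(2 * y + 1) / t)|) ?_
        · refine (Real.le_norm_self _).trans (this.trans (le_of_eq ?_))
          rw [abs_of_pos (by linarith)]; ring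
        · intro y hy
          rw [Set.uIoc_of_le hle] at hy
          have y0 : 0 < y := by linarith [hy.1]
          rw [Real.norm_eq_abs, abs_of_nonneg (by positivity), neg_div, neg_div, abs_neg, abs_neg, abs_of_pos (by positivity : 0 < y * (y + 1) / t), abs_of_pos (by positivity : 0 < (2 * y + 1) / t)]
          have h1 := h.bd y
          have h2 := h.bd' y
          have h3 : y + 1 ≤ 2 * Y := by linarith [hy.2]
          have h3' : y ≤ 2 * Y := by linarith [hy.2]
          have h4 : 2 * y + 1 ≤ 4 * Y := by linarith [hy.2]
          calc _ ≤ β / Y * ((2 * Y) * (2 * Y) / T) + β * (4 * Y / T) := by gcongr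
            _ = _ := by field_simp; ring
      · intro y hy
        rw [Set.uIcc_of_le hle] at hy
        have y0 := hpos y hy
        have : b y * (-(y * (y + 1)) / t) * (t * (-eta y)) = b y := by unfold eta; field_simp
        simp only [this]
    · refine (((hasDerivAt_id y).mul ((hasDerivAt_id y).add_const 1)).neg.div_const t).congr_deriv (by simp; ring)
    · unfold eta
      refine ContinuousOn.mul continuousOn_const (ContinuousOn.neg (ContinuousOn.div continuousOn_const (Continuous.continuousOn (by fun_prop)) fun y hy => ?_))
      have := hpos y hy; positivity
  · intro y hy
    simp only [Set.mem_Ioc, not_and_or, not_le, not_lt] at hy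
    rw [h.supp y (by rcases hy with h | h; exact Or.inl h; exact Or.inr h.le)]; simp


noncomputable def SS (I : Finset ℕ) (t : ℕ → ℝ) (Y T : ℝ) : ℝ :=
  ∑ i ∈ I, ∑ k ∈ I, (1 / (Y + |t i - t k|) + Y / T * (1 + Real.log ⌈Y⌉₊) + √(Y * |t i - t k|) / T)

lemma FF_deriv {b b' : ℝ → ℝ} {β Y T : ℝ} (hY : 4 ≤ Y) (hT : 0 < T) (h : Amp b b' β Y) (I : Finset ℕ) (t : ℕ → ℝ) (y : ℝ) :
    HasDerivAt (FF b I (fun _ => 1) t) (FF b' I (fun _ => 1) t y - Complex.I * FF (fun y => b y * (T * eta y)) I (fun i => t i / T) t y) y := by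
  rcases lt_or_ge 0 y with hy | hy
  · unfold FF
    have h1 := (h.der y).ofReal_comp
    have h2 : HasDerivAt (fun y => ∑ i ∈ I, (((1:ℝ)):ℂ) * ee (t i * tht y)) (∑ i ∈ I, ((1:ℝ):ℂ) * (ee (t i * tht y) * ((t i * (-eta y) : ℝ) * Complex.I))) y :=
      HasDerivAt.fun_sum fun i _ => (hasDerivAt_ee ((tht_deriv hy).const_mul (t i))).const_mul _
    refine (h1.mul h2).congr_deriv ?_
    rw [sub_eq_add_neg]
    congr 1
    rw [Finset.mul_sum, Finset.mul_sum, Finset.mul_sum, ← Finset.sum_neg_distrib]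
    refine Finset.sum_congr rfl fun i _ => ?_
    have : (T:ℂ) ≠ 0 := by exact_mod_cast hT.ne'
    push_cast
    field_simp
  · have hz : ∀ z < Y - 1, b z = 0 := fun z hz => h.supp z (Or.inl hz.le)
    have hev : b =ᶠ[nhds y] fun _ => 0 := by
      filter_upwards [Iio_mem_nhds (by linarith : y < Y - 1)] with z hz'
      exact hz z hz'
    have hb' : b' y = 0 := by
      rw [← (h.der y).deriv, hev.deriv_eq]; simp
    have e : FF b' I (fun _ => 1) t y - Complex.I * FF (fun y => b y * (T * eta y)) I (fun i => t i / T) t y = 0 := by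
      unfold FF; simp only [hb', hz y (by linarith : y < Y - 1)]; simp
    rw [e]
    refine (hasDerivAt_const y (0:ℂ)).congr_of_eventuallyEq ?_
    filter_upwards [hev] with z hz'
    unfold FF; rw [hz']; simp

lemma sum_le_two {x y z : ℂ} (h : x = y - Complex.I * z) : ‖x‖ ^ 2 ≤ 2 * ‖y‖ ^ 2 + 2 * ‖z‖ ^ 2 := by
  have : ‖x‖ ≤ ‖y‖ + ‖z‖ := by
    rw [h]; refine (norm_sub_le _ _).trans ?_; simp
  nlinarith [sq_nonneg (‖y‖ - ‖z‖), norm_nonneg x, norm_nonneg y, norm_nonneg z]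

lemma energy : ∃ C : ℝ, 0 < C ∧ ∀ (G Y T : ℝ) (I : Finset ℕ) (t : ℕ → ℝ), 4 ≤ Y → 0 < T → (∀ i ∈ I, T ≤ t i ∧ t i ≤ 2 * T) →
    ∃ g : 𝓢(ℝ, ℂ), (∀ y, g y = FF (amc G Y) I (fun _ => 1) t y) ∧ ∑' N : ℤ, ‖𝓕 (g : ℝ → ℂ) (N:ℝ)‖ ^ 2 ≤ C * SS I t Y T ∧
    ∑' N : ℤ, |(N:ℝ)| ^ 2 * ‖𝓕 (g : ℝ → ℂ) (N:ℝ)‖ ^ 2 ≤ C * ((T / Y ^ 2) ^ 2 * SS I t Y T + I.card ^ 2) ∧ ‖𝓕 (g : ℝ → ℂ) 0‖ ≤ C * (I.card * (Y / T)) := by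
  obtain ⟨C1, C10, hC1⟩ := amp_amc
  refine ⟨10000000 * (C1 + C1 ^ 2), by positivity, fun G Y T I t hY hT ht => ?_⟩
  have Y0 : 0 < Y := by linarith
  obtain ⟨κ, hκ⟩ : ∃ κ : ℝ, κ = I.card := ⟨_, rfl⟩
  have κ0 : 0 ≤ κ := by rw [hκ]; exact Nat.cast_nonneg _
  rw [← hκ]
  have h := hC1 G Y hY
  have hs := amc_smooth G hY
  obtain ⟨hs2, h2⟩ := amp_eta hY hT h hs
  have S0 : 0 ≤ SS I t Y T := by
    unfold SS
    refine Finset.sum_nonneg fun i _ => Finset.sum_nonneg fun k _ => ?_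
    have : 0 ≤ Real.log ⌈Y⌉₊ := Real.log_natCast_nonneg _
    positivity
  set b := amc G Y with hb
  set g0 := FF b I (fun _ => 1) t with hg0
  have gs : ContDiff ℝ ∞ g0 := FF_smooth hY h hs I _ t
  have gc : HasCompactSupport g0 := FF_hcs h I _ t
  set H2 := FF (fun y => b y * (T * eta y)) I (fun i => t i / T) t with hH2
  have H2s : ContDiff ℝ ∞ H2 := FF_smooth hY h2 hs2 I _ t
  have H2c : HasCompactSupport H2 := FF_hcs h2 I _ t
  set H1 := FF (deriv b) I (fun _ => 1) t with hH1
  have hd : deriv g0 = fun y => H1 y - Complex.I * H2 y := funext fun y => (FF_deriv hY hT h I t y).deriv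
  have gs' : ContDiff ℝ ∞ (deriv g0) := gs.deriv' 
  have gc' : HasCompactSupport (deriv g0) := gc.deriv
  have H1e : H1 = fun y => deriv g0 y + Complex.I * H2 y := by rw [hd]; ext y; ring
  have H1s : ContDiff ℝ ∞ H1 := by rw [H1e]; exact gs'.add (contDiff_const.mul H2s)
  have hdz : ∀ y, y < Y - 1 ∨ 2 * Y - 1 < y → deriv b y = 0 := by
    intro y hy
    have : b =ᶠ[nhds y] fun _ => 0 := by
      rcases hy with hy | hy
      · filter_upwards [Iio_mem_nhds hy] with z hz
        exact h.supp z (Or.inl (le_of_lt hz))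
      · filter_upwards [Ioi_mem_nhds hy] with z hz
        exact h.supp z (Or.inr (le_of_lt hz))
    rw [this.deriv_eq]; simp
  have H1z : ∀ y, y < Y - 1 ∨ 2 * Y - 1 < y → H1 y = 0 := by
    intro y hy
    rw [hH1]; unfold FF; rw [hdz y hy]; simp
  have H1c : HasCompactSupport H1 := by
    refine HasCompactSupport.intro (isCompact_Icc (a := Y - 1) (b := 2 * Y - 1)) fun y hy => H1z y ?_
    simpa only [Set.mem_Icc, not_and_or, not_le] using hy
  have H1b : ∀ y, ‖H1 y‖ ≤ C1 / Y / Y * κ := by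
    intro y
    rw [hH1]; unfold FF
    rw [norm_mul, Complex.norm_real, Real.norm_eq_abs]
    have := h.bd' y
    gcongr
    refine (norm_sum_le _ _).trans (le_of_eq ?_)
    simp [norm_ee, hκ]
  have k1 := flat_sum hY (by positivity) (H1c.toSchwartzMap H1s) H1b H1z
  have k2 := ker_sum h2 hY I t (fun i => t i / T) (c0 := 2) (fun i hi => by
    rw [abs_of_nonneg (div_nonneg (by linarith [(ht i hi).1]) hT.le), div_le_iff₀ hT]; exact (ht i hi).2) (H2c.toSchwartzMap H2s) (fun y => rfl) hT ht
  have k0 := ker_sum h hY I t (fun _ => 1) (c0 := 1) (by simp) (gc.toSchwartzMap gs) (fun y => rfl) hT ht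
  refine ⟨gc.toSchwartzMap gs, fun y => rfl, ?_, ?_, ?_⟩
  · refine k0.trans ?_
    have e : 10000 * (1:ℝ) ^ 2 * ((C1 / Y) ^ 2 * Y ^ 2) = 10000 * C1 ^ 2 := by field_simp
    rw [e]
    change 10000 * C1 ^ 2 * SS I t Y T ≤ _
    gcongr ?_ * _
    nlinarith
  · have e : ((H1c.toSchwartzMap H1s : 𝓢(ℝ, ℂ)) - Complex.I • (H2c.toSchwartzMap H2s) : 𝓢(ℝ, ℂ)) = gc'.toSchwartzMap gs' := by
      ext y
      change H1 y - Complex.I * H2 y = deriv g0 y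
      rw [hd]
    have e1 : 𝓕 (gc'.toSchwartzMap gs') = 𝓕 (H1c.toSchwartzMap H1s : 𝓢(ℝ, ℂ)) - Complex.I • 𝓕 (H2c.toSchwartzMap H2s : 𝓢(ℝ, ℂ)) := by
      rw [← e, sub_eq_add_neg, FourierTransform.fourier_add, ← neg_one_smul ℂ, FourierTransform.fourier_smul, FourierTransform.fourier_smul]
      rw [neg_one_smul, sub_eq_add_neg]
    have hf := Real.fourier_deriv (f := g0) (gs.continuous.integrable_of_hasCompactSupport gc) (gs.differentiable (by simp)) (gs'.continuous.integrable_of_hasCompactSupport gc')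
    have pt : ∀ N : ℤ, |(N:ℝ)| ^ 2 * ‖𝓕 g0 (N:ℝ)‖ ^ 2 ≤ 2 * ‖𝓕 H1 (N:ℝ)‖ ^ 2 + 2 * ‖𝓕 H2 (N:ℝ)‖ ^ 2 := by
      intro N
      have e2 : 𝓕 (deriv g0) (N:ℝ) = 𝓕 H1 (N:ℝ) - Complex.I * 𝓕 H2 (N:ℝ) := by
        have := congrArg (fun q : 𝓢(ℝ, ℂ) => q (N:ℝ)) e1
        exact this
      have e3 := sum_le_two e2
      refine le_trans ?_ e3
      rw [hf]
      simp only [norm_smul, norm_mul, Complex.norm_I, Complex.norm_real, Real.norm_eq_abs, RCLike.norm_ofNat, mul_one]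
      rw [← mul_pow]
      have := abs_of_pos Real.pi_pos
      rw [this]
      gcongr
      nlinarith [abs_nonneg (N:ℝ), Real.pi_gt_three]
    have s1 : Summable fun N : ℤ => ‖𝓕 H1 (N:ℝ)‖ ^ 2 := by simpa using! sch_summable2 (H1c.toSchwartzMap H1s) 0
    have s2 : Summable fun N : ℤ => ‖𝓕 H2 (N:ℝ)‖ ^ 2 := by simpa using! sch_summable2 (H2c.toSchwartzMap H2s) 0
    have s3 : Summable fun N : ℤ => |(N:ℝ)| ^ 2 * ‖𝓕 g0 (N:ℝ)‖ ^ 2 := by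
      have := sch_summable2 (gc.toSchwartzMap gs) 2
      simpa only [Real.rpow_two] using! this
    have k1' : ∑' N : ℤ, ‖𝓕 H1 (N:ℝ)‖ ^ 2 ≤ 3 * C1 ^ 2 * κ ^ 2 := by
      refine k1.trans ?_
      have : 3 * Y ^ 2 * (C1 / Y / Y * κ) ^ 2 = 3 * C1 ^ 2 * κ ^ 2 * (1 / Y) ^ 2 := by field_simp
      rw [this]
      have : (1 / Y) ^ 2 ≤ 1 := by
        apply pow_le_one₀ (by positivity); rw [div_le_one Y0]; linarith
      exact mul_le_of_le_one_right (by positivity) this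
    have k2' : ∑' N : ℤ, ‖𝓕 H2 (N:ℝ)‖ ^ 2 ≤ 2560000 * C1 ^ 2 * (T / Y ^ 2) ^ 2 * SS I t Y T := by
      refine k2.trans (le_of_eq ?_)
      change _ * SS I t Y T = _
      congr 1
      field_simp; norm_num
    calc ∑' N : ℤ, |(N:ℝ)| ^ 2 * ‖𝓕 g0 (N:ℝ)‖ ^ 2 ≤ ∑' N : ℤ, (2 * ‖𝓕 H1 (N:ℝ)‖ ^ 2 + 2 * ‖𝓕 H2 (N:ℝ)‖ ^ 2) :=
          Summable.tsum_le_tsum pt s3 ((s1.mul_left 2).add (s2.mul_left 2))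
      _ = 2 * ∑' N : ℤ, ‖𝓕 H1 (N:ℝ)‖ ^ 2 + 2 * ∑' N : ℤ, ‖𝓕 H2 (N:ℝ)‖ ^ 2 := by
          rw [(s1.mul_left 2).tsum_add (s2.mul_left 2), tsum_mul_left, tsum_mul_left]
      _ ≤ 2 * (3 * C1 ^ 2 * κ ^ 2) + 2 * (2560000 * C1 ^ 2 * (T / Y ^ 2) ^ 2 * SS I t Y T) := by gcongr
      _ ≤ _ := by
          have p1 : 0 ≤ (T / Y ^ 2) ^ 2 * SS I t Y T := by positivity
          have p2 : (0:ℝ) ≤ κ ^ 2 := by positivity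
          nlinarith [mul_nonneg C10.le p1, mul_nonneg C10.le p2, mul_nonneg (sq_nonneg C1) p1, mul_nonneg (sq_nonneg C1) p2]
  · have e : 𝓕 ((gc.toSchwartzMap gs : 𝓢(ℝ, ℂ)) : ℝ → ℂ) 0 = ∑ i ∈ I, ∫ y : ℝ, (b y : ℂ) * ee (t i * tht y) := by
      rw [Real.fourier_real_eq_integral_exp_smul, ← integral_finsetSum]
      · congr 1
        ext y
        change _ • g0 y = _
        rw [hg0]; unfold FF
        simp [Finset.mul_sum]
      · intro i _
        refine Integrable.mul_bdd (c := 1) ?_ ?_ ?_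
        · exact (h.cts.integrable_of_hasCompactSupport h.hcs).ofReal
        · exact (meas_ee.comp (by have := meas_tht; fun_prop)).aestronglyMeasurable
        · exact Filter.Eventually.of_forall fun y => (norm_ee _).le
    rw [e]
    refine (norm_sum_le _ _).trans ((Finset.sum_le_sum fun i hi => fd_test h hY hT (ht i hi).1).trans ?_)
    rw [Finset.sum_const, nsmul_eq_mul, ← hκ]
    have : κ * (8 * (C1 / Y) * Y ^ 2 / T) = 8 * C1 * (κ * (Y / T)) := by field_simp
    rw [this]
    gcongr ?_ * _
    nlinarith


lemma dd_eq {G X ρ : ℝ} (M : ℕ) (I : Finset ℕ) (t : ℕ → ℝ) (hρ : 1 < ρ) (hX : 4 * ρ ≤ X) (hM : 2 * X ≤ M) :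
    DD M I t G X ρ = (∑ r ∈ Finset.range (⌈ρ⌉₊ - 1), (1 / ((r:ℂ) + 1)) * ∑' n : ℤ, FF (amc G (X / ρ)) I (fun _ => 1) t (n / ((r + 1 : ℕ) : ℝ))).re := by
  have ρ0 : 0 < ρ := by linarith
  have X0 : 0 < X := by linarith
  have hY : 4 ≤ X / ρ := by rw [le_div_iff₀ ρ0]; exact hX
  have hS : ∀ r : ℕ, r < ⌈ρ⌉₊ - 1 ↔ (r:ℝ) + 1 < ρ := by
    intro r
    rw [Nat.lt_sub_iff_add_lt, Nat.lt_ceil]; push_cast; rfl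
  have h1 : ∀ r : ℕ, (r:ℝ) + 1 < ρ → ∑' n : ℤ, FF (amc G (X / ρ)) I (fun _ => 1) t (n / ((r + 1 : ℕ) : ℝ)) =
      ∑ n ∈ Finset.range M, FF (amc G (X / ρ)) I (fun _ => 1) t (yy n r) := by
    intro r hr
    have inj : Function.Injective (fun n : ℕ => (n:ℤ) + 1) := fun a b h => by simpa using h
    have hz : ∀ n : ℤ, FF (amc G (X / ρ)) I (fun _ => 1) t (n / ((r + 1 : ℕ) : ℝ)) ≠ 0 → 0 < n ∧ n ≤ M := by
      intro n hn
      have hb : amc G (X / ρ) (n / ((r + 1 : ℕ) : ℝ)) ≠ 0 := fun h => hn (by unfold FF; rw [h]; simp)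
      have h3 : ¬ ((n:ℝ) / ((r + 1 : ℕ) : ℝ) ≤ X / ρ - 1 ∨ 2 * (X / ρ) - 1 ≤ n / ((r + 1 : ℕ) : ℝ)) := fun h => hb (amc_zero hY h)
      push Not at h3
      have r0 : (0:ℝ) < ((r + 1 : ℕ) : ℝ) := by positivity
      constructor
      · have : 0 < (n:ℝ) / ((r + 1 : ℕ) : ℝ) := by linarith [h3.1]
        have := (div_pos_iff_of_pos_right r0).1 this
        exact_mod_cast this
      · have h4 : (n:ℝ) / ((r + 1 : ℕ) : ℝ) < 2 * (X / ρ) := by linarith [h3.2]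
        rw [div_lt_iff₀ r0] at h4
        have h5 : 2 * (X / ρ) * ((r + 1 : ℕ) : ℝ) ≤ 2 * (X / ρ) * ρ := by
          gcongr; push_cast; exact hr.le
        have h6 : 2 * (X / ρ) * ρ = 2 * X := by field_simp
        have : (n:ℝ) ≤ M := by linarith
        exact_mod_cast this
    rw [← Function.Injective.tsum_eq inj (f := fun n : ℤ => FF (amc G (X / ρ)) I (fun _ => 1) t (n / ((r + 1 : ℕ) : ℝ)))]
    · rw [tsum_eq_sum (L := SummationFilter.unconditional ℕ) (s := Finset.range M)]
      · refine Finset.sum_congr rfl fun n _ => ?_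
        unfold yy; push_cast; rfl
      · intro n hn
        by_contra h
        have := (hz _ h).2
        rw [Finset.mem_range] at hn
        omega
    · intro n hn
      have := (hz n hn).1
      exact ⟨(n - 1).toNat, by simp only; omega⟩
  have h2 : ∑ r ∈ Finset.range (⌈ρ⌉₊ - 1), (1 / ((r:ℂ) + 1)) * ∑' n : ℤ, FF (amc G (X / ρ)) I (fun _ => 1) t (n / ((r + 1 : ℕ) : ℝ)) =
      ∑ r ∈ Finset.range M, ∑ n ∈ Finset.range M, if (r:ℝ) + 1 < ρ then (1 / ((r:ℂ) + 1)) * FF (amc G (X / ρ)) I (fun _ => 1) t (yy n r) else 0 := by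
    have : Finset.range (⌈ρ⌉₊ - 1) ⊆ Finset.range M := by
      intro r hr
      rw [Finset.mem_range] at hr ⊢
      have := (hS r).1 hr
      have : (r:ℝ) < M := by linarith
      exact_mod_cast this
    rw [← Finset.sum_subset this]
    · refine Finset.sum_congr rfl fun r hr => ?_
      have hr' := (hS r).1 (Finset.mem_range.1 hr)
      rw [h1 r hr', Finset.mul_sum]
      refine Finset.sum_congr rfl fun n _ => ?_
      rw [if_pos hr']
    · intro r _ hr
      rw [Finset.mem_range, hS] at hr
      refine Finset.sum_eq_zero fun n _ => if_neg hr
  rw [h2]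
  unfold DD
  rw [Finset.sum_comm, Complex.re_sum]
  refine Finset.sum_congr rfl fun r _ => ?_
  rw [Complex.re_sum]
  refine Finset.sum_congr rfl fun n _ => ?_
  split_ifs with h
  · have e1 : ∀ x : ℝ, (ee x).re = Real.cos x := fun x => by unfold ee; exact Complex.exp_ofReal_mul_I_re x
    have e2 : (1 / ((r:ℂ) + 1)) = ((1 / ((r:ℝ) + 1) : ℝ) : ℂ) := by push_cast; rfl
    have e3 : ρ * ((yy n r + 1) / X) = (yy n r + 1) / (X / ρ) := by field_simp
    unfold FF coef amc
    rw [e2, Complex.re_ofReal_mul, Complex.re_ofReal_mul, Complex.re_sum, e3]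
    simp only [Complex.ofReal_one, one_mul, e1]
    ring
  · simp

set_option maxHeartbeats 800000 in
lemma dd_main {δ : ℝ} (hδ : 0 < δ) (hδ' : δ < 1 / 3) : ∃ C : ℝ, 0 < C ∧ ∀ (T G X ρ : ℝ) (M : ℕ) (I : Finset ℕ) (t : ℕ → ℝ), 0 < T → 1 < ρ → 4 * ρ ≤ X → 2 * X ≤ M →
    (∀ i ∈ I, T ≤ t i ∧ t i ≤ 2 * T) →
    DD M I t G X ρ ^ 2 ≤ C * ((X / T) ^ 2 * I.card ^ 2 + (1 + T / (X / ρ) ^ 2) ^ (3 * δ) * ((1 + T / (X / ρ) ^ 2) * SS I t (X / ρ) T + I.card ^ 2)) := by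
  obtain ⟨Ca, Ca0, ha⟩ := div_sum hδ
  obtain ⟨Cb, Cb0, hb⟩ := cauchy_div hδ hδ'
  obtain ⟨Cc, Cc0, hc⟩ := energy
  refine ⟨2 * Cc ^ 2 + 4 * Ca ^ 2 * Cb * Cc, by positivity, fun T G X ρ M I t hT hρ hX hM ht => ?_⟩
  have ρ0 : 0 < ρ := by linarith
  have X0 : 0 < X := by linarith
  obtain ⟨Y, hYd⟩ : ∃ Y, Y = X / ρ := ⟨_, rfl⟩
  have hY : 4 ≤ Y := by rw [hYd, le_div_iff₀ ρ0]; exact hX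
  rw [dd_eq M I t hρ hX hM, ← hYd]
  obtain ⟨g, hg, g1, g2, g3⟩ := hc G Y T I t hY hT ht
  have hg' : FF (amc G Y) I (fun _ => 1) t = g := funext fun y => (hg y).symm
  obtain ⟨κ, hκ⟩ : ∃ κ : ℝ, κ = I.card := ⟨_, rfl⟩
  have κ0 : 0 ≤ κ := by rw [hκ]; exact Nat.cast_nonneg _
  rw [hg']
  rw [← hκ]
  rw [← hκ] at g2 g3
  clear hg hc
  have S0 : 0 ≤ SS I t Y T := by
    unfold SS
    refine Finset.sum_nonneg fun i _ => Finset.sum_nonneg fun k _ => ?_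
    have : 0 ≤ Real.log ⌈Y⌉₊ := Real.log_natCast_nonneg _
    have : 0 < Y := by linarith
    positivity
  have hcs : HasCompactSupport (g : ℝ → ℂ) := by
    obtain ⟨C1, C10, hC1⟩ := amp_amc
    rw [← hg']; exact FF_hcs (hC1 G Y hY) I _ t
  have k1 := ha g g.smooth' hcs (⌈ρ⌉₊ - 1)
  obtain ⟨N0, hN0⟩ : ∃ N0, N0 = 1 + T / Y ^ 2 := ⟨_, rfl⟩
  have q0 : 0 ≤ T / Y ^ 2 := by positivity
  have n1 : 1 ≤ N0 := by rw [hN0]; linarith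
  have n0 : 0 < N0 := by linarith
  have k2 := hb g N0 n1
  rw [← hN0]
  set Q := ∑' N : ℤ, |(N:ℝ)| ^ δ * ‖𝓕 (g : ℝ → ℂ) (N:ℝ)‖ with hQ
  have Q0 : 0 ≤ Q := tsum_nonneg fun _ => by positivity
  have hSρ : ((⌈ρ⌉₊ - 1 : ℕ) : ℝ) ≤ ρ := by
    have h1 : 1 ≤ ⌈ρ⌉₊ := Nat.one_le_ceil_iff.2 ρ0
    rw [Nat.cast_sub h1]; push_cast
    linarith [Nat.ceil_lt_add_one ρ0.le]
  have k3 : ((⌈ρ⌉₊ - 1 : ℕ) : ℝ) * ‖𝓕 (g : ℝ → ℂ) 0‖ ≤ Cc * (X / T * κ) := by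
    calc _ ≤ ρ * (Cc * (κ * (Y / T))) := by gcongr
      _ = _ := by rw [hYd]; field_simp
  have k4 : Q ^ 2 ≤ 2 * Cb * Cc * (N0 ^ (3 * δ) * (N0 * SS I t Y T + κ ^ 2)) := by
    have e1 : N0 ^ (3 * δ - 1) = N0 ^ (3 * δ) / N0 := by rw [Real.rpow_sub n0, Real.rpow_one]
    refine k2.trans ?_
    rw [e1]
    calc _ ≤ Cb * (N0 ^ (3 * δ) / N0 * (N0 ^ 2 * (Cc * SS I t Y T) + Cc * (N0 ^ 2 * SS I t Y T + N0 * κ ^ 2))) := by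
          gcongr
          refine g2.trans ?_
          gcongr
          · rw [hN0]; linarith
          · exact le_mul_of_one_le_left (sq_nonneg κ) n1
      _ = Cb * Cc * (N0 ^ (3 * δ) * (2 * (N0 * SS I t Y T) + κ ^ 2)) := by field_simp; ring
      _ ≤ Cb * Cc * (N0 ^ (3 * δ) * (2 * (N0 * SS I t Y T) + 2 * κ ^ 2)) := by gcongr; nlinarith
      _ = _ := by ring
  set Z := ∑ r ∈ Finset.range (⌈ρ⌉₊ - 1), (1 / ((r:ℂ) + 1)) * ∑' n : ℤ, g (n / ((r + 1 : ℕ) : ℝ)) with hZ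
  have k5 : |Z.re| ≤ Cc * (X / T * κ) + Ca * Q := (Complex.abs_re_le_norm _).trans (k1.trans (by linarith))
  have P0 : 0 ≤ Cc * (X / T * κ) := by positivity
  have W0 : 0 ≤ N0 ^ (3 * δ) * (N0 * SS I t Y T + κ ^ 2) := by positivity
  calc Z.re ^ 2 = |Z.re| ^ 2 := (sq_abs _).symm
    _ ≤ (Cc * (X / T * κ) + Ca * Q) ^ 2 := by gcongr
    _ ≤ 2 * (Cc * (X / T * κ)) ^ 2 + 2 * (Ca * Q) ^ 2 := by nlinarith [sq_nonneg (Cc * (X / T * κ) - Ca * Q)]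
    _ = 2 * Cc ^ 2 * ((X / T) ^ 2 * κ ^ 2) + 2 * Ca ^ 2 * Q ^ 2 := by ring
    _ ≤ 2 * Cc ^ 2 * ((X / T) ^ 2 * κ ^ 2) + 2 * Ca ^ 2 * (2 * Cb * Cc * (N0 ^ (3 * δ) * (N0 * SS I t Y T + κ ^ 2))) := by gcongr
    _ = 2 * Cc ^ 2 * ((X / T) ^ 2 * κ ^ 2) + 4 * Ca ^ 2 * Cb * Cc * (N0 ^ (3 * δ) * (N0 * SS I t Y T + κ ^ 2)) := by ring
    _ ≤ _ := by
        have a1 : 0 ≤ (X / T) ^ 2 * κ ^ 2 := by positivity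
        have a2 : 0 ≤ 2 * Cc ^ 2 := by positivity
        have a3 : 0 ≤ 4 * Ca ^ 2 * Cb * Cc := by positivity
        nlinarith [mul_nonneg a2 W0, mul_nonneg a3 a1]


lemma poly_exp (n : ℕ) : ∃ C : ℝ, 0 < C ∧ ∀ R : ℝ, 1 ≤ R → R ^ n * Real.exp (-(R ^ 2 / 256)) ≤ C := by
  refine ⟨256 ^ n * n.factorial, by positivity, fun R hR => ?_⟩
  have h1 := Real.pow_div_factorial_le_exp (R ^ 2 / 256) (by positivity) n
  rw [div_le_iff₀ (by positivity), div_pow, div_le_iff₀ (by positivity)] at h1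
  rw [Real.exp_neg, ← div_eq_mul_inv, div_le_iff₀ (Real.exp_pos _)]
  calc R ^ n ≤ (R ^ 2) ^ n := by
        gcongr
        nlinarith
    _ ≤ _ := h1
    _ = _ := by ring

lemma dd_triv (K : ℕ) : ∃ C : ℝ, 0 < C ∧ ∀ (T G R X ρ : ℝ) (M : ℕ) (I : Finset ℕ) (t : ℕ → ℝ), 1 ≤ T → 1 ≤ R → T ≤ R ^ K → X = 16 * (T * R) → (M:ℝ) ≤ 2 * X + 1 →
    1 < ρ → 1 ≤ G → X * R ≤ 4 * G * ρ → |DD M I t G X ρ| ≤ C * I.card := by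
  have hcs : HasCompactSupport chit := by
    refine HasCompactSupport.intro (isCompact_Icc (a := 1) (b := 2)) fun y hy => chit_zero ?_
    simp only [Set.mem_Icc, not_and_or, not_le] at hy
    rcases hy with hy | hy
    · exact Or.inl hy.le
    · exact Or.inr hy.le
  obtain ⟨c0, h0⟩ := hcs.exists_bound_of_continuous chit_contDiff.continuous
  simp only [Real.norm_eq_abs] at h0
  have p0 : 0 ≤ c0 := (abs_nonneg _).trans (h0 0)
  obtain ⟨Ce, Ce0, hCe⟩ := poly_exp (3 * (K + 1))
  refine ⟨33 ^ 3 * Ce * c0 + 1, by positivity, fun T G R X ρ M I t hT hR hTR hX hM hρ hG hXR => ?_⟩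
  have ρ0 : 0 < ρ := by linarith
  have G0 : 0 < G := by linarith
  have X0 : 0 < X := by rw [hX]; positivity
  obtain ⟨κ, hκ⟩ : ∃ κ : ℝ, κ = I.card := ⟨_, rfl⟩
  have κ0 : 0 ≤ κ := by rw [hκ]; exact Nat.cast_nonneg _
  rw [← hκ]
  set E := Real.exp (-(R ^ 2 / 256)) with hE
  have E0 : 0 < E := Real.exp_pos _
  have term : ∀ n ∈ Finset.range M, ∀ r ∈ Finset.range M, |coef I t G n r * (if (r:ℝ) + 1 < ρ then chit (ρ * ((yy n r + 1) / X)) else 0)| ≤ M * E * κ * c0 := by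
    intro n hn r hr
    split_ifs with h
    · by_cases h1 : ρ * ((yy n r + 1) / X) ≤ 1 ∨ 2 ≤ ρ * ((yy n r + 1) / X)
      · rw [chit_zero h1, mul_zero, abs_zero]; positivity
      · push Not at h1
        have y0 := yy_pos n r
        rw [abs_mul]
        have hh := h0 (ρ * ((yy n r + 1) / X))
        gcongr
        unfold coef
        have h2 : |∑ i ∈ I, Real.cos (t i * tht (yy n r))| ≤ κ := by
          refine (Finset.abs_sum_le_sum_abs _ _).trans ((Finset.sum_le_sum fun i _ => Real.abs_cos_le_one _).trans (le_of_eq ?_))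
          rw [hκ]; simp
        have h3 : |am G (yy n r)| ≤ M * E := by
          unfold am
          rw [abs_mul, abs_of_nonneg (by positivity), abs_of_pos (Real.exp_pos _)]
          have h4 : 1 / √(yy n r * (yy n r + 1)) ≤ M := by
            have hy1 : 1 / (M:ℝ) ≤ yy n r := by
              unfold yy
              have : ((r:ℝ) + 1) ≤ M := by exact_mod_cast Finset.mem_range.1 hr
              gcongr
              have : (0:ℝ) ≤ n := Nat.cast_nonneg n
              linarith
            have hM0 : (0:ℝ) < M := by exact_mod_cast (Nat.zero_le _).trans_lt (Finset.mem_range.1 hr)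
            have hs : yy n r ≤ √(yy n r * (yy n r + 1)) := by apply Real.le_sqrt_of_sq_le; nlinarith
            rw [div_le_iff₀ (by positivity)]
            rw [div_le_iff₀ hM0] at hy1
            nlinarith
          have h5 : R / 8 ≤ G * tht (yy n r) := by
            have h6 := tht_ge y0
            have h7 : ρ * (yy n r + 1) < 2 * X := by
              have := h1.2
              rw [← mul_div_assoc, div_lt_iff₀ X0] at this; exact this
            have h8 : R / 8 ≤ G * (1 / (yy n r + 1)) := by
              rw [mul_one_div, le_div_iff₀ (by positivity)]
              have h9 : R * (ρ * (yy n r + 1)) ≤ R * (2 * X) := by gcongr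
              have h10 : R * (yy n r + 1) * ρ ≤ (8 * G) * ρ := by nlinarith
              have := le_of_mul_le_mul_right h10 ρ0
              linarith
            refine h8.trans (by gcongr)
          have h6 : Real.exp (-(G ^ 2 / 4 * tht (yy n r) ^ 2)) ≤ E := by
            rw [hE]; apply Real.exp_le_exp.2
            have : (R / 8) ^ 2 ≤ (G * tht (yy n r)) ^ 2 := by gcongr
            nlinarith
          gcongr
        have h4 : |1 / ((r:ℝ) + 1)| ≤ 1 := by
          rw [abs_of_pos (by positivity), div_le_one (by positivity)]
          linarith [(Nat.cast_nonneg r : (0:ℝ) ≤ r)]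
        rw [abs_mul, abs_mul]
        calc _ ≤ 1 * (M * E * κ) := by gcongr
          _ = _ := one_mul _
    · rw [mul_zero, abs_zero]; positivity
  have h1 : |DD M I t G X ρ| ≤ M * (M * (M * E * κ * c0)) := by
    unfold DD
    refine (Finset.abs_sum_le_sum_abs _ _).trans ?_
    have : ∀ n ∈ Finset.range M, |∑ r ∈ Finset.range M, coef I t G n r * (if (r:ℝ) + 1 < ρ then chit (ρ * ((yy n r + 1) / X)) else 0)| ≤ M * (M * E * κ * c0) := by
      intro n hn
      refine (Finset.abs_sum_le_sum_abs _ _).trans ((Finset.sum_le_sum fun r hr => term n hn r hr).trans (le_of_eq ?_))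
      rw [Finset.sum_const, Finset.card_range, nsmul_eq_mul]
    refine (Finset.sum_le_sum this).trans (le_of_eq ?_)
    rw [Finset.sum_const, Finset.card_range, nsmul_eq_mul]
  have hM2 : (M:ℝ) ≤ 33 * R ^ (K + 1) := by
    have : T * R ≤ R ^ (K + 1) := by rw [pow_succ]; gcongr
    have h1 : 1 ≤ R ^ (K + 1) := one_le_pow₀ hR
    linarith
  calc |DD M I t G X ρ| ≤ M * (M * (M * E * κ * c0)) := h1
    _ ≤ (33 * R ^ (K + 1)) * ((33 * R ^ (K + 1)) * ((33 * R ^ (K + 1)) * E * κ * c0)) := by gcongr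
    _ = 33 ^ 3 * (R ^ (3 * (K + 1)) * E) * c0 * κ := by ring
    _ ≤ 33 ^ 3 * Ce * c0 * κ := by gcongr; exact hCe R hR
    _ ≤ _ := by nlinarith


lemma ss_bound (I : Finset ℕ) (n : ℕ) (hI : I ⊆ Finset.range n) (t : ℕ → ℝ) {t0 h Y T T0 L : ℝ} (ht : ∀ i, t i = t0 + i * h) (hh : 0 < h) (hY : 4 ≤ Y) (hT : 0 < T)
    (hT0 : ∀ i ∈ I, ∀ k ∈ I, |t i - t k| ≤ T0) (hL : 1 + Real.log n ≤ L) (hL2 : 1 + Real.log ⌈Y⌉₊ ≤ L) :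
    SS I t Y T ≤ I.card * (1 / Y + 2 * L / h) + I.card * (I.card * (Y / T * L + √(Y * T0) / T)) := by
  unfold SS
  have Y0 : 0 < Y := by linarith
  have h1 : ∀ i ∈ I, ∑ k ∈ I, (1 / (Y + |t i - t k|) + Y / T * (1 + Real.log ⌈Y⌉₊) + √(Y * |t i - t k|) / T) ≤ (1 / Y + 2 * L / h) + I.card * (Y / T * L + √(Y * T0) / T) := by
    intro i hi
    have h2 : ∀ k, t i - t k = ((i:ℝ) - k) * h := fun k => by rw [ht, ht]; ring
    calc _ ≤ ∑ k ∈ I, (1 / (Y + |((i:ℝ) - k) * h|) + (Y / T * L + √(Y * T0) / T)) := by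
          refine Finset.sum_le_sum fun k hk => ?_
          rw [add_assoc, ← h2 k]
          have := hT0 i hi k hk
          gcongr
      _ = ∑ k ∈ I, 1 / (Y + |((i:ℝ) - k) * h|) + I.card * (Y / T * L + √(Y * T0) / T) := by
          rw [Finset.sum_add_distrib, Finset.sum_const, nsmul_eq_mul]
      _ ≤ _ := by
          gcongr
          refine (space_sum I n hI Y0 hh i hi).trans ?_
          gcongr
  refine (Finset.sum_le_sum h1).trans (le_of_eq ?_)
  rw [Finset.sum_const, nsmul_eq_mul]; ring

lemma n0_bound {κ h Y T T0 L R G : ℝ} (hκ : 0 ≤ κ) (hκ2 : κ ≤ κ ^ 2) (hR : 1 ≤ R) (hG : 1 ≤ G) (hGh : G ≤ h) (hY : 4 ≤ Y) (hT : 1 ≤ T) (hYG : 4 * G ≤ Y * R) (hYT : Y ≤ 16 * (T * R))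
    (hT0 : 0 ≤ T0) (hT0' : T0 ≤ T) (hL : 1 ≤ L) :
    (1 + T / Y ^ 2) * (κ * (1 / Y + 2 * L / h) + κ * (κ * (Y / T * L + √(Y * T0) / T))) ≤ 24 * (L * R ^ 3 * (κ ^ 2 + T / G ^ 3 * κ + κ ^ 2 * (√T0 / (G * √G)))) := by
  have Y0 : 0 < Y := by linarith
  have G0 : 0 < G := by linarith
  have T0' : 0 < T := by linarith
  have h0 : 0 < h := by linarith
  have R0 : 0 < R := by linarith
  have hv : 1 / Y ≤ R / (4 * G) := by rw [div_le_div_iff₀ Y0 (by positivity)]; linarith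
  have hv2 : R / (4 * G) ≤ R := by
    apply div_le_self R0.le; linarith
  have R3 : R ≤ R ^ 3 := le_self_pow₀ hR (by norm_num)
  have R23 : R ^ 2 ≤ R ^ 3 := pow_le_pow_right₀ hR (by norm_num)
  have LR : R ^ 3 ≤ L * R ^ 3 := le_mul_of_one_le_left (by positivity) hL
  have LL : L ≤ L * R ^ 3 := le_mul_of_one_le_right (by linarith) (one_le_pow₀ hR)
  have LR2 : L * R ≤ L * R ^ 3 := by gcongr
  have q0 : 0 ≤ T / G ^ 3 * κ := by positivity
  have q1 : 0 ≤ κ ^ 2 * (√T0 / (G * √G)) := by positivity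
  have q2 : 0 ≤ κ ^ 2 := by positivity
  -- pieces
  have p1 : κ * (1 / Y) ≤ L * R ^ 3 * κ ^ 2 := by
    calc κ * (1 / Y) ≤ κ ^ 2 * R := by gcongr; exact hv.trans hv2
      _ ≤ κ ^ 2 * (L * R ^ 3) := by gcongr; linarith
      _ = _ := by ring
  have p2 : κ * (2 * L / h) ≤ 2 * (L * R ^ 3 * κ ^ 2) := by
    have : 2 * L / h ≤ 2 * L := div_le_self (by linarith) (by linarith)
    calc κ * (2 * L / h) ≤ κ ^ 2 * (2 * (L * R ^ 3)) := by gcongr; linarith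
      _ = _ := by ring
  have p3 : κ * (κ * (Y / T * L)) ≤ 16 * (L * R ^ 3 * κ ^ 2) := by
    have : Y / T ≤ 16 * R := by rw [div_le_iff₀ T0']; linarith
    calc κ * (κ * (Y / T * L)) ≤ κ * (κ * (16 * R * L)) := by gcongr
      _ = 16 * κ ^ 2 * (L * R) := by ring
      _ ≤ 16 * κ ^ 2 * (L * R ^ 3) := by gcongr
      _ = _ := by ring
  have p4 : κ * (κ * (√(Y * T0) / T)) ≤ 4 * (L * R ^ 3 * κ ^ 2) := by
    have h1 : √(Y * T0) ≤ 4 * R * T := by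
      apply Real.sqrt_le_iff.2 ⟨by positivity, ?_⟩
      calc Y * T0 ≤ (16 * (T * R)) * T := by gcongr
        _ = 16 * T ^ 2 * R := by ring
        _ ≤ 16 * T ^ 2 * R ^ 2 := by gcongr; nlinarith
        _ = _ := by ring
    have h2 : √(Y * T0) / T ≤ 4 * R := by rw [div_le_iff₀ T0']; exact h1
    calc κ * (κ * (√(Y * T0) / T)) ≤ κ * (κ * (4 * (L * R ^ 3))) := by gcongr; linarith
      _ = _ := by ring
  have e2 : T / Y ^ 2 = T * (1 / Y) ^ 2 := by field_simp
  have p5 : T / Y ^ 2 * (κ * (1 / Y)) ≤ L * R ^ 3 * (T / G ^ 3 * κ) := by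
    calc T / Y ^ 2 * (κ * (1 / Y)) = T * κ * (1 / Y) ^ 3 := by field_simp
      _ ≤ T * κ * (R / (4 * G)) ^ 3 := by gcongr
      _ = 1 / 64 * (R ^ 3 * (T / G ^ 3 * κ)) := by field_simp; norm_num
      _ ≤ 1 * (L * R ^ 3 * (T / G ^ 3 * κ)) := by gcongr; norm_num
      _ = _ := one_mul _
  have p6 : T / Y ^ 2 * (κ * (2 * L / h)) ≤ L * R ^ 3 * (T / G ^ 3 * κ) := by
    rw [e2]
    calc T * (1 / Y) ^ 2 * (κ * (2 * L / h)) ≤ T * (R / (4 * G)) ^ 2 * (κ * (2 * L / G)) := by gcongr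
      _ = 1 / 8 * (L * R ^ 2 * (T / G ^ 3 * κ)) := by field_simp; ring
      _ ≤ 1 * (L * R ^ 3 * (T / G ^ 3 * κ)) := by gcongr; norm_num
      _ = _ := one_mul _
  have p7 : T / Y ^ 2 * (κ * (κ * (Y / T * L))) ≤ L * R ^ 3 * κ ^ 2 := by
    calc T / Y ^ 2 * (κ * (κ * (Y / T * L))) = κ ^ 2 * L * (1 / Y) := by field_simp
      _ ≤ κ ^ 2 * L * R ^ 3 := by gcongr; linarith
      _ = _ := by ring
  have p8 : T / Y ^ 2 * (κ * (κ * (√(Y * T0) / T))) ≤ L * R ^ 3 * (κ ^ 2 * (√T0 / (G * √G))) := by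
    have hs : √Y * √Y = Y := Real.mul_self_sqrt Y0.le
    have hsG : √G * √G = G := Real.mul_self_sqrt G0.le
    have sY : 0 < √Y := Real.sqrt_pos.2 Y0
    have sG : 0 < √G := Real.sqrt_pos.2 G0
    have h1 : √Y / Y ^ 2 ≤ R ^ 2 / (G * √G) := by
      have h2 : √G ≤ √Y * R := by
        calc √G ≤ √(Y * R ^ 2) := by apply Real.sqrt_le_sqrt; nlinarith
          _ = √Y * R := by rw [Real.sqrt_mul Y0.le, Real.sqrt_sq R0.le]
      rw [div_le_div_iff₀ (by positivity) (by positivity)]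
      calc √Y * (G * √G) ≤ √Y * ((Y * R) * (√Y * R)) := by gcongr; linarith
        _ = R ^ 2 * (Y * (√Y * √Y)) := by ring
        _ = _ := by rw [hs]; ring
    calc T / Y ^ 2 * (κ * (κ * (√(Y * T0) / T))) = κ ^ 2 * √T0 * (√Y / Y ^ 2) := by
          rw [Real.sqrt_mul Y0.le]; field_simp
      _ ≤ κ ^ 2 * √T0 * (R ^ 2 / (G * √G)) := by gcongr
      _ = R ^ 2 * (κ ^ 2 * (√T0 / (G * √G))) := by ring
      _ ≤ _ := by gcongr; linarith
  have W : 0 ≤ L * R ^ 3 := by positivity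
  have w0 := mul_nonneg W q0
  have w1 := mul_nonneg W q1
  have w2 := mul_nonneg W q2
  calc (1 + T / Y ^ 2) * (κ * (1 / Y + 2 * L / h) + κ * (κ * (Y / T * L + √(Y * T0) / T)))
      = κ * (1 / Y) + κ * (2 * L / h) + κ * (κ * (Y / T * L)) + κ * (κ * (√(Y * T0) / T)) + T / Y ^ 2 * (κ * (1 / Y)) + T / Y ^ 2 * (κ * (2 * L / h))
        + T / Y ^ 2 * (κ * (κ * (Y / T * L))) + T / Y ^ 2 * (κ * (κ * (√(Y * T0) / T))) := by ring
    _ ≤ _ := by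
        have e : 24 * (L * R ^ 3 * (κ ^ 2 + T / G ^ 3 * κ + κ ^ 2 * (√T0 / (G * √G)))) = 24 * (L * R ^ 3 * κ ^ 2) + 24 * (L * R ^ 3 * (T / G ^ 3 * κ)) + 24 * (L * R ^ 3 * (κ ^ 2 * (√T0 / (G * √G)))) := by ring
        rw [e]; linarith


lemma J_nonneg (k : ℕ) (t : ℝ) {G : ℝ} (hG : 0 < G) : 0 ≤ J k t G := by
  unfold J
  refine mul_nonneg (by positivity) (integral_nonneg fun u => ?_)
  positivity

lemma log_T {δ T x : ℝ} (hδ : 0 < δ) (hT : 2 ≤ T) (hx : 0 ≤ x) (hx' : x ≤ T ^ 8) : 1 + Real.log x ≤ (1 + 8 / δ) * T ^ δ := by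
  have T1 : 1 ≤ T := by linarith
  have h1 : Real.log x ≤ 8 * (T ^ δ / δ) := by
    rcases hx.eq_or_lt with h | h
    · rw [← h, Real.log_zero]; positivity
    · calc Real.log x ≤ Real.log (T ^ 8) := Real.log_le_log h hx'
        _ = 8 * Real.log T := by rw [Real.log_pow]; norm_num
        _ ≤ _ := by
          have := Real.log_le_rpow_div (x := T) (by linarith) hδ
          linarith
  have h2 : 1 ≤ T ^ δ := Real.one_le_rpow T1 hδ.le
  calc _ ≤ T ^ δ + 8 * (T ^ δ / δ) := by linarith
    _ = _ := by ring

set_option maxHeartbeats 1000000 in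
lemma dd_all {δ : ℝ} (hδ : 0 < δ) (hδ' : δ ≤ 1 / 10) (K : ℕ) : ∃ C : ℝ, 0 < C ∧ ∀ (T G h t0 T0 R X ρ : ℝ) (n M : ℕ) (I : Finset ℕ) (t : ℕ → ℝ),
    2 ≤ T → T ^ (1 / 5 : ℝ) ≤ G → G ≤ T → G ≤ h → I ⊆ Finset.range n → (n:ℝ) ≤ T → (∀ i : ℕ, t i = t0 + i * h) →
    (∀ i ∈ I, T ≤ t i ∧ t i ≤ 2 * T) → (∀ i ∈ I, ∀ k ∈ I, |t i - t k| ≤ T0) → 0 ≤ T0 → T0 ≤ T →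
    R = T ^ δ → T ≤ R ^ K → X = 16 * (T * R) → 2 * X ≤ M → (M:ℝ) ≤ 2 * X + 1 → 1 < ρ →
    DD M I t G X ρ ^ 2 ≤ C * (R ^ 10 * ((I.card:ℝ) ^ 2 + T / G ^ 3 * I.card + I.card ^ 2 * (√T0 / (G * √G)))) := by
  obtain ⟨Cd, hCd, hd⟩ := dd_main hδ (by linarith : δ < 1 / 3)
  obtain ⟨Ct, hCt, ht'⟩ := dd_triv K
  refine ⟨Cd * (257 + 24 * (1 + 8 / δ)) + Ct ^ 2, by positivity, ?_⟩
  intro T G h t0 T0 R X ρ n M I t hT hTG hGT hGh hI hn ht htT htd hT0 hT0' hR hRK hX hM hM' hρ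
  have T1 : 1 ≤ T := by linarith
  have R1 : 1 ≤ R := hR ▸ Real.one_le_rpow T1 hδ.le
  have G1 : 1 ≤ G := le_trans (Real.one_le_rpow T1 (by norm_num)) hTG
  have RG : R ≤ G := le_trans (hR ▸ Real.rpow_le_rpow_of_exponent_le T1 (by linarith)) hTG
  have RT : R ≤ T := RG.trans hGT
  have hsm : ((I.card : ℕ):ℝ) ≤ (I.card:ℝ) ^ 2 := by
    have := Nat.le_self_pow (two_ne_zero) I.card
    exact_mod_cast this
  have hd := hd T G X ρ M I t (by linarith) hρ
  have ht' := ht' T G R X ρ M I t T1 R1 hRK hX hM' hρ G1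
  have hs := fun (Y L : ℝ) (hY : 4 ≤ Y) => ss_bound I n hI t (Y := Y) (L := L) (T := T) ht (by linarith) hY (by linarith) htd
  obtain ⟨S, hS⟩ : ∃ S : ℝ → ℝ, S = fun Y => SS I t Y T := ⟨_, rfl⟩
  have hs : ∀ (Y L : ℝ), 4 ≤ Y → 1 + Real.log n ≤ L → 1 + Real.log ⌈Y⌉₊ ≤ L → S Y ≤ I.card * (1 / Y + 2 * L / h) + I.card * (I.card * (Y / T * L + √(Y * T0) / T)) := by
    intro Y L h1 h2 h3; rw [hS]; exact hs Y L h1 h2 h3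
  have e : SS I t (X / ρ) T = S (X / ρ) := by rw [hS]
  rw [e] at hd
  obtain ⟨κ, hκ⟩ : ∃ κ : ℝ, κ = I.card := ⟨_, rfl⟩
  have hκ0 : 0 ≤ κ := hκ ▸ Nat.cast_nonneg _
  rw [← hκ] at hd ht' hs hsm ⊢
  obtain ⟨D, hD⟩ : ∃ D : ℝ, D = DD M I t G X ρ := ⟨_, rfl⟩
  rw [← hD] at hd ht' ⊢
  clear hκ hD hS e
  obtain ⟨Q, hQ⟩ : ∃ Q : ℝ, Q = κ ^ 2 + T / G ^ 3 * κ + κ ^ 2 * (√T0 / (G * √G)) := ⟨_, rfl⟩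
  have T0p : 0 < T := by linarith
  have G0 : 0 < G := by linarith
  have hQκ : κ ^ 2 ≤ Q := by
    have : 0 ≤ T / G ^ 3 * κ := by positivity
    have : 0 ≤ κ ^ 2 * (√T0 / (G * √G)) := by positivity
    linarith
  rw [← hQ]
  have Q0 : 0 ≤ Q := le_trans (by positivity) hQκ
  have R10 : 1 ≤ R ^ 10 := one_le_pow₀ R1
  by_cases hc : X * R ≤ 4 * G * ρ
  · have h1 := ht' hc
    have h2 : D ^ 2 ≤ (Ct * κ) ^ 2 := by rw [← sq_abs D]; gcongr
    calc D ^ 2 ≤ Ct ^ 2 * κ ^ 2 := by rw [← mul_pow]; exact h2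
      _ ≤ Ct ^ 2 * (1 * Q) := by rw [one_mul]; gcongr
      _ ≤ Ct ^ 2 * (R ^ 10 * Q) := by gcongr
      _ ≤ _ := by gcongr; linarith [show 0 ≤ Cd * (257 + 24 * (1 + 8 / δ)) by positivity]
  · push Not at hc
    have ρ0 : 0 < ρ := by linarith
    have X0 : 0 < X := by rw [hX]; positivity
    have hYX : 4 * ρ ≤ X := by
      have h1 : G * (4 * ρ) ≤ G * X := by
        calc G * (4 * ρ) = 4 * G * ρ := by ring
          _ ≤ X * R := hc.le
          _ ≤ X * G := by gcongr
          _ = _ := by ring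
      exact le_of_mul_le_mul_left h1 G0
    have hd := hd hYX hM htT
    obtain ⟨Y, hY⟩ : ∃ Y : ℝ, Y = X / ρ := ⟨_, rfl⟩
    rw [← hY] at hd
    have Y4 : 4 ≤ Y := by rw [hY, le_div_iff₀ ρ0]; exact hYX
    have YR : 4 * G ≤ Y * R := by
      rw [hY, div_mul_eq_mul_div, le_div_iff₀ ρ0]; exact hc.le
    have YX : Y ≤ X := by rw [hY]; exact div_le_self X0.le hρ.le
    have TT : 2 * T ≤ T ^ 2 := by rw [pow_two]; gcongr
    have XT : 16 * (T * R) ≤ 16 * T ^ 2 := by rw [pow_two]; gcongr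
    have T8 : 64 * T ^ 2 ≤ T ^ 8 := by
      have : (2:ℝ) ^ 6 ≤ T ^ 6 := by gcongr
      calc 64 * T ^ 2 ≤ T ^ 6 * T ^ 2 := by gcongr; linarith
        _ = _ := by ring
    obtain ⟨L, hL⟩ : ∃ L : ℝ, L = (1 + 8 / δ) * R := ⟨_, rfl⟩
    have L1 : 1 + Real.log n ≤ L := by
      rw [hL, hR]; exact log_T hδ hT (by positivity) (by linarith)
    have L2 : 1 + Real.log ⌈Y⌉₊ ≤ L := by
      rw [hL, hR]; refine log_T hδ hT (by positivity) ?_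
      have := Nat.ceil_lt_add_one (show 0 ≤ Y by linarith)
      linarith
    have hL' : 1 ≤ L := by
      rw [hL]
      have : 0 < 8 / δ := by positivity
      exact one_le_mul_of_one_le_of_one_le (by linarith) R1
    have h3 := hs Y L Y4 L1 L2
    have h4 := n0_bound (h := h) hκ0 hsm R1 G1 hGh Y4 T1 YR (hX ▸ YX) hT0 hT0' hL'
    rw [← hQ] at h4
    have Y0 : 0 < Y := by linarith
    have N0p : 0 < 1 + T / Y ^ 2 := by positivity
    have h5 : (1 + T / Y ^ 2) * S Y ≤ 24 * (L * R ^ 3 * Q) := le_trans (mul_le_mul_of_nonneg_left h3 N0p.le) h4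
    have h6 : (1 + T / Y ^ 2) ^ (3 * δ) ≤ R ^ 6 := by
      have : T / Y ^ 2 ≤ T := div_le_self T0p.le (one_le_pow₀ (by linarith))
      calc (1 + T / Y ^ 2) ^ (3 * δ) ≤ (T ^ (2:ℝ)) ^ (3 * δ) := by
            apply Real.rpow_le_rpow N0p.le _ (by positivity)
            rw [Real.rpow_two]; linarith
        _ = R ^ 6 := by
            rw [hR, ← Real.rpow_natCast, ← Real.rpow_mul T0p.le, ← Real.rpow_mul T0p.le]; congr 1; push_cast; ring
    have XT' : X / T = 16 * R := by rw [hX]; field_simp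
    rw [XT'] at hd
    have R6 : R ^ 2 ≤ R ^ 10 := pow_le_pow_right₀ R1 (by norm_num)
    have R7 : R ^ 6 ≤ R ^ 10 := pow_le_pow_right₀ R1 (by norm_num)
    calc D ^ 2 ≤ Cd * ((16 * R) ^ 2 * κ ^ 2 + (1 + T / Y ^ 2) ^ (3 * δ) * ((1 + T / Y ^ 2) * S Y + κ ^ 2)) := hd
      _ ≤ Cd * ((16 * R) ^ 2 * κ ^ 2 + (1 + T / Y ^ 2) ^ (3 * δ) * (24 * (L * R ^ 3 * Q) + κ ^ 2)) := by gcongr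
      _ ≤ Cd * ((16 * R) ^ 2 * κ ^ 2 + R ^ 6 * (24 * (L * R ^ 3 * Q) + κ ^ 2)) := by gcongr
      _ = Cd * (256 * (R ^ 2 * κ ^ 2) + 24 * (1 + 8 / δ) * (R ^ 10 * Q) + R ^ 6 * κ ^ 2) := by rw [hL]; ring
      _ ≤ Cd * (256 * (R ^ 10 * Q) + 24 * (1 + 8 / δ) * (R ^ 10 * Q) + R ^ 10 * Q) := by gcongr
      _ = Cd * (257 + 24 * (1 + 8 / δ)) * (R ^ 10 * Q) := by ring
      _ ≤ _ := by gcongr; linarith [sq_nonneg Ct]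

set_option maxHeartbeats 1000000 in
lemma key_prop {δ : ℝ} (hδ : 0 < δ) (hδ' : δ ≤ 1 / 10) : ∃ C : ℝ, 0 < C ∧ ∀ (T G h t0 T0 : ℝ) (n : ℕ) (I : Finset ℕ) (t : ℕ → ℝ),
    2 ≤ T → T ^ (1 / 5 : ℝ) ≤ G → G ≤ T → G ≤ h → I ⊆ Finset.range n → (n:ℝ) ≤ T → (∀ i : ℕ, t i = t0 + i * h) →
    (∀ i ∈ I, T ≤ t i ∧ t i ≤ 2 * T) → (∀ i ∈ I, ∀ k ∈ I, |t i - t k| ≤ T0) → 0 ≤ T0 → T0 ≤ T →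
    (∑ i ∈ I, J 1 (t i) G) ^ 2 ≤ C * (T ^ δ) ^ 12 * ((I.card:ℝ) ^ 2 + T / G ^ 3 * I.card + I.card ^ 2 * (√T0 / (G * √G))) := by
  obtain ⟨K, hK⟩ := exists_nat_ge (1 / δ)
  obtain ⟨Ca, hCa, ha⟩ := avg_step K
  obtain ⟨C3, hC3, h3⟩ := dd_all hδ hδ' K
  refine ⟨2 * (Ca + 2 * (1 + 8 / δ)) ^ 2 + 32 * (1 + 8 / δ) ^ 2 * C3, by positivity, ?_⟩
  intro T G h t0 T0 n I t hT hTG hGT hGh hI hn ht htT htd hT0 hT0'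
  have T1 : 1 ≤ T := by linarith
  have T0p : 0 < T := by linarith
  obtain ⟨R, hR⟩ : ∃ R : ℝ, R = T ^ δ := ⟨_, rfl⟩
  have R1 : 1 ≤ R := hR ▸ Real.one_le_rpow T1 hδ.le
  have R0 : 0 < R := by linarith
  have G1 : 1 ≤ G := le_trans (Real.one_le_rpow T1 (by norm_num)) hTG
  have G0 : 0 < G := by linarith
  have RT : R ≤ T := le_trans (hR ▸ Real.rpow_le_rpow_of_exponent_le T1 (by linarith)) (hTG.trans hGT)
  have hRK : T ≤ R ^ K := by
    rw [hR, ← Real.rpow_natCast, ← Real.rpow_mul T0p.le]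
    conv_lhs => rw [← Real.rpow_one T]
    apply Real.rpow_le_rpow_of_exponent_le T1
    rw [div_le_iff₀ hδ] at hK; linarith
  obtain ⟨X, hX⟩ : ∃ X : ℝ, X = 16 * (T * R) := ⟨_, rfl⟩
  have X0 : 0 < X := by rw [hX]; positivity
  have hM : 2 * X ≤ (⌈2 * X⌉₊ : ℝ) := Nat.le_ceil _
  have hM' : (⌈2 * X⌉₊ : ℝ) ≤ 2 * X + 1 := (Nat.ceil_lt_add_one (by positivity)).le
  generalize ⌈2 * X⌉₊ = M at hM hM'
  have TT : 2 * T ≤ T ^ 2 := by rw [pow_two]; gcongr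
  have XT : X ≤ 16 * T ^ 2 := by rw [hX]; rw [pow_two]; gcongr
  have T8 : 64 * T ^ 2 ≤ T ^ 8 := by
    have : (2:ℝ) ^ 6 ≤ T ^ 6 := by gcongr
    calc 64 * T ^ 2 ≤ T ^ 6 * T ^ 2 := by gcongr; linarith
      _ = _ := by ring
  have h3 := fun (ρ : ℝ) (hρ : 1 < ρ) => h3 T G h t0 T0 R X ρ n M I t hT hTG hGT hGh hI hn ht htT htd hT0 hT0' hR hRK hX hM hM' hρ
  have ha := fun Mb => ha T G R X Mb I t M hT G1 hGT htT R1 hRK hX hM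
  have hS0 : 0 ≤ ∑ i ∈ I, J 1 (t i) G := Finset.sum_nonneg fun i _ => J_nonneg _ _ G0
  rw [← hR]
  obtain ⟨κ, hκ⟩ : ∃ κ : ℝ, κ = I.card := ⟨_, rfl⟩
  have hκ0 : 0 ≤ κ := hκ ▸ Nat.cast_nonneg _
  rw [← hκ] at h3 ha ⊢
  obtain ⟨Q, hQ⟩ : ∃ Q : ℝ, Q = κ ^ 2 + T / G ^ 3 * κ + κ ^ 2 * (√T0 / (G * √G)) := ⟨_, rfl⟩
  rw [← hQ] at h3 ⊢
  have hQκ : κ ^ 2 ≤ Q := by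
    have : 0 ≤ T / G ^ 3 * κ := by positivity
    have : 0 ≤ κ ^ 2 * (√T0 / (G * √G)) := by positivity
    linarith
  have Q0 : 0 ≤ Q := le_trans (by positivity) hQκ
  have h4 := ha (√(C3 * (R ^ 10 * Q))) (fun ρ hρ _ => Real.abs_le_sqrt (h3 ρ hρ))
  have l1 : 1 + Real.log M ≤ (1 + 8 / δ) * R := by
    rw [hR]; exact log_T hδ hT (by positivity) (by linarith)
  have l2 : Real.log (2 * X) ≤ (1 + 8 / δ) * R := by
    have := log_T hδ hT (show 0 ≤ 2 * X by positivity) (by linarith)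
    rw [hR]; linarith
  obtain ⟨c, hc⟩ : ∃ c, c = 1 + 8 / δ := ⟨_, rfl⟩
  rw [← hc] at l1 l2 ⊢
  have c0 : 0 < c := by rw [hc]; positivity
  obtain ⟨m, hm⟩ : ∃ m, m = √(C3 * (R ^ 10 * Q)) := ⟨_, rfl⟩
  rw [← hm] at h4
  have m0 : 0 ≤ m := hm ▸ Real.sqrt_nonneg _
  have m2 : m ^ 2 = C3 * (R ^ 10 * Q) := by rw [hm]; exact Real.sq_sqrt (by positivity)
  have h5 : ∑ i ∈ I, J 1 (t i) G ≤ κ * ((Ca + 2 * c) * R) + 4 * (m * (c * R)) := by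
    refine h4.trans ?_
    gcongr
    linarith
  have R12 : R ^ 2 ≤ R ^ 12 := pow_le_pow_right₀ R1 (by norm_num)
  calc (∑ i ∈ I, J 1 (t i) G) ^ 2 ≤ (κ * ((Ca + 2 * c) * R) + 4 * (m * (c * R))) ^ 2 := by gcongr
    _ ≤ 2 * (κ * ((Ca + 2 * c) * R)) ^ 2 + 2 * (4 * (m * (c * R))) ^ 2 := by
      linarith [sq_nonneg (κ * ((Ca + 2 * c) * R) - 4 * (m * (c * R)))]
    _ = 2 * (Ca + 2 * c) ^ 2 * (R ^ 2 * κ ^ 2) + 32 * c ^ 2 * R ^ 2 * m ^ 2 := by ring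
    _ = 2 * (Ca + 2 * c) ^ 2 * (R ^ 2 * κ ^ 2) + 32 * c ^ 2 * C3 * (R ^ 12 * Q) := by rw [m2]; ring
    _ ≤ 2 * (Ca + 2 * c) ^ 2 * (R ^ 12 * Q) + 32 * c ^ 2 * C3 * (R ^ 12 * Q) := by gcongr
    _ = _ := by ring


lemma window {κ T G B V q T0 s : ℝ} (hκ : 1 ≤ κ) (hG : 1 ≤ G) (hB : 1 ≤ B) (hq : 1 ≤ q) (hV : V ^ 2 = 4 * B * q)
    (hT0 : √T0 ≤ q * (G * √G)) (V0 : 0 < V) (hs : V * κ ≤ s) (key : s ^ 2 ≤ B * (κ ^ 2 + T / G ^ 3 * κ + κ ^ 2 * (√T0 / (G * √G)))) : κ ≤ T / (2 * q * G ^ 3) := by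
  have κ0 : 0 < κ := by linarith
  have G0 : 0 < G := by linarith
  have h1 : √T0 / (G * √G) ≤ q := by
    rw [div_le_iff₀ (by positivity)]; exact hT0
  have h2 : (V * κ) ^ 2 ≤ B * (κ ^ 2 * q + T / G ^ 3 * κ + κ ^ 2 * q) := by
    calc (V * κ) ^ 2 ≤ s ^ 2 := by gcongr
      _ ≤ _ := key
      _ ≤ B * (κ ^ 2 * q + T / G ^ 3 * κ + κ ^ 2 * q) := by
        gcongr
        exact le_mul_of_one_le_right (by positivity) hq
  rw [mul_pow, hV] at h2
  have h3 : (B * κ) * (2 * q * κ) ≤ (B * κ) * (T / G ^ 3) := by linarith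
  have h4 := le_of_mul_le_mul_left h3 (by positivity)
  rw [le_div_iff₀ (by positivity)] at h4 ⊢
  linarith

lemma level (I : Finset ℕ) (a t : ℕ → ℝ) {t0 h T G B V q : ℝ} (hT : 1 ≤ T) (hG : 1 ≤ G) (hTG : T ≤ G ^ 5) (hB : 1 ≤ B) (hq : 1 ≤ q) (hV : V ^ 2 = 4 * B * q) (V0 : 0 < V)
    (hh : 0 < h) (hnh : ∀ i ∈ I, (i:ℝ) * h ≤ T) (ht : ∀ i : ℕ, t i = t0 + i * h)
    (key : ∀ I' ⊆ I, ∀ T0, 0 ≤ T0 → T0 ≤ T → (∀ i ∈ I', ∀ k ∈ I', |t i - t k| ≤ T0) →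
      (∑ i ∈ I', a i) ^ 2 ≤ B * ((I'.card:ℝ) ^ 2 + T / G ^ 3 * I'.card + I'.card ^ 2 * (√T0 / (G * √G))))
    (ha : ∀ i ∈ I, V ≤ a i) (hne : I.Nonempty) : (I.card:ℝ) * (q ^ 2 * G) ≤ T ∧ 2 * q ≤ G ^ 2 := by
  have T0p : 0 < T := by linarith
  have G0 : 0 < G := by linarith
  have q0 : 0 < q := by linarith
  obtain ⟨T0, hT0⟩ : ∃ T0, T0 = min T (q ^ 2 * G ^ 3) := ⟨_, rfl⟩
  have P : 0 < T0 := by rw [hT0]; positivity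
  have PT : T0 ≤ T := by rw [hT0]; exact min_le_left _ _
  have sq : √T0 ≤ q * (G * √G) := by
    apply Real.sqrt_le_iff.2 ⟨by positivity, ?_⟩
    calc T0 ≤ q ^ 2 * G ^ 3 := by rw [hT0]; exact min_le_right _ _
      _ = q ^ 2 * (G ^ 2 * G) := by ring
      _ = q ^ 2 * (G ^ 2 * √G ^ 2) := by rw [Real.sq_sqrt G0.le]
      _ = _ := by ring
  have W : ∀ I' ⊆ I, I'.Nonempty → (∀ i ∈ I', ∀ k ∈ I', |t i - t k| ≤ T0) → (I'.card:ℝ) ≤ T / (2 * q * G ^ 3) := by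
    intro I' hI' hn hd
    refine window (by exact_mod_cast hn.card_pos) hG hB hq hV sq V0 ?_ (key I' hI' T0 P.le PT hd)
    have := Finset.card_nsmul_le_sum I' a V fun i hi => ha i (hI' hi)
    rw [nsmul_eq_mul] at this; linarith
  have hm : 1 ≤ T / (2 * q * G ^ 3) := by
    obtain ⟨i, hi⟩ := hne
    have := W {i} (by simpa using hi) (by simp) (by simp [P.le])
    simpa using this
  have h2 : 2 * q ≤ G ^ 2 := by
    rw [le_div_iff₀ (by positivity)] at hm
    have : G ^ 3 * (2 * q) ≤ G ^ 3 * G ^ 2 := by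
      calc G ^ 3 * (2 * q) ≤ T := by linarith
        _ ≤ _ := hTG
        _ = _ := by ring
    exact le_of_mul_le_mul_left this (by positivity)
  refine ⟨?_, h2⟩
  have hw : ∀ i ∈ I, ⌊(i:ℝ) * h / T0⌋₊ ∈ Finset.range (⌊T / T0⌋₊ + 1) := by
    intro i hi
    rw [Finset.mem_range]
    apply Nat.lt_succ_of_le
    apply Nat.floor_le_floor
    have := hnh i hi
    gcongr
  have h3 : (I.card:ℝ) ≤ (T / T0 + 1) * (T / (2 * q * G ^ 3)) := by
    rw [Finset.card_eq_sum_card_fiberwise hw, Nat.cast_sum]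
    calc _ ≤ ∑ w ∈ Finset.range (⌊T / T0⌋₊ + 1), T / (2 * q * G ^ 3) := by
          apply Finset.sum_le_sum
          intro w _
          rcases Finset.eq_empty_or_nonempty (I.filter fun i : ℕ => ⌊(i:ℝ) * h / T0⌋₊ = w) with h0 | h0
          · rw [h0]; simp; positivity
          · refine W _ (Finset.filter_subset _ _) h0 ?_
            intro i hi k hk
            rw [Finset.mem_filter] at hi hk
            have i1 := Nat.floor_le (show 0 ≤ (i:ℝ) * h / T0 by positivity)
            have i2 := Nat.lt_floor_add_one ((i:ℝ) * h / T0)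
            have k1 := Nat.floor_le (show 0 ≤ (k:ℝ) * h / T0 by positivity)
            have k2 := Nat.lt_floor_add_one ((k:ℝ) * h / T0)
            rw [hi.2] at i1 i2; rw [hk.2] at k1 k2
            rw [le_div_iff₀ P] at i1 k1
            rw [div_lt_iff₀ P] at i2 k2
            rw [ht, ht, abs_le]
            constructor <;> linarith
      _ = (⌊T / T0⌋₊ + 1) * (T / (2 * q * G ^ 3)) := by simp
      _ ≤ _ := by
          have := Nat.floor_le (show 0 ≤ T / T0 by positivity)
          gcongr
  have h4 : (T / T0 + 1) ≤ 2 * (T / T0) := by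
    have : 1 ≤ T / T0 := by rw [le_div_iff₀ P]; linarith
    linarith
  have h5 : (I.card:ℝ) * (q ^ 2 * G) ≤ 2 * (T / T0) * (T / (2 * q * G ^ 3)) * (q ^ 2 * G) := by
    gcongr; exact h3.trans (by gcongr)
  refine h5.trans ?_
  rcases min_choice T (q ^ 2 * G ^ 3) with hc | hc
  · rw [hT0, hc]
    calc 2 * (T / T) * (T / (2 * q * G ^ 3)) * (q ^ 2 * G) = T * (q / G ^ 2) := by field_simp
      _ ≤ T * 1 := by gcongr; rw [div_le_one (by positivity)]; linarith
      _ = T := mul_one _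
  · rw [hT0, hc]
    calc 2 * (T / (q ^ 2 * G ^ 3)) * (T / (2 * q * G ^ 3)) * (q ^ 2 * G) = T * (T / (q * G ^ 5)) := by field_simp
      _ ≤ T * 1 := by
        gcongr; rw [div_le_one (by positivity)]
        exact hTG.trans (le_mul_of_one_le_left (by positivity) hq)
      _ = T := mul_one _

/-- summation over dyadic levels -/
lemma levels (n : ℕ) (a t : ℕ → ℝ) {t0 h T G B : ℝ} (hT : 1 ≤ T) (hG : 1 ≤ G) (hGT : G ≤ T) (hTG : T ≤ G ^ 5) (hB : 1 ≤ B) (ha : ∀ i, 0 ≤ a i)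
    (hh : 0 < h) (hnh : ∀ i ∈ Finset.range n, (i:ℝ) * h ≤ T) (hn : n * G ≤ T) (ht : ∀ i : ℕ, t i = t0 + i * h)
    (key : ∀ I' ⊆ Finset.range n, ∀ T0, 0 ≤ T0 → T0 ≤ T → (∀ i ∈ I', ∀ k ∈ I', |t i - t k| ≤ T0) →
      (∑ i ∈ I', a i) ^ 2 ≤ B * ((I'.card:ℝ) ^ 2 + T / G ^ 3 * I'.card + I'.card ^ 2 * (√T0 / (G * √G)))) :
    (∑ i ∈ Finset.range n, a i ^ 4) * G ≤ 256 * (B ^ 2 * T * (3 + 2 * Real.log T)) := by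
  have T0p : 0 < T := by linarith
  have G0 : 0 < G := by linarith
  have B0 : 0 < B := by linarith
  have logT : 0 ≤ Real.log T := Real.log_nonneg hT
  obtain ⟨S, hS⟩ : ∃ S, S = 2 * √B := ⟨_, rfl⟩
  have S0 : 0 < S := by rw [hS]; positivity
  have S2 : S ^ 2 = 4 * B := by rw [hS, mul_pow, Real.sq_sqrt B0.le]; norm_num
  have S4 : S ^ 4 = 16 * B ^ 2 := by calc S ^ 4 = (S ^ 2) ^ 2 := by ring
    _ = _ := by rw [S2]; ring
  let f : ℕ → ℕ := fun i => Nat.log 2 ⌊a i / S⌋₊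
  have f1 : ∀ i, a i ≤ 2 * (2 ^ f i * S) := by
    intro i
    have h1 := Nat.lt_floor_add_one (a i / S)
    have h2 : ⌊a i / S⌋₊ + 1 ≤ 2 ^ (f i + 1) := Nat.lt_pow_succ_log_self (by norm_num) _
    have h3 : ((⌊a i / S⌋₊ + 1 : ℕ):ℝ) ≤ ((2 ^ (f i + 1) : ℕ) : ℝ) := by exact_mod_cast h2
    push_cast at h3
    rw [div_lt_iff₀ S0] at h1
    calc a i ≤ (⌊a i / S⌋₊ + 1) * S := h1.le
      _ ≤ 2 ^ (f i + 1) * S := by gcongr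
      _ = _ := by ring
  have f2 : ∀ i, f i ≠ 0 → 2 ^ f i * S ≤ a i := by
    intro i hi
    have h0 : ⌊a i / S⌋₊ ≠ 0 := by
      intro h; apply hi; simp [f, h]
    have h2 : 2 ^ f i ≤ ⌊a i / S⌋₊ := Nat.pow_log_le_self 2 h0
    have h3 : ((2 ^ f i : ℕ) : ℝ) ≤ (⌊a i / S⌋₊ : ℝ) := by exact_mod_cast h2
    push_cast at h3
    have h4 := Nat.floor_le (show 0 ≤ a i / S by have := ha i; positivity)
    rw [← le_div_iff₀ S0]; linarith
  have lev : ∀ j : ℕ, j ≠ 0 → ((Finset.range n).filter fun i => f i = j).Nonempty →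
      (((Finset.range n).filter fun i => f i = j).card : ℝ) * ((((2:ℝ) ^ j) ^ 2) ^ 2 * G) ≤ T ∧ 2 * ((2:ℝ) ^ j) ^ 2 ≤ G ^ 2 := by
    intro j hj hne
    refine level _ a t (V := 2 ^ j * S) hT hG hTG hB (one_le_pow₀ (one_le_pow₀ (by norm_num))) ?_ (by positivity) hh ?_ ht ?_ ?_ hne
    · rw [mul_pow, S2]; ring
    · intro i hi; exact hnh i (Finset.mem_of_mem_filter i hi)
    · intro I' hI'; exact key I' (hI'.trans (Finset.filter_subset _ _))
    · intro i hi
      rw [Finset.mem_filter] at hi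
      have := f2 i (hi.2 ▸ hj)
      rwa [hi.2] at this
  obtain ⟨N, hN⟩ : ∃ N, N = ⌊2 * Real.log T⌋₊ + 1 := ⟨_, rfl⟩
  have hN' : (N:ℝ) ≤ 2 * Real.log T + 1 := by
    rw [hN]; push_cast
    linarith [Nat.floor_le (show 0 ≤ 2 * Real.log T by positivity)]
  have maps : ∀ i ∈ Finset.range n, f i ∈ Finset.range (N + 1) := by
    intro i hi
    rw [Finset.mem_range]
    by_cases h0 : f i = 0
    · omega
    have h1 := (lev (f i) h0 ⟨i, by simp [Finset.mem_range.1 hi]⟩).2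
    have h2 : (2:ℝ) ^ f i ≤ T := by
      refine le_trans ?_ hGT
      refine le_of_sq_le_sq ?_ G0.le
      nlinarith [sq_nonneg ((2:ℝ) ^ f i)]
    have h3 : (f i : ℝ) * Real.log 2 ≤ Real.log T := by
      rw [← Real.log_pow]; exact Real.log_le_log (by positivity) h2
    have h4 : (f i:ℝ) ≤ 2 * Real.log T := by
      have := Real.log_two_gt_d9
      have : (f i : ℝ) * (1 / 2) ≤ f i * Real.log 2 := by gcongr; linarith
      linarith
    have := Nat.le_floor h4
    omega
  have big : ∀ j ∈ Finset.range (N + 1), (∑ i ∈ (Finset.range n).filter fun i => f i = j, a i ^ 4) * G ≤ 256 * (B ^ 2 * T) := by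
    intro j _
    have h1 : (∑ i ∈ (Finset.range n).filter fun i => f i = j, a i ^ 4) ≤ ((Finset.range n).filter fun i => f i = j).card * (2 * (2 ^ j * S)) ^ 4 := by
      rw [← nsmul_eq_mul]
      apply Finset.sum_le_card_nsmul
      intro i hi
      rw [Finset.mem_filter] at hi
      have := f1 i
      rw [hi.2] at this
      have := ha i
      gcongr
    have h2 : (((Finset.range n).filter fun i => f i = j).card : ℝ) * ((((2:ℝ) ^ j) ^ 2) ^ 2 * G) ≤ T := by
      rcases Finset.eq_empty_or_nonempty ((Finset.range n).filter fun i => f i = j) with h0 | h0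
      · rw [h0]; simpa using T0p.le
      by_cases hj : j = 0
      · have : (((Finset.range n).filter fun i => f i = j).card : ℝ) ≤ n := by
          have := Finset.card_filter_le (Finset.range n) fun i => f i = j
          rw [Finset.card_range] at this
          exact_mod_cast this
        rw [hj] at this ⊢
        calc _ ≤ (n:ℝ) * ((((2:ℝ) ^ 0) ^ 2) ^ 2 * G) := by gcongr
          _ = n * G := by norm_num
          _ ≤ T := hn
      · exact (lev j hj h0).1
    generalize (((Finset.range n).filter fun i => f i = j).card : ℝ) = κ at h1 h2
    calc _ ≤ κ * (2 * (2 ^ j * S)) ^ 4 * G := by gcongr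
      _ = 16 * S ^ 4 * (κ * ((((2:ℝ) ^ j) ^ 2) ^ 2 * G)) := by ring
      _ ≤ 16 * S ^ 4 * T := by gcongr
      _ = _ := by rw [S4]; ring
  rw [← Finset.sum_fiberwise_of_maps_to maps, Finset.sum_mul]
  calc _ ≤ ∑ j ∈ Finset.range (N + 1), 256 * (B ^ 2 * T) := Finset.sum_le_sum big
    _ = (N + 1) * (256 * (B ^ 2 * T)) := by simp
    _ ≤ (2 * Real.log T + 1 + 1) * (256 * (B ^ 2 * T)) := by gcongr
    _ ≤ (3 + 2 * Real.log T) * (256 * (B ^ 2 * T)) := mul_le_mul_of_nonneg_right (by linarith) (by positivity)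
    _ = _ := by ring


lemma sum_bound {δ : ℝ} (hδ : 0 < δ) (hδ' : δ ≤ 1 / 10) : ∃ C : ℝ, 0 < C ∧ ∀ (T G h t0 : ℝ) (n : ℕ),
    2 ≤ T → T ^ (1 / 5 : ℝ) ≤ G → G ≤ T → G ≤ h → (n:ℝ) * h ≤ T → T ≤ t0 → t0 + n * h ≤ 2 * T + h →
    (∑ i ∈ Finset.range n, J 1 (t0 + i * h) G ^ 4) * G ≤ C * (T ^ δ) ^ 25 * T := by
  obtain ⟨C, hC, hk⟩ := key_prop hδ hδ'
  refine ⟨256 * ((C + 1) ^ 2 * (3 * (1 + 8 / δ))), by positivity, ?_⟩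
  intro T G h t0 n hT hTG hGT hGh hn ht0 ht1
  have T1 : 1 ≤ T := by linarith
  have T0p : 0 < T := by linarith
  obtain ⟨R, hR⟩ : ∃ R : ℝ, R = T ^ δ := ⟨_, rfl⟩
  have R1 : 1 ≤ R := hR ▸ Real.one_le_rpow T1 hδ.le
  have R0 : 0 < R := by linarith
  have G1 : 1 ≤ G := le_trans (Real.one_le_rpow T1 (by norm_num)) hTG
  have G0 : 0 < G := by linarith
  have h0 : 0 < h := by linarith
  have TG5 : T ≤ G ^ 5 := by
    calc T = (T ^ (1 / 5 : ℝ)) ^ 5 := by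
          rw [← Real.rpow_natCast, ← Real.rpow_mul T0p.le]; norm_num
      _ ≤ G ^ 5 := by gcongr
  have nG : (n:ℝ) * G ≤ T := le_trans (by gcongr) hn
  have nT : (n:ℝ) ≤ T := le_trans (le_mul_of_one_le_right (by positivity) G1) nG
  have hi : ∀ i ∈ Finset.range n, ((i:ℝ) + 1) * h ≤ n * h := by
    intro i hi
    have : i + 1 ≤ n := Finset.mem_range.1 hi
    have : (i:ℝ) + 1 ≤ n := by exact_mod_cast this
    gcongr
  have hB : 1 ≤ (C + 1) * R ^ 12 := one_le_mul_of_one_le_of_one_le (by linarith) (one_le_pow₀ R1)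
  have main := levels n (fun i => J 1 (t0 + i * h) G) (fun i => t0 + i * h) (t0 := t0) (h := h) (T := T) (G := G) (B := (C + 1) * R ^ 12)
    T1 G1 hGT TG5 hB (fun i => J_nonneg _ _ G0) h0 (fun i hi' => by have := hi i hi'; linarith) nG (fun i => rfl) (by
      intro I' hI' T0 a1 a2 a3
      have := hk T G h t0 T0 n I' (fun i => t0 + i * h) hT hTG hGT hGh hI' nT (fun i => rfl) (fun i hi' => by
        have := hi i (hI' hi')
        have : 0 ≤ (i:ℝ) * h := by positivity
        constructor <;> linarith) a3 a1 a2
      rw [← hR] at this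
      refine this.trans ?_
      have k0 : (0:ℝ) ≤ I'.card := Nat.cast_nonneg _
      generalize (I'.card : ℝ) = κ at k0
      gcongr
      linarith)
  rw [← hR]
  refine main.trans ?_
  have l := log_T hδ hT T0p.le (le_self_pow₀ T1 (by norm_num))
  rw [← hR] at l
  have l' : 3 + 2 * Real.log T ≤ 3 * ((1 + 8 / δ) * R) := by
    have : 0 ≤ Real.log T := Real.log_nonneg T1
    linarith
  calc 256 * (((C + 1) * R ^ 12) ^ 2 * T * (3 + 2 * Real.log T)) ≤ 256 * (((C + 1) * R ^ 12) ^ 2 * T * (3 * ((1 + 8 / δ) * R))) := by gcongr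
    _ = _ := by ring

lemma int_bound {δ : ℝ} (hδ : 0 < δ) (hδ' : δ ≤ 1 / 10) : ∃ C : ℝ, 0 < C ∧ ∀ (T G : ℝ),
    2 ≤ T → T ^ (1 / 5 : ℝ) ≤ G → G ≤ T → (∫ t in T..(2 * T), J 1 t G ^ 4) ≤ C * (T ^ δ) ^ 25 * T := by
  obtain ⟨C, hC, hs⟩ := sum_bound hδ hδ'
  refine ⟨2 * C, by positivity, ?_⟩
  intro T G hT hTG hGT
  have T1 : 1 ≤ T := by linarith
  have T0p : 0 < T := by linarith
  have G1 : 1 ≤ G := le_trans (Real.one_le_rpow T1 (by norm_num)) hTG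
  have G0 : 0 < G := by linarith
  by_cases hint : IntervalIntegrable (fun t => J 1 t G ^ 4) volume T (2 * T)
  swap
  · rw [intervalIntegral.integral_undef hint]; positivity
  obtain ⟨n, hn⟩ : ∃ n, n = ⌊T / G⌋₊ := ⟨_, rfl⟩
  have n1 : 1 ≤ n := by
    rw [hn]; apply Nat.le_floor; rw [Nat.cast_one, le_div_iff₀ G0]; linarith
  have n1' : (1:ℝ) ≤ n := by exact_mod_cast n1
  have n0 : (0:ℝ) < n := by linarith
  have n2 : (n:ℝ) * G ≤ T := by
    have := Nat.floor_le (show 0 ≤ T / G by positivity)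
    rw [← hn, le_div_iff₀ G0] at this; exact this
  have n3 : T ≤ ((n:ℝ) + 1) * G := by
    have := Nat.lt_floor_add_one (T / G)
    rw [← hn, div_lt_iff₀ G0] at this; exact this.le
  obtain ⟨h, hh⟩ : ∃ h, h = T / n := ⟨_, rfl⟩
  have hnh : n * h = T := by rw [hh]; field_simp
  have hG : G ≤ h := by rw [hh, le_div_iff₀ n0]; linarith
  have hG2 : h ≤ 2 * G := by rw [hh, div_le_iff₀ n0]; nlinarith
  have h0 : 0 < h := by linarith
  have pc : ∀ k < n, IntervalIntegrable (fun t => J 1 t G ^ 4) volume (T + k * h) (T + (k + 1 : ℕ) * h) := by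
    intro k hk
    apply hint.mono_set
    have : ((k + 1 : ℕ):ℝ) * h ≤ n * h := by gcongr; omega
    push_cast at this ⊢
    have : 0 ≤ (k:ℝ) * h := by positivity
    rw [Set.uIcc_of_le (by linarith), Set.uIcc_of_le (by linarith)]
    apply Set.Icc_subset_Icc <;> linarith
  have e1 := intervalIntegral.sum_integral_adjacent_intervals (a := fun k : ℕ => T + k * h) pc
  have e2 : T + (n:ℝ) * h = 2 * T := by linarith
  simp only [e2, Nat.cast_zero, zero_mul, add_zero] at e1
  have e3 : ∀ k : ℕ, ∫ x in (T + k * h)..(T + (k + 1 : ℕ) * h), J 1 x G ^ 4 = ∫ v in (0:ℝ)..h, J 1 (T + k * h + v) G ^ 4 := by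
    intro k
    rw [intervalIntegral.integral_comp_add_left (fun x => J 1 x G ^ 4) (T + k * h)]
    congr 1 <;> push_cast <;> ring
  rw [← e1, Finset.sum_congr rfl fun k _ => e3 k, ← intervalIntegral.integral_finsetSum]
  swap
  · intro k hk
    have := (pc k (Finset.mem_range.1 hk)).comp_add_left (T + k * h)
    have a1 : T + (k:ℝ) * h - (T + k * h) = 0 := by ring
    have a2 : T + ((k + 1 : ℕ):ℝ) * h - (T + k * h) = h := by push_cast; ring
    rw [a1, a2] at this
    exact this
  have B := intervalIntegral.norm_integral_le_of_norm_le_const (a := 0) (b := h) (C := C * (T ^ δ) ^ 25 * T / G)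
    (f := fun v => ∑ k ∈ Finset.range n, J 1 (T + k * h + v) G ^ 4) (by
      intro v hv
      rw [Set.uIoc_of_le h0.le] at hv
      have p : 0 ≤ ∑ k ∈ Finset.range n, J 1 (T + k * h + v) G ^ 4 := Finset.sum_nonneg fun k _ => by positivity
      rw [Real.norm_of_nonneg p, le_div_iff₀ G0]
      have := hs T G h (T + v) n hT hTG hGT hG hnh.le (by linarith [hv.1]) (by linarith [hv.2])
      refine le_trans (le_of_eq ?_) this
      congr 1
      refine Finset.sum_congr rfl fun k _ => ?_
      congr 2; ring)
  refine (Real.le_norm_self _).trans (B.trans ?_)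
  rw [sub_zero, abs_of_pos h0]
  calc C * (T ^ δ) ^ 25 * T / G * h ≤ C * (T ^ δ) ^ 25 * T / G * (2 * G) := by gcongr
    _ = _ := by field_simp

end FM

/-- For every `ε > 0`, `∫_T^{2T} J_1(t,G)^4 dt ≪_ε T^{1+ε}` uniformly for
`T^{1/5+ε} ≤ G ≤ T`, `T ≥ 2`. -/
theorem fourth_moment_J1 :
    ∀ ε : ℝ, 0 < ε → ∃ C : ℝ, 0 < C ∧
      ∀ T G : ℝ, 2 ≤ T → T ^ (1 / 5 + ε) ≤ G → G ≤ T →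
        (∫ t in T..(2 * T), J 1 t G ^ 4) ≤ C * T ^ (1 + ε) := by
  intro ε hε
  obtain ⟨δ, hδ⟩ : ∃ δ, δ = min (1 / 10) (ε / 25) := ⟨_, rfl⟩
  have d0 : 0 < δ := by rw [hδ]; positivity
  have d1 : δ ≤ 1 / 10 := by rw [hδ]; exact min_le_left _ _
  have d2 : δ ≤ ε / 25 := by rw [hδ]; exact min_le_right _ _
  obtain ⟨C, hC, h⟩ := FM.int_bound d0 d1
  refine ⟨C, hC, ?_⟩
  intro T G hT hTG hGT
  have T1 : 1 ≤ T := by linarith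
  have T0 : 0 < T := by linarith
  have h1 : T ^ (1 / 5 : ℝ) ≤ G := le_trans (Real.rpow_le_rpow_of_exponent_le T1 (by linarith)) hTG
  refine (h T G hT h1 hGT).trans ?_
  rw [mul_assoc]
  refine mul_le_mul_of_nonneg_left ?_ hC.le
  rw [← Real.rpow_natCast, ← Real.rpow_mul T0.le, add_comm, Real.rpow_add T0, Real.rpow_one]
  refine mul_le_mul_of_nonneg_right (Real.rpow_le_rpow_of_exponent_le T1 ?_) T0.le
  push_cast; linarith
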